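/- arXiv:1604.00303 — 3 statements merged into one kernel-verified Lean document; each statement's English description precedes it below -/
import Mathlib

section
/- For every integer d ≥ 3 and every λ ∈ ℂ with Re λ ≥ 0 and λ ≠ 1, the only function u : ℝ → ℂ that is smooth (C^∞) on [0,1] and satisfies the mode equation (1−ρ²)u''(ρ) + ((d−1)/ρ − 2(λ+1)ρ)u'(ρ) − λ(λ+1)u(ρ) − V(ρ)u(ρ) = 0 for all ρ ∈ (0,1) is u ≡ 0. In other words, the Bizoń–Biernat self-similar wave map is mode stable: its only unstable mode occurs at the symmetry eigenvalue λ = 1. -/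
/-- The linearized potential around the Bizoń–Biernat profile. -/
noncomputable def V (d : ℕ) (ρ : ℝ) : ℂ :=
  (((d : ℂ) - 1) / (ρ : ℂ) ^ 2) *
    (((ρ : ℂ) ^ 4 + (12 - 6 * (d : ℂ)) * (ρ : ℂ) ^ 2 + ((d : ℂ) - 2) ^ 2) /
      ((ρ : ℂ) ^ 2 + (d : ℂ) - 2) ^ 2)

namespace MS

/-- recurrence coefficients -/
noncomputable def cX (m : ℝ) (l : ℂ) (n : ℕ) : ℂ :=
  m * (2 * n + l + 5) * (2 * n + l - 1) + 4 * (n + 1) * (2 * n + l + 1) - 8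
noncomputable def cP (l : ℂ) (n : ℕ) : ℂ := (2 * n + l - 3) * (2 * n + l + 3)
noncomputable def cR (m : ℝ) (n : ℕ) : ℝ := 2 * (m + 1) * (n + 1) * (2 * n + m + 4)

/-- power series coefficients of the regular solution at zero -/
noncomputable def co (m : ℝ) (l : ℂ) : ℕ → ℂ
  | 0 => 1
  | 1 => cX m l 0 / cR m 0
  | (n + 2) => (cX m l (n + 1) * co m l (n + 1) - cP l (n + 1) * co m l n) / cR m (n + 1)

lemma cR_pos {m : ℝ} (hm : 1 ≤ m) (n : ℕ) : 0 < cR m n := by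
  unfold cR; positivity

lemma co_rec {m : ℝ} (hm : 1 ≤ m) (l : ℂ) (n : ℕ) :
    (cR m (n + 1) : ℂ) * co m l (n + 2) =
      cX m l (n + 1) * co m l (n + 1) - cP l (n + 1) * co m l n := by
  have h : (cR m (n + 1) : ℂ) ≠ 0 := by exact_mod_cast (cR_pos hm (n + 1)).ne'
  rw [co]; field_simp

lemma co_rec0 {m : ℝ} (hm : 1 ≤ m) (l : ℂ) :
    (cR m 0 : ℂ) * co m l 1 = cX m l 0 * co m l 0 := by
  have h : (cR m 0 : ℂ) ≠ 0 := by exact_mod_cast (cR_pos hm 0).ne'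
  rw [co, co]; field_simp

lemma re_inv_eq (v : ℂ) : (1 / v).re = v.re / ‖v‖ ^ 2 := by
  rw [one_div, Complex.inv_re, Complex.normSq_eq_norm_sq]

/-- The scalar inequality behind the induction step. -/
lemma scalar_ineq {m n s x : ℝ} (hm : 1 ≤ m) (hn : 2 ≤ n) (hx : 2 * n - 1 ≤ x) (hs : 0 < s)
    (hsx : s * x ≤ 1) :
    2 * (m + 1) * (n + 1) * (2 * n + m + 4) / (3 * n + m + 1) + (1 + 4 * s) * (3 * n + m - 2) ≤
      m * (x + 6) + 4 * (n + 1) + 8 * n * (x * s ^ 2) := by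
  have h1 : 8 * n * ((2 * n - 1) * s ^ 2) ≤ 8 * n * (x * s ^ 2) := by gcongr
  have h2 : m * (2 * n + 5) ≤ m * (x + 6) := by nlinarith
  have hD : (0:ℝ) < 2 * n - 1 := by linarith
  -- introduce the slack variable φ
  obtain ⟨φ, hφ⟩ : ∃ φ, φ = 1 - (2 * n - 1) * s := ⟨_, rfl⟩
  have hφ0 : 0 ≤ φ := by
    have : (2 * n - 1) * s ≤ x * s := by gcongr
    rw [hφ]; nlinarith
  have hs' : s = (1 - φ) / (2 * n - 1) := by rw [hφ]; field_simp; ring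
  have h3 : 8 * n * ((2 * n - 1) * s ^ 2) - 4 * s * (3 * n + m - 2)
      ≥ (8 * n - 4 * (3 * n + m - 2)) / (2 * n - 1) - (n + 1) ^ 2 / (2 * n * (2 * n - 1)) := by
    have e : 8 * n * ((2 * n - 1) * s ^ 2) - 4 * s * (3 * n + m - 2) -
      ((8 * n - 4 * (3 * n + m - 2)) / (2 * n - 1) - (n + 1) ^ 2 / (2 * n * (2 * n - 1)))
      = (φ * (m - 1) * 8 * n + (4 * n * φ - (n + 1)) ^ 2) / (2 * n * (2 * n - 1)) := by
      rw [hs']; field_simp; ring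
    have : 0 ≤ (φ * (m - 1) * 8 * n + (4 * n * φ - (n + 1)) ^ 2) / (2 * n * (2 * n - 1)) := by
      have : 0 ≤ m - 1 := by linarith
      positivity
    linarith
  have h4 : 0 ≤ m * (2 * n + 5) + 4 * (n + 1) - (3 * n + m - 2)
      - 2 * (m + 1) * (n + 1) * (2 * n + m + 4) / (3 * n + m + 1)
      + ((8 * n - 4 * (3 * n + m - 2)) / (2 * n - 1) - (n + 1) ^ 2 / (2 * n * (2 * n - 1))) := by
    obtain ⟨a, rfl⟩ : ∃ a, n = a + 2 := ⟨n - 2, by ring⟩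
    obtain ⟨b, rfl⟩ : ∃ b, m = b + 1 := ⟨m - 1, by ring⟩
    have ha : 0 ≤ a := by linarith
    have hb : 0 ≤ b := by linarith
    have h5 : (0:ℝ) < 2 * (a + 2) - 1 := by linarith
    have h6 : (0:ℝ) < 3 * (a + 2) + (b + 1) + 1 := by linarith
    rw [show (b + 1) * (2 * (a + 2) + 5) + 4 * (a + 2 + 1) - (3 * (a + 2) + (b + 1) - 2)
      - 2 * ((b + 1) + 1) * ((a + 2) + 1) * (2 * (a + 2) + (b + 1) + 4) / (3 * (a + 2) + (b + 1) + 1)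
      + ((8 * (a + 2) - 4 * (3 * (a + 2) + (b + 1) - 2)) / (2 * (a + 2) - 1)
        - ((a + 2) + 1) ^ 2 / (2 * (a + 2) * (2 * (a + 2) - 1)))
      = (((b + 1) * (2 * (a + 2) + 5) + 4 * (a + 2 + 1) - (3 * (a + 2) + (b + 1) - 2)) *
          ((3 * (a + 2) + (b + 1) + 1) * (2 * (a + 2) * (2 * (a + 2) - 1)))
        - 2 * ((b + 1) + 1) * ((a + 2) + 1) * (2 * (a + 2) + (b + 1) + 4) *
           (2 * (a + 2) * (2 * (a + 2) - 1))
        + (8 * (a + 2) - 4 * (3 * (a + 2) + (b + 1) - 2)) * (2 * (a + 2)) *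
            (3 * (a + 2) + (b + 1) + 1)
        - ((a + 2) + 1) ^ 2 * (3 * (a + 2) + (b + 1) + 1)) /
        ((3 * (a + 2) + (b + 1) + 1) * (2 * (a + 2) * (2 * (a + 2) - 1))) by field_simp; ring]
    apply div_nonneg _ (by positivity)
    ring_nf
    positivity
  nlinarith

lemma step_ineq {m n : ℝ} {v : ℂ} (hm : 1 ≤ m) (hn : 2 ≤ n) (hv : 2 * n - 1 ≤ v.re) :
    2 * (m + 1) * (n + 1) * (2 * n + m + 4) / (3 * n + m + 1) + ‖1 + 4 / v‖ * (3 * n + m - 2) ≤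
      ‖(m * (v + 6) + 4 * (n + 1) + 8 * n * (1 / v) : ℂ)‖ := by
  have hre : 0 < v.re := by linarith
  have hv0 : v ≠ 0 := by rintro rfl; simp at hre
  have hnv : 0 < ‖v‖ := norm_pos_iff.2 hv0
  have h1 := scalar_ineq (m := m) (n := n) (s := 1 / ‖v‖) (x := v.re) hm hn hv (by positivity)
    (by rw [div_mul_eq_mul_div, one_mul]; exact div_le_one_of_le₀ (Complex.re_le_norm v) hnv.le)
  have h2 : ‖1 + 4 / v‖ ≤ 1 + 4 * (1 / ‖v‖) := by
    refine (norm_add_le _ _).trans ?_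
    simp [div_eq_mul_inv]
  have h3 : ‖1 + 4 / v‖ * (3 * n + m - 2) ≤ (1 + 4 * (1 / ‖v‖)) * (3 * n + m - 2) := by
    apply mul_le_mul_of_nonneg_right h2; linarith
  have h4 := Complex.re_le_norm (m * (v + 6) + 4 * (n + 1) + 8 * n * (1 / v) : ℂ)
  have h5 : (m * (v + 6) + 4 * (n + 1) + 8 * n * (1 / v) : ℂ).re =
      m * (v.re + 6) + 4 * (n + 1) + 8 * n * (v.re * (1 / ‖v‖) ^ 2) := by
    have e : (m * (v + 6) + 4 * (n + 1) + 8 * n * (1 / v) : ℂ) =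
      ((m : ℝ) : ℂ) * (v + 6) + ((4 * (n + 1) : ℝ) : ℂ) + ((8 * n : ℝ) : ℂ) * (1 / v) := by
      push_cast; ring
    rw [e, Complex.add_re, Complex.add_re, Complex.re_ofReal_mul, Complex.re_ofReal_mul, re_inv_eq]
    simp [div_eq_mul_inv]
  rw [h5] at h4
  linarith

lemma start_ineq {m : ℝ} {v : ℂ} (hm : 1 ≤ m) (hv : 1 ≤ v.re) :
    4 * (m + 1) * (m + 6) / (m + 4) ≤
     ‖(m * (v + 6) + 8 - 2 * m * (1 / v) - 2 * (m + 4) * (1 / (m * v + 4 * m + 4)) : ℂ)‖ := by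
  have hre : 0 < v.re := by linarith
  have hv0 : v ≠ 0 := by rintro rfl; simp at hre
  have key : ∀ (c : ℝ) (z : ℂ), 0 < c → c ≤ z.re → (1 / z).re ≤ 1 / c := by
    intro c z hc hz
    have hz0 : z ≠ 0 := by rintro rfl; simp at hz; linarith
    have : 0 < ‖z‖ := norm_pos_iff.2 hz0
    rw [re_inv_eq, div_le_div_iff₀ (by positivity) hc]
    have := Complex.re_le_norm z
    nlinarith
  have h1 := key 1 v one_pos hv
  have h2 := key (5 * m + 4) (m * v + 4 * m + 4) (by linarith) (by simp; nlinarith)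
  refine le_trans ?_ (Complex.re_le_norm _)
  have e : (m * (v + 6) + 8 - 2 * m * (1 / v) - 2 * (m + 4) * (1 / (m * v + 4 * m + 4)) : ℂ)
    = ((m : ℝ) : ℂ) * (v + 6) + ((8 : ℝ) : ℂ) - ((2 * m : ℝ) : ℂ) * (1 / v)
      - ((2 * (m + 4) : ℝ) : ℂ) * (1 / (m * v + 4 * m + 4)) := by push_cast; ring
  rw [e, Complex.sub_re, Complex.sub_re, Complex.add_re, Complex.re_ofReal_mul,
    Complex.re_ofReal_mul, Complex.re_ofReal_mul, Complex.ofReal_re]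
  have h3 : 2 * m * (1 / v).re ≤ 2 * m := by nlinarith
  have h4 : 2 * (m + 4) * (1 / (m * v + 4 * m + 4)).re ≤ 2 * (m + 4) * (1 / (5 * m + 4)) := by
    gcongr
  have h5 : 7 * m ≤ m * (v + 6).re := by simp; nlinarith
  have h6 : 4 * (m + 1) * (m + 6) / (m + 4) ≤ 7 * m + 8 - 2 * m - 2 * (m + 4) * (1 / (5 * m + 4)) := by
    obtain ⟨b, rfl⟩ : ∃ b, m = b + 1 := ⟨m - 1, by ring⟩
    have hb : 0 ≤ b := by linarith
    rw [mul_one_div, le_sub_iff_add_le, div_add_div _ _ (by positivity) (by positivity),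
      div_le_iff₀ (by positivity)]
    nlinarith [mul_nonneg hb hb, mul_nonneg hb (mul_nonneg hb hb), mul_nonneg hb (sq_nonneg (b-1))]
  linarith

lemma co_one_ne {m : ℝ} (hm : 1 ≤ m) {l : ℂ} (hl : 0 ≤ l.re) (hne : l ≠ 1) : co m l 1 ≠ 0 := by
  have h : (cR m 0 : ℂ) ≠ 0 := by exact_mod_cast (cR_pos hm 0).ne'
  rw [co]
  refine div_ne_zero ?_ h
  have : cX m l 0 = (l - 1) * (m * l + 5 * m + 4) := by unfold cX; push_cast; ring
  rw [this]
  refine mul_ne_zero (sub_ne_zero.2 hne) ?_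
  intro h0
  have := congrArg Complex.re h0
  simp at this
  nlinarith

lemma co_lower {m : ℝ} (hm : 1 ≤ m) {l : ℂ} (hl : 0 ≤ l.re) (hne : l ≠ 1) (n : ℕ) :
    co m l (n + 1) ≠ 0 ∧
    ‖(2 * n + 1 + l : ℂ)‖ * ‖co m l (n + 1)‖ ≤ (3 * n + m + 4) * ‖co m l (n + 2)‖ := by
  induction n with
  | zero =>
    refine ⟨co_one_ne hm hl hne, ?_⟩
    obtain ⟨v, hv⟩ : ∃ v, v = 1 + l := ⟨_, rfl⟩
    have hl' : l = v - 1 := by rw [hv]; ring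
    have hvre : 1 ≤ v.re := by rw [hv]; simp [hl]
    have hv0 : v ≠ 0 := by rintro rfl; simp at hvre; linarith
    have hq0 : (m * v + 4 * m + 4 : ℂ) ≠ 0 := by
      intro h0
      have := congrArg Complex.re h0
      simp at this
      nlinarith
    have h0 := co_rec0 hm l
    have h1 := co_rec hm l 0
    have hR1 : cR m 1 = 4 * (m + 1) * (m + 6) := by unfold cR; push_cast; ring
    have hR0 : cR m 0 = 2 * (m + 1) * (m + 4) := by unfold cR; push_cast; ring
    have hX0 : cX m l 0 = (v - 2) * (m * v + 4 * m + 4) := by unfold cX; rw [hl']; push_cast; ring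
    have hc0 : co m l 0 = 1 := by rw [co]
    have hne2 : v - 2 ≠ 0 := by
      intro h; apply hne; rw [hl']; linear_combination h
    have hkey : (cR m 1 : ℂ) * co m l 2 = v * co m l 1 *
      (m * (v + 6) + 8 - 2 * m * (1 / v) - 2 * (m + 4) * (1 / (m * v + 4 * m + 4))) := by
      have hP : cP l 1 = (v - 2) * (v + 4) := by unfold cP; rw [hl']; push_cast; ring
      have hX1 : cX m l 1 = v * (m * (v + 6)) + 8 * (v + 2) - 8 := by
        unfold cX; rw [hl']; push_cast; ring
      simp only [zero_add] at h1
      rw [h1, hP, hX1, hc0]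
      rw [hR0, hX0, hc0] at h0
      push_cast at h0
      have hi := mul_one_div_cancel hq0
      have hj := mul_one_div_cancel hv0
      generalize (1 / (m * v + 4 * m + 4) : ℂ) = i at *
      generalize (1 / v : ℂ) = j at *
      have h0' : (v - 2) = 2 * (m + 1) * (m + 4) * co m l 1 * i := by
        linear_combination (-(v - 2)) * hi - i * h0
      linear_combination (-(v + 4)) * h0' + 2 * m * co m l 1 * hj - 2 * (m + 4) * co m l 1 * hi
    have hst := start_ineq hm hvre
    have hn := congrArg norm hkey
    rw [norm_mul, norm_mul, norm_mul, hR1, Complex.norm_real, Real.norm_of_nonneg (by positivity)] at hn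
    have e : (2 * ((0:ℕ) : ℂ) + 1 + l) = v := by rw [hv]; simp
    rw [e]
    simp only [Nat.cast_zero, mul_zero, zero_add]
    rw [div_le_iff₀ (by positivity)] at hst
    have hp : (0:ℝ) < 4 * (m + 1) * (m + 6) := by positivity
    have : 4 * (m + 1) * (m + 6) * (‖v‖ * ‖co m l 1‖) ≤ 4 * (m + 1) * (m + 6) * ((m + 4) * ‖co m l 2‖) := by
      calc _ ≤ _ := mul_le_mul_of_nonneg_right hst (by positivity)
        _ = (m + 4) * (4 * (m + 1) * (m + 6) * ‖co m l 2‖) := by rw [hn]; ring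
        _ = _ := by ring
    exact le_of_mul_le_mul_left this hp
  | succ n ih =>
    obtain ⟨ih1, ih2⟩ := ih
    have hne' : co m l (n + 2) ≠ 0 := by
      intro h
      rw [h, norm_zero, mul_zero] at ih2
      have h1 : (2 * n + 1 + l : ℂ) ≠ 0 := by
        intro h0
        have := congrArg Complex.re h0
        simp at this
        have hn : (0:ℝ) ≤ n := Nat.cast_nonneg n
        nlinarith
      have := mul_pos (norm_pos_iff.2 h1) (norm_pos_iff.2 ih1)
      linarith
    refine ⟨hne', ?_⟩
    obtain ⟨v, hv⟩ : ∃ v : ℂ, v = 2 * n + 3 + l := ⟨_, rfl⟩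
    have hl' : l = v - 2 * n - 3 := by rw [hv]; ring
    have hn : (0:ℝ) ≤ n := Nat.cast_nonneg n
    have hvre : 2 * ((n:ℝ) + 2) - 1 ≤ v.re := by rw [hv]; simp; linarith
    have hv0 : v ≠ 0 := by rintro rfl; simp at hvre; linarith
    have hst := step_ineq (n := (n:ℝ) + 2) hm (by linarith) hvre
    have h1 := co_rec hm l (n + 1)
    have hP : cP l (n + 2) = (2 * n + 1 + l) * (v + 4) := by
      unfold cP; rw [hv]; push_cast; ring
    have hX : cX m l (n + 2) = v *
      (m * (v + 6) + 4 * (((n + 2 : ℝ) : ℂ) + 1) + 8 * ((n + 2 : ℝ) : ℂ) * (1 / v)) := by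
      have hj := mul_one_div_cancel hv0
      generalize (1 / v : ℂ) = j at *
      unfold cX; rw [hl']; push_cast
      linear_combination (-8 * ((n:ℂ) + 2)) * hj
    have hR : cR m (n + 2) = 2 * (m + 1) * ((n + 2 : ℝ) + 1) * (2 * (n + 2) + m + 4) := by
      unfold cR; push_cast; ring
    have e1 : n + 1 + 1 = n + 2 := rfl
    have e2 : n + 1 + 2 = n + 3 := rfl
    rw [e1, e2] at *
    have hv4 : ‖v + 4‖ = ‖v‖ * ‖1 + 4 / v‖ := by
      rw [← norm_mul, mul_add, mul_div_cancel₀ _ hv0, mul_one]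
    have h2 : cR m (n + 2) * ‖co m l (n + 3)‖ ≥
        ‖cX m l (n + 2)‖ * ‖co m l (n + 2)‖ - ‖cP l (n + 2)‖ * ‖co m l (n + 1)‖ := by
      rw [← norm_mul, ← norm_mul]
      refine le_trans (norm_sub_norm_le _ _) ?_
      rw [← h1, norm_mul, Complex.norm_real, Real.norm_of_nonneg (cR_pos hm _).le]
    rw [hX, hP, norm_mul, norm_mul, hv4] at h2
    have h3 : ‖(2 * n + 1 + l : ℂ)‖ * (‖v‖ * ‖1 + 4 / v‖) * ‖co m l (n + 1)‖ ≤
      (3 * n + m + 4) * ‖co m l (n + 2)‖ * (‖v‖ * ‖1 + 4 / v‖) := by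
      calc _ = ‖(2 * n + 1 + l : ℂ)‖ * ‖co m l (n + 1)‖ * (‖v‖ * ‖1 + 4 / v‖) := by ring
        _ ≤ _ := by gcongr
    have h4 := mul_le_mul_of_nonneg_left hst (show 0 ≤ ‖v‖ * ‖co m l (n + 2)‖ by positivity)
    rw [← hR] at h4
    have e : (2 * ((n + 1 : ℕ) : ℂ) + 1 + l) = v := by rw [hv]; push_cast; ring
    rw [e]
    have h5 : cR m (n + 2) / (3 * ((n:ℝ) + 2) + m + 1) * (‖v‖ * ‖co m l (n + 2)‖) ≤
      cR m (n + 2) * ‖co m l (n + 3)‖ := by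
      nlinarith
    rw [div_mul_eq_mul_div, div_le_iff₀ (by linarith), mul_assoc] at h5
    have h6 := le_of_mul_le_mul_left h5 (cR_pos hm _)
    push_cast
    linarith

end MS

namespace MS

open Filter Topology

lemma summable_of_contract {x e : ℕ → ℝ} {θ : ℝ} (hx : ∀ n, 0 ≤ x n) (he : ∀ n, 0 ≤ e n)
    (hθ1 : θ < 1) (hs : Summable e) (N : ℕ)
    (h : ∀ n, N ≤ n → x (n + 1) ≤ e n + θ * x n) : Summable x := by
  rw [← summable_nat_add_iff N]
  refine summable_of_sum_range_le (c := (x N + ∑' i, e (i + N)) / (1 - θ)) (fun n => hx _) ?_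
  intro n
  have hs' : Summable (fun i => e (i + N)) := (summable_nat_add_iff N).2 hs
  have key : ∀ n, ∑ i ∈ Finset.range n, x (i + N) + x (n + N) ≤
      x N + ∑ i ∈ Finset.range n, e (i + N) + θ * ∑ i ∈ Finset.range n, x (i + N) := by
    intro n
    induction n with
    | zero => simp
    | succ n ih =>
      rw [Finset.sum_range_succ, Finset.sum_range_succ]
      have := h (n + N) (by omega)
      rw [show n + 1 + N = n + N + 1 by ring]
      linarith
  have h1 := key n
  have h2 : ∑ i ∈ Finset.range n, e (i + N) ≤ ∑' i, e (i + N) :=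
    hs'.sum_le_tsum _ (fun i _ => he _)
  have h3 := hx (n + N)
  rw [le_div_iff₀ (by linarith)]
  linarith

lemma tendsto_of_ratio {s : ℕ → ℂ} {η : ℕ → ℂ} (hη : Summable (fun n => ‖η n‖)) (N : ℕ)
    (hs : ∀ n, N ≤ n → s n ≠ 0) (h : ∀ n, N ≤ n → s (n + 1) = s n * (1 + η n)) :
    ∃ C : ℂ, C ≠ 0 ∧ Tendsto s atTop (𝓝 C) := by
  have hη' : Summable (fun n => ‖η (n + N)‖) := (summable_nat_add_iff (f := fun n => ‖η n‖) N).2 hη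
  have hm := multipliable_one_add_of_summable hη'
  have hp : ∀ n, s (n + N) = s N * ∏ i ∈ Finset.range n, (1 + η (i + N)) := by
    intro n
    induction n with
    | zero => simp
    | succ n ih =>
      rw [Finset.prod_range_succ, ← mul_assoc, ← ih, show n + 1 + N = n + N + 1 by ring]
      exact h _ (by omega)
  refine ⟨s N * ∏' i, (1 + η (i + N)), mul_ne_zero (hs N le_rfl) ?_, ?_⟩
  · refine tprod_one_add_ne_zero_of_summable (f := fun i => η (i + N)) ?_ hη'
    intro i h0
    have := h (i + N) (by omega)
    rw [h0, mul_zero] at this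
    exact hs _ (by omega) this
  · rw [← tendsto_add_atTop_iff_nat N]
    simp_rw [hp]
    exact hm.tendsto_prod_tprod_nat.const_mul _

lemma tendsto_frac (a b c e : ℂ) (hc : c ≠ 0) :
    Tendsto (fun n : ℕ => (a * n + b) / (c * n + e)) atTop (𝓝 (a / c)) := by
  have h0 : Tendsto (fun n : ℕ => ((n : ℂ))⁻¹) atTop (𝓝 0) := tendsto_inv_atTop_nhds_zero_nat
  have h1 : Tendsto (fun n : ℕ => (a + b * (n : ℂ)⁻¹) / (c + e * (n : ℂ)⁻¹)) atTop
      (𝓝 ((a + b * 0) / (c + e * 0))) :=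
    (tendsto_const_nhds.add (h0.const_mul b)).div (tendsto_const_nhds.add (h0.const_mul e)) (by simpa)
  simp only [mul_zero, add_zero] at h1
  refine h1.congr' ?_
  filter_upwards [eventually_gt_atTop 0] with n hn
  have hn' : (n : ℂ) ≠ 0 := by exact_mod_cast hn.ne'
  rw [← mul_div_mul_right (a + b * (n : ℂ)⁻¹) (c + e * (n : ℂ)⁻¹) hn', add_mul, add_mul, mul_assoc b,
    mul_assoc e, inv_mul_cancel₀ hn', mul_one, mul_one]

/-- comparison ratio -/
noncomputable def rt (m : ℝ) (l : ℂ) (n : ℕ) : ℂ := (n + 1 + (l - (m + 3) / 2)) / (n + 1)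

lemma ratio_summable {m : ℝ} (hm : 1 ≤ m) {l : ℂ} (hl : 0 ≤ l.re) (hne : l ≠ 1) :
    Summable (fun n => ‖co m l (n + 1) / co m l n / rt m l n - 1‖) := by
  obtain ⟨σ, hσ⟩ : ∃ σ : ℂ, σ = l - (m + 3) / 2 := ⟨_, rfl⟩
  have hl' : l = σ + (m + 3) / 2 := by rw [hσ]; ring
  have hrt : ∀ n, rt m l n = (n + 1 + σ) / (n + 1) := by intro n; rw [rt, hσ]
  obtain ⟨N, hN⟩ := exists_nat_ge (m + 3)
  have hσre : ∀ n : ℕ, N ≤ n → ((n:ℂ) + 1 + σ) ≠ 0 := by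
    intro n hn h0
    have := congrArg Complex.re h0
    rw [hσ] at this
    have e : ((l - ((m:ℂ) + 3) / 2)).re = l.re - (m + 3) / 2 := by
      rw [show ((m:ℂ) + 3) / 2 = (((m + 3) / 2 : ℝ) : ℂ) by push_cast; rfl]
      simp
    rw [Complex.add_re, e] at this
    simp at this
    have : (N:ℝ) ≤ n := by exact_mod_cast hn
    linarith
  have hm1 : ((m:ℂ) + 1) ≠ 0 := by
    have : (m + 1 : ℝ) ≠ 0 := by linarith
    exact_mod_cast this
  have hm4 : ∀ n : ℕ, (2 * (n:ℂ) + 1 * (m + 6)) ≠ 0 := by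
    intro n
    have : (2 * n + 1 * (m + 6) : ℝ) ≠ 0 := by positivity
    exact_mod_cast this
  have hn1 : ∀ n : ℕ, (n : ℂ) + 1 ≠ 0 := fun n => Nat.cast_add_one_ne_zero n
  have hn2 : ∀ n : ℕ, (n : ℂ) + 1 + 1 ≠ 0 := fun n => by
    have := Nat.cast_add_one_ne_zero (R := ℂ) (n + 1)
    push_cast at this; exact this
  -- error term, at index n + 1
  let α : ℂ := (4 * m + 8) * 0 + (cX m l 0 + (4 * m * l + 8 * m + 4 * l + 12) * σ - (l ^ 2 - 9)
      - 2 * (m + 1) * (2 * (σ * (1 + σ)) + (m + 4) * (1 + 2 * σ)))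
  let β : ℂ := cX m l 0 * σ - 2 * (m + 1) * (m + 4) * (σ * (1 + σ))
  let ε : ℕ → ℂ := fun n => (1 / (2 * (m + 1))) * ((α * n + (α + β)) / (2 * n + 1 * (m + 6))) *
      ((1 / ((n + 2 + σ))) * (1 / (n + 1 + σ)))
  let c : ℕ → ℂ := fun n => (cP l (n + 1) / cR m (n + 1)) /
      (rt m l (n + 1) * (co m l (n + 1) / co m l n))
  have hε : Summable (fun n => ‖ε n‖) := by
    have hO : ε =O[atTop] (fun n : ℕ => 1 / (n:ℝ) ^ 2) := by
      have h1 : Tendsto (fun n : ℕ => (1 / (2 * ((m:ℂ) + 1))) * ((α * n + (α + β)) / (2 * n + 1 * (m + 6))) *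
        (((1 * n + 0) / (1 * n + (2 + σ))) * ((1 * n + 0) / (1 * n + (1 + σ))))) atTop
          (𝓝 ((1 / (2 * ((m:ℂ) + 1))) * (α / 2) * ((1 / 1) * (1 / 1)))) :=
        ((tendsto_frac _ _ _ _ two_ne_zero).const_mul _).mul
          ((tendsto_frac _ _ _ _ one_ne_zero).mul (tendsto_frac _ _ _ _ one_ne_zero))
      have h3 : ε =O[atTop] (fun n : ℕ => ((1 / (2 * ((m:ℂ) + 1))) * ((α * n + (α + β)) / (2 * n + 1 * (m + 6))) *
        (((1 * n + 0) / (1 * n + (2 + σ))) * ((1 * n + 0) / (1 * n + (1 + σ))))) * ((1 / (n:ℝ) ^ 2 : ℝ) : ℂ)) := by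
        refine Asymptotics.IsBigO.of_bound 1 ?_
        filter_upwards [eventually_gt_atTop 0] with n hn
        rw [one_mul]
        apply le_of_eq
        congr 1
        have hn' : (n : ℂ) ≠ 0 := by exact_mod_cast hn.ne'
        change (1 / (2 * ((m:ℂ) + 1))) * ((α * n + (α + β)) / (2 * n + 1 * (m + 6))) *
          ((1 / ((n + 2 + σ))) * (1 / (n + 1 + σ))) = _
        generalize (α * n + (α + β)) / (2 * (n:ℂ) + 1 * (m + 6)) = T
        rw [show 1 * (n:ℂ) + (2 + σ) = n + (2 + σ) by ring, show 1 * (n:ℂ) + (1 + σ) = n + (1 + σ) by ring,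
          show 1 * (n:ℂ) + 0 = n by ring, add_assoc, add_assoc]
        push_cast
        simp only [div_eq_mul_inv]
        have := mul_inv_cancel₀ (pow_ne_zero 2 hn')
        generalize ((n:ℂ)^2)⁻¹ = q at *
        linear_combination (-(1 * (2 * ((m:ℂ) + 1))⁻¹ * T * ((n:ℂ) + (2 + σ))⁻¹ * ((n:ℂ) + (1 + σ))⁻¹)) * this
      have h4 : (fun n : ℕ => ((1 / (2 * ((m:ℂ) + 1))) * ((α * n + (α + β)) / (2 * n + 1 * (m + 6))) *
        (((1 * n + 0) / (1 * n + (2 + σ))) * ((1 * n + 0) / (1 * n + (1 + σ))))) * ((1 / (n:ℝ) ^ 2 : ℝ) : ℂ))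
          =O[atTop] (fun n : ℕ => (1:ℝ) * (1 / (n:ℝ) ^ 2)) := by
        refine (h1.isBigO_one ℝ).mul ?_
        refine Asymptotics.isBigO_of_le _ (fun n => ?_)
        rw [Complex.norm_real]
      simpa using h3.trans h4
    have hsum : Summable (fun n : ℕ => 1 / (n:ℝ) ^ 2) := Real.summable_one_div_nat_pow.2 (by norm_num)
    exact summable_of_isBigO_nat hsum hO.norm_left
  have hc : ∀ᶠ n in atTop, ‖c n‖ ≤ 4 / 5 := by
    have h1 : Tendsto (fun n : ℕ => ‖(1 / (2 * ((m:ℂ) + 1))) * ((2 * n + (l + 5)) / (1 * n + (2 + σ))) *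
        ((3 * n + (m + 1)) / (2 * n + (m + 6)))‖) atTop
        (𝓝 ‖(1 / (2 * ((m:ℂ) + 1))) * (2 / 1) * (3 / 2)‖) :=
      (((tendsto_frac _ _ _ _ one_ne_zero).const_mul _).mul (tendsto_frac _ _ _ _ two_ne_zero)).norm
    have h2 : ‖(1 / (2 * ((m:ℂ) + 1))) * (2 / 1) * (3 / 2)‖ < 4 / 5 := by
      rw [show (1 / (2 * ((m:ℂ) + 1))) * (2 / 1) * (3 / 2) = ((3 / (2 * (m + 1)) : ℝ) : ℂ) by
        push_cast; field_simp]
      rw [Complex.norm_real, Real.norm_of_nonneg (by positivity), div_lt_div_iff₀ (by positivity) (by norm_num)]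
      linarith
    filter_upwards [h1.eventually_lt_const h2, eventually_ge_atTop (N + 1)] with n hn hnN
    refine le_trans ?_ hn.le
    obtain ⟨k, rfl⟩ : ∃ k, n = k + 1 := ⟨n - 1, by omega⟩
    obtain ⟨hk0, hk⟩ := co_lower hm hl hne k
    have hk2 : co m l (k + 2) ≠ 0 := (co_lower hm hl hne (k + 1)).1
    have hd : ((k + 1 : ℕ) : ℂ) + 1 + 1 + σ ≠ 0 := by
      have := hσre (k + 2) (by omega)
      push_cast at this ⊢
      convert this using 1; ring
    simp only [c]
    rw [hrt]
    have hP : cP l (k + 1 + 1) = (2 * k + 1 + l) * (2 * ((k + 1 : ℕ):ℂ) + (l + 5)) := by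
      unfold cP; push_cast; ring
    have hR : (cR m (k + 1 + 1) : ℂ) = 2 * (m + 1) * (((k + 1 + 1 : ℕ) : ℂ) + 1) * (2 * ((k + 1 : ℕ) : ℂ) + (m + 6)) := by
      unfold cR; push_cast; ring
    have h5 : (2 * ((k + 1 : ℕ) : ℂ) + (m + 6)) ≠ 0 := by simpa using hm4 (k + 1)
    have h6 : (((k + 1 + 1 : ℕ) : ℂ) + 1) ≠ 0 := Nat.cast_add_one_ne_zero _
    have e1 : cP l (k + 1 + 1) / cR m (k + 1 + 1) /
        ((((k + 1 + 1 : ℕ) : ℂ) + 1 + σ) / (((k + 1 + 1 : ℕ) : ℂ) + 1) * (co m l (k + 1 + 1) / co m l (k + 1)))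
        = (1 / (2 * ((m:ℂ) + 1))) * ((2 * ((k + 1 : ℕ):ℂ) + (l + 5)) / (1 * ((k + 1 : ℕ):ℂ) + (2 + σ))) *
         (1 / (2 * ((k + 1 : ℕ):ℂ) + (m + 6))) * ((2 * k + 1 + l) * co m l (k + 1) / co m l (k + 2)) := by
      rw [hP, hR, show 1 * ((k + 1 : ℕ):ℂ) + (2 + σ) = ((k + 1 : ℕ) : ℂ) + 1 + 1 + σ by ring,
        show ((k + 1 + 1 : ℕ) : ℂ) + 1 + σ = ((k + 1 : ℕ) : ℂ) + 1 + 1 + σ by push_cast; ring]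
      generalize ((k + 1 : ℕ) : ℂ) + 1 + 1 + σ = D at *
      generalize (2 * ((k + 1 : ℕ) : ℂ) + (m + 6)) = D2 at *
      generalize (((k + 1 + 1 : ℕ) : ℂ) + 1) = D3 at *
      field_simp
    rw [e1, mul_assoc, norm_mul]
    conv_rhs => rw [norm_mul]
    refine mul_le_mul_of_nonneg_left ?_ (norm_nonneg _)
    rw [norm_mul, norm_div, norm_div, norm_div, norm_mul, norm_one]
    have h7 : ‖(2 * k + 1 + l : ℂ)‖ * ‖co m l (k + 1)‖ / ‖co m l (k + 2)‖ ≤ 3 * k + m + 4 := by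
      rw [div_le_iff₀ (norm_pos_iff.2 hk2)]; exact hk
    have h8 : ‖(3 * ((k + 1 : ℕ) : ℂ) + (m + 1))‖ = 3 * k + m + 4 := by
      rw [show (3 * ((k + 1 : ℕ) : ℂ) + (m + 1)) = ((3 * k + m + 4 : ℝ) : ℂ) by push_cast; ring,
        Complex.norm_real, Real.norm_of_nonneg (by positivity)]
    rw [h8, div_eq_mul_one_div (3 * (k:ℝ) + m + 4), mul_comm]
    gcongr
  obtain ⟨M, hM⟩ := eventually_atTop.1 hc
  refine summable_of_contract (e := fun n => ‖ε n‖) (θ := 4 / 5) (fun _ => norm_nonneg _)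
    (fun _ => norm_nonneg _) (by norm_num) hε (M + N + 1) ?_
  intro n hn
  have hcn := hM n (by omega)
  obtain ⟨k, rfl⟩ : ∃ k, n = k + 1 := ⟨n - 1, by omega⟩
  have hk1 : co m l (k + 1) ≠ 0 := (co_lower hm hl hne k).1
  have hk2 : co m l (k + 2) ≠ 0 := (co_lower hm hl hne (k + 1)).1
  have hrec := co_rec hm l (k + 1)
  have key : co m l (k + 1 + 1 + 1) / co m l (k + 1 + 1) / rt m l (k + 1 + 1) - 1 =
      ε (k + 1) + c (k + 1) * (co m l (k + 1 + 1) / co m l (k + 1) / rt m l (k + 1) - 1) := by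
    have hd1 : ((k + 1 : ℕ) : ℂ) + 1 + σ ≠ 0 := hσre (k + 1) (by omega)
    have hd2 : ((k + 1 : ℕ) : ℂ) + 2 + σ ≠ 0 := by
      have := hσre (k + 2) (by omega)
      push_cast at this ⊢
      convert this using 1; ring
    have hr1 : rt m l (k + 1) ≠ 0 := by
      rw [hrt]; exact div_ne_zero hd1 (Nat.cast_add_one_ne_zero _)
    have hr2 : rt m l (k + 2) ≠ 0 := by
      rw [hrt]; refine div_ne_zero ?_ (Nat.cast_add_one_ne_zero _)
      convert hd2 using 1; push_cast; ring
    have hRne : (cR m (k + 2) : ℂ) ≠ 0 := by exact_mod_cast (cR_pos hm (k + 2)).ne'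
    have hε' : ε (k + 1) = cX m l (k + 2) / cR m (k + 2) / rt m l (k + 2)
        - cP l (k + 2) / cR m (k + 2) / (rt m l (k + 2) * rt m l (k + 1)) - 1 := by
      have h5 : (2 * ((k + 1 : ℕ) : ℂ) + 1 * (m + 6)) ≠ 0 := by simpa using hm4 (k + 1)
      have h6 : ((k + 1 : ℕ) : ℂ) + 1 ≠ 0 := Nat.cast_add_one_ne_zero _
      have h7 : ((k + 1 : ℕ) : ℂ) + 1 + 1 ≠ 0 := hn2 (k + 1)
      have e3 : rt m l (k + 2) = (((k + 1 : ℕ) : ℂ) + 2 + σ) / (((k + 1 : ℕ) : ℂ) + 1 + 1) := by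
        rw [hrt]; push_cast; ring
      have e4 : (cR m (k + 2) : ℂ) = 2 * (m + 1) * (((k + 1 : ℕ) : ℂ) + 1 + 1) *
        (2 * ((k + 1 : ℕ) : ℂ) + 1 * (m + 6)) := by unfold cR; push_cast; ring
      simp only [ε]
      rw [e3, e4, hrt (k + 1)]
      have hX : cX m l (k + 2) = (4 * m + 8) * (((k + 1 : ℕ) : ℂ) + 1) ^ 2 +
        (4 * m * l + 8 * m + 4 * l + 12) * (((k + 1 : ℕ) : ℂ) + 1) + cX m l 0 := by
        unfold cX; push_cast; ring
      have hP : cP l (k + 2) = 4 * (((k + 1 : ℕ) : ℂ) + 1) ^ 2 + 4 * l * (((k + 1 : ℕ) : ℂ) + 1)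
         + (l ^ 2 - 9) := by unfold cP; push_cast; ring
      rw [hX, hP]
      simp only [α, β]
      generalize hx : ((k + 1 : ℕ) : ℂ) = x at *
      obtain ⟨D1, hD1⟩ : ∃ D, D = x + 1 + σ := ⟨_, rfl⟩
      obtain ⟨D2, hD2⟩ : ∃ D, D = x + 2 + σ := ⟨_, rfl⟩
      obtain ⟨D3, hD3⟩ : ∃ D, D = 2 * x + 1 * ((m:ℂ) + 6) := ⟨_, rfl⟩
      rw [← hD1] at hd1 ⊢
      rw [← hD2] at hd2 ⊢
      rw [← hD3] at h5 ⊢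
      generalize cX m l 0 = X0
      field_simp
      rw [hD1, hD2, hD3, hl']
      ring
    simp only [c]
    rw [hε']
    have e1 : k + 1 + 1 = k + 2 := rfl
    have e2 : k + 1 + 2 = k + 3 := rfl
    have e2' : k + 2 + 1 = k + 3 := rfl
    rw [e1, e2] at *
    rw [e2']
    have h9 : co m l (k + 3) = (cX m l (k + 2) * co m l (k + 2) - cP l (k + 2) * co m l (k + 1)) / cR m (k + 2) := by
      rw [← hrec]; field_simp
    rw [h9]
    field_simp
    ring
  rw [key]
  refine (norm_add_le _ _).trans ?_
  refine add_le_add le_rfl ?_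
  rw [norm_mul]
  exact mul_le_mul_of_nonneg_right hcn (norm_nonneg _)

end MS

namespace MS

open Filter Topology

/-- coefficients of the derivative of a power series -/
noncomputable def dc (c : ℕ → ℂ) : ℕ → ℂ := fun n => (n + 1) * c (n + 1)

/-- coefficients of `x` times a power series -/
def sh (c : ℕ → ℂ) : ℕ → ℂ
  | 0 => 0
  | (n + 1) => c n

/-- sum of a power series at a real point -/
noncomputable def ser (c : ℕ → ℂ) (x : ℝ) : ℂ := ∑' n, c n * (x : ℂ) ^ n

/-- radius of convergence at least one -/
def Sub1 (c : ℕ → ℂ) : Prop := ∀ r : ℝ, 0 ≤ r → r < 1 → Summable (fun n => ‖c n‖ * r ^ n)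

lemma Sub1.hasSum {c : ℕ → ℂ} (hc : Sub1 c) {x : ℝ} (hx : |x| < 1) :
    HasSum (fun n => c n * (x : ℂ) ^ n) (ser c x) := by
  refine Summable.hasSum (Summable.of_norm ?_)
  convert hc |x| (abs_nonneg _) hx using 2 with n
  rw [norm_mul, norm_pow, Complex.norm_real, Real.norm_eq_abs]

lemma hasSum_sh {c : ℕ → ℂ} {x : ℝ} {s : ℂ} (h : HasSum (fun n => c n * (x : ℂ) ^ n) s) :
    HasSum (fun n => sh c n * (x : ℂ) ^ n) (x * s) := by
  have h1 := h.mul_left (x : ℂ)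
  rw [← hasSum_nat_add_iff' 1]
  simp only [Finset.sum_range_one, sh, zero_mul, sub_zero]
  have e : (fun n : ℕ => c n * (x : ℂ) ^ (n + 1)) = fun i => (x:ℂ) * (c i * (x:ℂ) ^ i) := by
    funext n; ring
  rw [e]; exact h1

lemma Sub1.dc {c : ℕ → ℂ} (hc : Sub1 c) : Sub1 (dc c) := by
  intro r hr0 hr1
  obtain ⟨s, hs, hs1⟩ := exists_between hr1
  have hs0 : 0 < s := hr0.trans_lt hs
  have hq : |r / s| < 1 := by
    rw [abs_of_nonneg (by positivity), div_lt_one hs0]; exact hs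
  have ht : Tendsto (fun n : ℕ => ((n:ℝ) * (r / s) ^ n + (r / s) ^ n)) atTop (𝓝 (0 + 0)) :=
    (tendsto_self_mul_const_pow_of_abs_lt_one hq).add (tendsto_pow_atTop_nhds_zero_of_abs_lt_one hq)
  obtain ⟨B, hB⟩ := ht.bddAbove_range
  have hsum : Summable (fun n => B / s * (‖c (n + 1)‖ * s ^ (n + 1))) :=
    ((summable_nat_add_iff 1).2 (hc s hs0.le hs1)).mul_left _
  refine Summable.of_nonneg_of_le (fun n => by positivity) (fun n => ?_) hsum
  have h1 : (n:ℝ) * (r / s) ^ n + (r / s) ^ n ≤ B := hB ⟨n, rfl⟩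
  rw [MS.dc, norm_mul, show ((n:ℂ) + 1) = ((n + 1 : ℝ) : ℂ) by push_cast; rfl, Complex.norm_real,
    Real.norm_of_nonneg (by positivity)]
  have h2 : B / s * (‖c (n + 1)‖ * s ^ (n + 1)) = B * s ^ n * ‖c (n + 1)‖ := by
    rw [pow_succ]; field_simp
  rw [h2]
  have h3 : (n + 1 : ℝ) * r ^ n ≤ B * s ^ n := by
    rw [div_pow] at h1
    have : ((n:ℝ) * (r ^ n / s ^ n) + r ^ n / s ^ n) * s ^ n ≤ B * s ^ n := by gcongr
    calc (n + 1 : ℝ) * r ^ n = ((n:ℝ) * (r ^ n / s ^ n) + r ^ n / s ^ n) * s ^ n := by field_simp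
      _ ≤ _ := this
  calc (n + 1 : ℝ) * ‖c (n + 1)‖ * r ^ n = ((n + 1 : ℝ) * r ^ n) * ‖c (n + 1)‖ := by ring
    _ ≤ _ := by gcongr

lemma Sub1.hasDerivAt {c : ℕ → ℂ} (hc : Sub1 c) {x : ℝ} (hx : |x| < 1) :
    HasDerivAt (ser c) (ser (MS.dc c) x) x := by
  obtain ⟨r, hr, hr1⟩ := exists_between hx
  have hr0 : 0 ≤ r := (abs_nonneg x).trans hr.le
  have h0 := hc.dc r hr0 hr1
  have hu : Summable (fun n : ℕ => ‖c n‖ * (n * r ^ (n - 1))) := by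
    rw [← summable_nat_add_iff 1]
    refine (summable_congr fun n => ?_).2 h0
    rw [MS.dc, norm_mul, show ((n:ℂ) + 1) = ((n + 1 : ℝ) : ℂ) by push_cast; rfl, Complex.norm_real,
      Real.norm_of_nonneg (by positivity)]
    push_cast
    ring
  have key := hasDerivAt_tsum_of_isPreconnected (𝕜 := ℝ) (g := fun n y => c n * ((y:ℝ) : ℂ) ^ n)
    (g' := fun n y => c n * ((n:ℂ) * ((y:ℝ):ℂ) ^ (n - 1))) (t := Set.Ioo (-r) r) (y₀ := 0) (y := x) hu isOpen_Ioo
    isPreconnected_Ioo ?_ ?_ ?_ ?_ ?_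
  · have hs : Summable (fun n : ℕ => c n * ((n:ℂ) * (x:ℂ) ^ (n - 1))) := by
      refine Summable.of_norm (Summable.of_nonneg_of_le (fun n => norm_nonneg _) (fun n => ?_) hu)
      rw [norm_mul, norm_mul, norm_pow, Complex.norm_real, Complex.norm_natCast]
      have : ‖x‖ ≤ r := hr.le
      gcongr
    have e : ser (MS.dc c) x = ∑' n : ℕ, c n * ((n:ℂ) * (x:ℂ) ^ (n - 1)) := by
     rw [hs.tsum_eq_zero_add]
     simp only [Nat.cast_zero, zero_mul, mul_zero, zero_add]
     refine tsum_congr (fun n => ?_)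
     rw [MS.dc]; push_cast; ring
    rw [e]; exact key
  · intro n y _
    have := (hasDerivAt_id y).ofReal_comp.pow n
    have h2 := this.const_mul (c n)
    simpa using h2
  · intro n y hy
    rw [norm_mul, norm_mul, norm_pow, Complex.norm_real, Complex.norm_natCast]
    have : ‖y‖ ≤ r := (abs_lt.2 hy).le
    gcongr
  · have : 0 < r := (abs_nonneg x).trans_lt hr
    constructor <;> linarith
  · refine summable_of_ne_finset_zero (s := {0}) ?_
    intro n hn
    have : n ≠ 0 := by simpa using hn
    simp [this]
  · exact abs_lt.1 hr

lemma Sub1.of_ratio {c : ℕ → ℂ} (h0 : ∀ᶠ n in atTop, c n ≠ 0)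
    (h : Tendsto (fun n => c (n + 1) / c n) atTop (𝓝 1)) : Sub1 c := by
  intro r hr0 hr1
  rcases hr0.eq_or_lt with h00 | hr0
  · refine summable_of_ne_finset_zero (s := {0}) ?_
    intro n hn
    have : n ≠ 0 := by simpa using hn
    simp [← h00, this]
  refine summable_of_ratio_test_tendsto_lt_one (l := r) hr1 ?_ ?_
  · filter_upwards [h0] with n hn
    have := norm_pos_iff.2 hn
    positivity
  · have h1 : Tendsto (fun n => ‖c (n + 1) / c n‖ * r) atTop (𝓝 (‖(1:ℂ)‖ * r)) := h.norm.mul_const r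
    rw [norm_one, one_mul] at h1
    refine h1.congr' ?_
    filter_upwards [h0] with n hn
    have := norm_pos_iff.2 hn
    rw [norm_mul, norm_mul, norm_norm, norm_norm, norm_div, norm_pow, norm_pow,
      Real.norm_of_nonneg hr0.le, pow_succ]
    field_simp

lemma dc_iter (k : ℕ) (c : ℕ → ℂ) (n : ℕ) :
    dc^[k] c n = ((n + 1).ascFactorial k : ℂ) * c (n + k) := by
  induction k generalizing c with
  | zero => simp
  | succ k ih =>
    rw [Function.iterate_succ_apply, ih, dc, Nat.ascFactorial_succ]
    push_cast
    rw [show n + (k + 1) = n + k + 1 by ring]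
    ring

lemma Sub1.iter {c : ℕ → ℂ} (hc : Sub1 c) (k : ℕ) : Sub1 (MS.dc^[k] c) := by
  induction k with
  | zero => simpa
  | succ k ih => rw [Function.iterate_succ_apply']; exact ih.dc

lemma rt_tendsto (m : ℝ) (l : ℂ) : Tendsto (rt m l) atTop (𝓝 1) := by
  have := tendsto_frac 1 (1 + (l - (m + 3) / 2)) 1 1 one_ne_zero
  rw [div_one] at this
  refine this.congr (fun n => ?_)
  rw [rt]; ring

lemma co_sub1 {m : ℝ} (hm : 1 ≤ m) {l : ℂ} (hl : 0 ≤ l.re) (hne : l ≠ 1) : Sub1 (co m l) := by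
  have h1 := (ratio_summable hm hl hne).tendsto_atTop_zero
  rw [← tendsto_iff_norm_sub_tendsto_zero] at h1
  have h2 := h1.mul (rt_tendsto m l)
  rw [one_mul] at h2
  refine Sub1.of_ratio ?_ (h2.congr' ?_)
  · filter_upwards [eventually_gt_atTop 0] with n hn
    obtain ⟨k, rfl⟩ : ∃ k, n = k + 1 := ⟨n - 1, by omega⟩
    exact (co_lower hm hl hne k).1
  · have : ∀ᶠ n in atTop, rt m l n ≠ 0 :=
      (rt_tendsto m l).eventually_ne one_ne_zero
    filter_upwards [this] with n hn
    field_simp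

lemma heun {m : ℝ} (hm : 1 ≤ m) {l : ℂ} (hl : 0 ≤ l.re) (hne : l ≠ 1) {x : ℝ} (hx : |x| < 1) :
    (4 * (m + 1) * x - (4 * m + 8) * x ^ 2 + 4 * x ^ 3) * ser (dc (dc (co m l))) x
    + (2 * (m + 1) * (m + 4) - (12 * m + 20 + 4 * (m + 1) * l) * x + (4 * l + 12) * x ^ 2)
      * ser (dc (co m l)) x
    + ((l - 1) * (l + 5) * x - (l - 1) * (m * l + 5 * m + 4)) * ser (co m l) x = 0 := by
  have h0 := co_sub1 hm hl hne
  have s0 := h0.hasSum hx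
  have s1 := h0.dc.hasSum hx
  have s2 := h0.dc.dc.hasSum hx
  have e1 := hasSum_sh s2
  have e2 := hasSum_sh e1
  have e3 := hasSum_sh e2
  have f1 := hasSum_sh s1
  have f2 := hasSum_sh f1
  have g1 := hasSum_sh s0
  have tot := ((((((((e1.mul_left (4 * ((m:ℂ) + 1))).sub (e2.mul_left (4 * (m:ℂ) + 8))).add (e3.mul_left 4)).add
    (s1.mul_left (2 * ((m:ℂ) + 1) * (m + 4)))).sub (f1.mul_left (12 * (m:ℂ) + 20 + 4 * (m + 1) * l))).add
    (f2.mul_left (4 * l + 12))).add (g1.mul_left ((l - 1) * (l + 5)))).sub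
    (s0.mul_left ((l - 1) * (m * l + 5 * m + 4))))
  have hz : ∀ n : ℕ, (4 * ((m:ℂ) + 1) * (sh (dc (dc (co m l))) n * (x:ℂ) ^ n)
      - (4 * (m:ℂ) + 8) * (sh (sh (dc (dc (co m l)))) n * (x:ℂ) ^ n)
      + 4 * (sh (sh (sh (dc (dc (co m l))))) n * (x:ℂ) ^ n)
      + 2 * ((m:ℂ) + 1) * (m + 4) * (dc (co m l) n * (x:ℂ) ^ n)
      - (12 * (m:ℂ) + 20 + 4 * (m + 1) * l) * (sh (dc (co m l)) n * (x:ℂ) ^ n)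
      + (4 * l + 12) * (sh (sh (dc (co m l))) n * (x:ℂ) ^ n)
      + (l - 1) * (l + 5) * (sh (co m l) n * (x:ℂ) ^ n)
      - (l - 1) * (m * l + 5 * m + 4) * (co m l n * (x:ℂ) ^ n)) = 0 := by
    intro n
    match n with
    | 0 =>
      have := co_rec0 hm l
      simp only [sh, dc]
      unfold cR cX at this
      push_cast at this ⊢
      linear_combination this
    | 1 =>
      have := co_rec hm l 0
      simp only [sh, dc]
      unfold cR cX cP at this
      push_cast at this ⊢
      simp only [zero_add] at this ⊢
      linear_combination (x:ℂ) * this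
    | 2 =>
      have := co_rec hm l 1
      simp only [sh, dc]
      unfold cR cX cP at this
      push_cast at this ⊢
      simp only [zero_add] at this ⊢
      linear_combination (x:ℂ)^2 * this
    | (n + 3) =>
      have := co_rec hm l (n + 2)
      simp only [sh, dc]
      unfold cR cX cP at this
      push_cast at this ⊢
      simp only [add_assoc, Nat.reduceAdd] at this ⊢
      linear_combination (x:ℂ)^(n+3) * this
  have hfun := funext hz
  have tot' := tot
  rw [hfun] at tot'
  have := tot'.unique hasSum_zero
  rw [← this]; ring

end MS

namespace MS

open Filter Topology

/-- binomial coefficients of `(1-x)^(-τ-1)` -/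
noncomputable def be (τ : ℂ) : ℕ → ℂ
  | 0 => 1
  | (n + 1) => be τ n * ((n + 1 + τ) / (n + 1))

lemma be_fac_ne {τ : ℂ} (h : 0 < τ.re) (n : ℕ) : ((n:ℂ) + 1 + τ) ≠ 0 := by
  intro h0
  have := congrArg Complex.re h0
  simp at this
  have : (0:ℝ) ≤ n := by positivity
  linarith

lemma be_ne {τ : ℂ} (h : 0 < τ.re) (n : ℕ) : be τ n ≠ 0 := by
  induction n with
  | zero => simp [be]
  | succ n ih => exact mul_ne_zero ih (div_ne_zero (be_fac_ne h n) (Nat.cast_add_one_ne_zero n))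

lemma be_sub1 {τ : ℂ} (h : 0 < τ.re) : Sub1 (be τ) := by
  refine Sub1.of_ratio (Eventually.of_forall (be_ne h)) ?_
  have := tendsto_frac 1 (1 + τ) 1 1 one_ne_zero
  rw [div_one] at this
  refine this.congr (fun n => ?_)
  rw [be, mul_div_cancel_left₀ _ (be_ne h n), one_mul, add_assoc]

lemma be_ser {τ : ℂ} (h : 0 < τ.re) {x : ℝ} (hx0 : 0 ≤ x) (hx1 : x < 1) :
    ser (be τ) x * Complex.exp ((1 + τ) * (Real.log (1 - x) : ℝ)) = 1 := by
  have hode : ∀ y : ℝ, |y| < 1 → (1 - (y:ℂ)) * ser (dc (be τ)) y = (1 + τ) * ser (be τ) y := by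
    intro y hy
    have s0 := (be_sub1 h).hasSum hy
    have s1 := (be_sub1 h).dc.hasSum hy
    have tot := (s1.sub (hasSum_sh s1)).sub (s0.mul_left (1 + τ))
    have hz : ∀ n : ℕ, dc (be τ) n * (y:ℂ) ^ n - sh (dc (be τ)) n * (y:ℂ) ^ n
        - (1 + τ) * (be τ n * (y:ℂ) ^ n) = 0 := by
      intro n
      match n with
      | 0 => simp only [dc, sh, be]; push_cast; ring
      | (n + 1) =>
        simp only [dc, sh]
        rw [be]
        have : ((n + 1 : ℕ) : ℂ) + 1 ≠ 0 := Nat.cast_add_one_ne_zero _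
        generalize be τ (n + 1) = B
        field_simp
        push_cast
        ring
    have hfun := funext hz
    rw [hfun] at tot
    have := tot.unique hasSum_zero
    linear_combination this
  have hd : ∀ y ∈ Set.Ioo (-1 : ℝ) 1, HasDerivAt
      (fun y : ℝ => ser (be τ) y * Complex.exp ((1 + τ) * (Real.log (1 - y) : ℝ))) 0 y := by
    intro y hy
    have hy' : |y| < 1 := abs_lt.2 hy
    have h1 := (be_sub1 h).hasDerivAt hy'
    have hpos : (1 - y) ≠ 0 := by have := hy.2; linarith
    have h2 : HasDerivAt (fun y : ℝ => Real.log (1 - y)) (-1 / (1 - y)) y :=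
      ((hasDerivAt_id y).const_sub 1).log hpos
    have h3 := (h2.ofReal_comp.const_mul (1 + τ)).cexp
    refine (h1.mul h3).congr_deriv ?_
    have e := hode y hy'
    have hpos' : (1 - (y:ℂ)) ≠ 0 := by exact_mod_cast hpos
    push_cast
    field_simp
    linear_combination Complex.exp ((1 + τ) * (Real.log (1 - y) : ℝ)) * e
  have hc := isOpen_Ioo.is_const_of_deriv_eq_zero (isPreconnected_Ioo (a := (-1:ℝ)) (b := 1))
    (f := fun y : ℝ => ser (be τ) y * Complex.exp ((1 + τ) * (Real.log (1 - y) : ℝ)))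
    (fun y hy => (hd y hy).differentiableAt.differentiableWithinAt)
    (fun y hy => (hd y hy).deriv) (x := x) (y := 0) ⟨by linarith, hx1⟩ ⟨by norm_num, by norm_num⟩
  refine hc.trans ?_
  have : ser (be τ) 0 = 1 := by
    rw [ser, tsum_eq_single 0]
    · simp [be]
    · intro n hn; simp [hn]
  rw [this]; simp

lemma be_ser_norm {τ : ℂ} (h : 0 < τ.re) {x : ℝ} (hx0 : 0 ≤ x) (hx1 : x < 1) :
    ‖ser (be τ) x‖ = Real.exp (-((1 + τ.re) * Real.log (1 - x))) := by
  have h1 := congrArg norm (be_ser h hx0 hx1)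
  rw [norm_mul, Complex.norm_exp, norm_one] at h1
  have e : ((1 + τ) * (Real.log (1 - x) : ℝ)).re = (1 + τ.re) * Real.log (1 - x) := by
    rw [Complex.re_mul_ofReal]; simp
  rw [e] at h1
  rw [Real.exp_neg]
  exact eq_inv_of_mul_eq_one_left h1

lemma be_real {t : ℝ} (h : 0 < t) (n : ℕ) : be (t : ℂ) n = (‖be (t:ℂ) n‖ : ℝ) := by
  induction n with
  | zero => simp [be]
  | succ n ih =>
    have e : (((n:ℂ) + 1 + t) / (n + 1)) = (((n + 1 + t) / (n + 1) : ℝ) : ℂ) := by push_cast; rfl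
    rw [be, norm_mul, e, Complex.norm_real, Real.norm_of_nonneg (by positivity)]
    rw [ih]; push_cast; simp

lemma be_sum_norm {τ : ℂ} (h : 0 < τ.re) {x : ℝ} (hx0 : 0 ≤ x) (hx1 : x < 1) :
    HasSum (fun n => ‖be (τ.re : ℂ) n‖ * x ^ n) ‖ser (be τ) x‖ := by
  have h' : 0 < ((τ.re : ℝ) : ℂ).re := by simpa
  have hx : |x| < 1 := by rwa [abs_of_nonneg hx0]
  have hs := (be_sub1 h').hasSum hx
  have hs2 : HasSum (fun n => ((‖be (τ.re : ℂ) n‖ * x ^ n : ℝ) : ℂ)) (ser (be (τ.re : ℂ)) x) := by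
    refine hs.congr_fun ?_
    intro n
    conv_rhs => rw [be_real h n]
    push_cast; rfl
  have hs3 := (be_sub1 h') x hx0 hx1
  have e1 := hs2.unique (Complex.hasSum_ofReal.2 hs3.hasSum)
  have e2 : ‖ser (be τ) x‖ = ‖ser (be (τ.re : ℂ)) x‖ := by
    rw [be_ser_norm h hx0 hx1, be_ser_norm h' hx0 hx1]; simp
  have e3 : ‖ser (be (τ.re : ℂ)) x‖ = ∑' n, ‖be (τ.re : ℂ) n‖ * x ^ n := by
    rw [e1, Complex.norm_real, Real.norm_of_nonneg]
    exact tsum_nonneg (fun n => by positivity)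
  rw [e2, e3]; exact hs3.hasSum

lemma be_le {τ : ℂ} (h : 0 < τ.re) : ∃ M : ℝ, 0 < M ∧ ∀ n, ‖be τ n‖ ≤ M * ‖be (τ.re : ℂ) n‖ := by
  have h' : 0 < ((τ.re : ℝ) : ℂ).re := by simpa
  let s : ℕ → ℂ := fun n => ((‖be τ n‖ ^ 2 / ‖be (τ.re : ℂ) n‖ ^ 2 : ℝ) : ℂ)
  let η : ℕ → ℂ := fun n => ((τ.im ^ 2 / (n + 1 + τ.re) ^ 2 : ℝ) : ℂ)
  have hη : Summable (fun n => ‖η n‖) := by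
    have hsum : Summable (fun n : ℕ => 1 / (n:ℝ) ^ 2) := Real.summable_one_div_nat_pow.2 (by norm_num)
    have hsum2 := ((summable_nat_add_iff 1).2 hsum).mul_left (τ.im ^ 2)
    refine Summable.of_nonneg_of_le (fun n => norm_nonneg _) (fun n => ?_) hsum2
    simp only [η]
    rw [Complex.norm_real, Real.norm_of_nonneg (by positivity), div_eq_mul_one_div]
    push_cast
    refine mul_le_mul_of_nonneg_left ?_ (by positivity)
    refine one_div_le_one_div_of_le (by positivity) ?_
    refine pow_le_pow_left₀ (by positivity) ?_ 2
    linarith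
  obtain ⟨C, -, hC⟩ := tendsto_of_ratio (s := s) hη 0 (fun n _ => by
      have h1 := norm_pos_iff.2 (be_ne h n)
      have h2 := norm_pos_iff.2 (be_ne h' n)
      have : (‖be τ n‖ ^ 2 / ‖be (τ.re : ℂ) n‖ ^ 2 : ℝ) ≠ 0 := by positivity
      exact Complex.ofReal_ne_zero.2 this) (fun n _ => by
      have h2 := norm_pos_iff.2 (be_ne h' n)
      simp only [s, η]
      rw [show (1:ℂ) = ((1:ℝ):ℂ) by simp, ← Complex.ofReal_add, ← Complex.ofReal_mul]
      congr 1
      rw [be, be, norm_mul, norm_mul, norm_div, norm_div, mul_pow, mul_pow, div_pow, div_pow]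
      have e1 : ‖(n:ℂ) + 1 + τ‖ ^ 2 = (n + 1 + τ.re) ^ 2 + τ.im ^ 2 := by
        rw [← Complex.normSq_eq_norm_sq, Complex.normSq_apply]; simp; ring
      have e2 : ‖(n:ℂ) + 1 + (τ.re : ℂ)‖ ^ 2 = (n + 1 + τ.re) ^ 2 := by
        rw [← Complex.normSq_eq_norm_sq, Complex.normSq_apply]; simp; ring
      rw [e1, e2]
      have h3 : 0 < ‖(n:ℂ) + 1‖ := norm_pos_iff.2 (Nat.cast_add_one_ne_zero n)
      have h4 : 0 < (n + 1 + τ.re) := by positivity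
      field_simp)
  obtain ⟨B, hB⟩ := hC.norm.bddAbove_range
  refine ⟨max B 1, by positivity, fun n => ?_⟩
  have h2 := norm_pos_iff.2 (be_ne h' n)
  have h1 : ‖s n‖ ≤ B := hB ⟨n, rfl⟩
  simp only [s] at h1
  rw [Complex.norm_real, Real.norm_of_nonneg (by positivity), ← div_pow] at h1
  rw [← div_le_iff₀ h2]
  have h3 : (1:ℝ) ≤ max B 1 := le_max_right _ _
  have h4 : B ≤ max B 1 := le_max_left _ _
  have h5 : 0 ≤ ‖be τ n‖ / ‖be (τ.re : ℂ) n‖ := by positivity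
  nlinarith

lemma unbounded {g : ℕ → ℂ} (hg : Sub1 g) {τ C : ℂ} (h : 0 < τ.re) (hC : C ≠ 0)
    (ht : Tendsto (fun n => g n / be τ n) atTop (𝓝 C)) :
    Tendsto (fun x => ‖ser g x‖) (𝓝[<] 1) atTop := by
  obtain ⟨M, hM0, hM⟩ := be_le h
  have hC0 := norm_pos_iff.2 hC
  obtain ⟨N, hN⟩ := (Metric.tendsto_atTop.1 ht) (‖C‖ / (2 * M)) (by positivity)
  obtain ⟨K, hK⟩ : ∃ K : ℝ, K = ∑ n ∈ Finset.range N, ‖g n - C * be τ n‖ := ⟨_, rfl⟩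
  have hbd : ∀ x : ℝ, 0 ≤ x → x < 1 → ‖C‖ / 2 * ‖ser (be τ) x‖ - K ≤ ‖ser g x‖ := by
    intro x hx0 hx1
    have hx : |x| < 1 := by rwa [abs_of_nonneg hx0]
    have s1 := hg.hasSum hx
    have s2 := (be_sub1 h).hasSum hx
    have s3 := s1.sub (s2.mul_left C)
    have b := be_sum_norm h hx0 hx1
    let k : ℕ → ℝ := fun n => if n ∈ Finset.range N then ‖g n - C * be τ n‖ else 0
    have hk : HasSum k K := by
      rw [hK, show ∑ n ∈ Finset.range N, ‖g n - C * be τ n‖ = ∑ n ∈ Finset.range N, k n from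
        Finset.sum_congr rfl (fun n hn => by simp only [k]; rw [if_pos hn])]
      exact hasSum_sum_of_ne_finset_zero (fun n hn => by simp only [k]; rw [if_neg hn])
    have b2 := hk.add (b.mul_left (‖C‖ / 2))
    have hle : ‖ser g x - C * ser (be τ) x‖ ≤ K + ‖C‖ / 2 * ‖ser (be τ) x‖ := by
      rw [← s3.tsum_eq]
      refine tsum_of_norm_bounded b2 ?_
      intro n
      have e : g n * (x:ℂ) ^ n - C * (be τ n * (x:ℂ) ^ n) = (g n - C * be τ n) * (x:ℂ) ^ n := by ring
      rw [e, norm_mul, norm_pow, Complex.norm_real, Real.norm_of_nonneg hx0]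
      by_cases hn : n ∈ Finset.range N
      · simp only [k]
        rw [if_pos hn]
        have h1 : ‖g n - C * be τ n‖ * x ^ n ≤ ‖g n - C * be τ n‖ * 1 := by
          gcongr; exact pow_le_one₀ hx0 hx1.le
        have h2 : 0 ≤ ‖C‖ / 2 * (‖be (τ.re : ℂ) n‖ * x ^ n) := by positivity
        linarith
      · simp only [k]
        rw [if_neg hn, zero_add]
        have hn' : N ≤ n := by simpa using hn
        have h1 := hN n hn'
        rw [dist_eq_norm] at h1
        have h2 : ‖g n - C * be τ n‖ = ‖g n / be τ n - C‖ * ‖be τ n‖ := by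
          rw [← norm_mul, sub_mul, div_mul_cancel₀ _ (be_ne h n)]
        have h3 : ‖g n - C * be τ n‖ ≤ ‖C‖ / 2 * ‖be (τ.re : ℂ) n‖ := by
          rw [h2]
          calc ‖g n / be τ n - C‖ * ‖be τ n‖ ≤ (‖C‖ / (2 * M)) * (M * ‖be (τ.re : ℂ) n‖) := by
                gcongr; exact hM n
            _ = _ := by field_simp
        rw [← mul_assoc]
        gcongr
    have h4 : ‖C * ser (be τ) x‖ ≤ ‖ser g x‖ + ‖ser g x - C * ser (be τ) x‖ := by
      have := norm_sub_le (ser g x) (ser g x - C * ser (be τ) x)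
      simpa using this
    rw [norm_mul] at h4
    linarith
  have hS : Tendsto (fun x => ‖C‖ / 2 * Real.exp (-((1 + τ.re) * Real.log (1 - x))) - K) (𝓝[<] 1) atTop := by
    have h1 : Tendsto (fun x : ℝ => 1 - x) (𝓝[<] 1) (𝓝[>] 0) := by
      refine tendsto_nhdsWithin_iff.2 ⟨?_, ?_⟩
      · have : Tendsto (fun x : ℝ => 1 - x) (𝓝 1) (𝓝 (1 - 1)) := tendsto_const_nhds.sub tendsto_id
        rw [sub_self] at this
        exact this.mono_left nhdsWithin_le_nhds
      · filter_upwards [self_mem_nhdsWithin] with x hx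
        have : x < 1 := hx
        show 0 < 1 - x
        linarith
    have h2 := Real.tendsto_log_nhdsGT_zero.comp h1
    have h3 : Tendsto (fun x => -((1 + τ.re) * Real.log (1 - x))) (𝓝[<] 1) atTop :=
      tendsto_neg_atBot_atTop.comp (h2.const_mul_atBot (by linarith))
    have h4 := (Real.tendsto_exp_atTop.comp h3).const_mul_atTop (show 0 < ‖C‖ / 2 by positivity)
    exact tendsto_atTop_add_const_right _ (-K) h4
  refine tendsto_atTop_mono' _ ?_ hS
  filter_upwards [Ioo_mem_nhdsLT (show (0:ℝ) < 1 by norm_num)] with x hx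
  rw [← be_ser_norm h hx.1.le hx.2]
  exact hbd x hx.1.le hx.2

lemma exists_blowup {m : ℝ} (hm : 1 ≤ m) {l : ℂ} (hl : 0 ≤ l.re) (hne : l ≠ 1) :
    ∃ k : ℕ, Tendsto (fun x => ‖ser (dc^[k] (co m l)) x‖) (𝓝[<] 1) atTop := by
  obtain ⟨k, hk⟩ := exists_nat_ge (m + 3)
  obtain ⟨τ, hτ⟩ : ∃ τ : ℂ, τ = l - (m + 3) / 2 + k := ⟨_, rfl⟩
  have hτre : 0 < τ.re := by
    have e : τ.re = l.re - (m + 3) / 2 + k := by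
      rw [hτ, show ((m:ℂ) + 3) / 2 = (((m + 3) / 2 : ℝ) : ℂ) by push_cast; rfl]
      simp
    rw [e]; linarith
  have hk1 : 1 ≤ k := by
    have : (1:ℝ) ≤ k := by linarith
    exact_mod_cast this
  have hco : ∀ n, co m l (n + k) ≠ 0 := by
    intro n
    obtain ⟨j, hj⟩ : ∃ j, n + k = j + 1 := ⟨n + k - 1, by omega⟩
    rw [hj]; exact (co_lower hm hl hne j).1
  have hg0 : ∀ n, dc^[k] (co m l) n ≠ 0 := by
    intro n
    rw [dc_iter]
    exact mul_ne_zero (by exact_mod_cast (Nat.ascFactorial_pos _ _).ne') (hco n)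
  obtain ⟨C, hC, ht⟩ := tendsto_of_ratio (s := fun n => dc^[k] (co m l) n / be τ n)
    (η := fun n => co m l (n + k + 1) / co m l (n + k) / rt m l (n + k) - 1)
    ((summable_nat_add_iff k).2 (ratio_summable hm hl hne)) 0
    (fun n _ => div_ne_zero (hg0 n) (be_ne hτre n)) (fun n _ => by
      rw [be, dc_iter, dc_iter, rt]
      have hf : ((n:ℂ) + 1) * ((n + 1 + 1).ascFactorial k : ℂ) = (n + 1 + k) * ((n + 1).ascFactorial k : ℂ) := by
        have := Nat.succ_ascFactorial (n + 1) k
        exact_mod_cast this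
      have h1 := hco n
      have h2 := be_fac_ne hτre n
      have h3 := be_ne hτre n
      have h4 : ((n:ℂ) + 1) ≠ 0 := Nat.cast_add_one_ne_zero n
      have h5 : ((n:ℂ) + k + 1) ≠ 0 := by
        have := Nat.cast_add_one_ne_zero (R := ℂ) (n + k)
        push_cast at this; exact this
      have e1 : ((n + k : ℕ) : ℂ) + 1 + (l - (m + 3) / 2) = n + 1 + τ := by rw [hτ]; push_cast; ring
      rw [e1, show n + 1 + k = n + k + 1 by ring]
      push_cast
      generalize co m l (n + k + 1) = c1
      generalize be τ n = b at *
      generalize co m l (n + k) = c0 at *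
      generalize (n:ℂ) + 1 + τ = D at *
      have hf2 : ((n + 1 + 1).ascFactorial k : ℂ) = (n + k + 1) * ((n + 1).ascFactorial k : ℂ) / (n + 1) := by
        rw [eq_div_iff h4]; linear_combination hf
      rw [hf2]
      field_simp
      ring)
  exact ⟨k, unbounded ((co_sub1 hm hl hne).iter k) hτre hC ht⟩

end MS

namespace MS

open Filter Topology

noncomputable def zf (m ρ : ℝ) : ℝ := (m + 1) * ρ ^ 2 / (ρ ^ 2 + m)
noncomputable def Ef (m : ℝ) (l : ℂ) (ρ : ℝ) : ℂ :=
  Complex.exp (-(l + 1) / 2 * (Real.log (ρ ^ 2 + m) : ℝ))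
noncomputable def Af (m : ℝ) (l : ℂ) (ρ : ℝ) : ℂ := 1 - (l + 1) * (ρ : ℂ) ^ 2 / ((ρ : ℂ) ^ 2 + m)
noncomputable def Bf (m : ℝ) (ρ : ℝ) : ℂ := 2 * (m + 1) * m * (ρ : ℂ) ^ 2 / ((ρ : ℂ) ^ 2 + m) ^ 2
/-- the explicit solution regular at the origin -/
noncomputable def ph (m : ℝ) (l : ℂ) (ρ : ℝ) : ℂ := ρ * Ef m l ρ * ser (co m l) (zf m ρ)
/-- its first derivative -/
noncomputable def ph1 (m : ℝ) (l : ℂ) (ρ : ℝ) : ℂ :=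
  Ef m l ρ * (Af m l ρ * ser (co m l) (zf m ρ) + Bf m ρ * ser (dc (co m l)) (zf m ρ))
/-- its second derivative -/
noncomputable def ph2 (m : ℝ) (l : ℂ) (ρ : ℝ) : ℂ :=
  Ef m l ρ * (-(l + 1) * ρ / ((ρ : ℂ) ^ 2 + m) *
      (Af m l ρ * ser (co m l) (zf m ρ) + Bf m ρ * ser (dc (co m l)) (zf m ρ))
    + (-2 * (l + 1) * ρ * m / ((ρ : ℂ) ^ 2 + m) ^ 2) * ser (co m l) (zf m ρ)
    + (Af m l ρ * (2 * (m + 1) * m * ρ / ((ρ : ℂ) ^ 2 + m) ^ 2) +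
        4 * (m + 1) * m * ρ * (m - (ρ : ℂ) ^ 2) / ((ρ : ℂ) ^ 2 + m) ^ 3) * ser (dc (co m l)) (zf m ρ)
    + Bf m ρ * (2 * (m + 1) * m * ρ / ((ρ : ℂ) ^ 2 + m) ^ 2) * ser (dc (dc (co m l))) (zf m ρ))

lemma s_pos {m : ℝ} (hm : 1 ≤ m) (ρ : ℝ) : 0 < ρ ^ 2 + m := by positivity

lemma s_ne {m : ℝ} (hm : 1 ≤ m) (ρ : ℝ) : (ρ : ℂ) ^ 2 + m ≠ 0 := by
  have := (s_pos hm ρ).ne'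
  exact_mod_cast this

lemma zf_lt {m : ℝ} (hm : 1 ≤ m) {ρ : ℝ} (h : |ρ| < 1) : |zf m ρ| < 1 := by
  have h1 : ρ ^ 2 < 1 := by rwa [sq_lt_one_iff_abs_lt_one]
  have h2 := s_pos hm ρ
  rw [zf, abs_of_nonneg (by positivity), div_lt_one h2]
  nlinarith

lemma hd_zf {m : ℝ} (hm : 1 ≤ m) (ρ : ℝ) :
    HasDerivAt (zf m) (2 * (m + 1) * m * ρ / (ρ ^ 2 + m) ^ 2) ρ := by
  have h2 := s_pos hm ρ
  have h := ((hasDerivAt_pow 2 ρ).const_mul (m + 1)).div ((hasDerivAt_pow 2 ρ).add_const m) h2.ne'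
  refine h.congr_deriv ?_
  field_simp
  push_cast
  ring

lemma hd_ser {m : ℝ} (hm : 1 ≤ m) {c : ℕ → ℂ} (hc : Sub1 c) {ρ : ℝ} (h : |ρ| < 1) :
    HasDerivAt (fun ρ => ser c (zf m ρ))
      ((2 * (m + 1) * m * ρ / ((ρ : ℂ) ^ 2 + m) ^ 2) * ser (dc c) (zf m ρ)) ρ := by
  have h1 := (hc.hasDerivAt (zf_lt hm h)).scomp ρ (hd_zf hm ρ)
  refine h1.congr_deriv ?_
  rw [Complex.real_smul]
  push_cast; rfl

lemma hd_E {m : ℝ} (hm : 1 ≤ m) (l : ℂ) (ρ : ℝ) :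
    HasDerivAt (Ef m l) (Ef m l ρ * (-(l + 1) * ρ / ((ρ : ℂ) ^ 2 + m))) ρ := by
  have h1 : HasDerivAt (fun ρ : ℝ => Real.log (ρ ^ 2 + m)) _ ρ :=
    ((hasDerivAt_pow 2 ρ).add_const m).log (s_pos hm ρ).ne'
  have h2 := (h1.ofReal_comp.const_mul (-(l + 1) / 2)).cexp
  refine h2.congr_deriv ?_
  have := s_ne hm ρ
  rw [Ef]
  push_cast
  field_simp

lemma hd_sq (ρ : ℝ) : HasDerivAt (fun ρ : ℝ => (ρ : ℂ) ^ 2) (2 * ρ) ρ := by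
  have := (hasDerivAt_id ρ).ofReal_comp.pow 2
  exact this.congr_deriv (by simp)

lemma hd_A {m : ℝ} (hm : 1 ≤ m) (l : ℂ) (ρ : ℝ) :
    HasDerivAt (Af m l) (-2 * (l + 1) * ρ * m / ((ρ : ℂ) ^ 2 + m) ^ 2) ρ := by
  have hs := s_ne hm ρ
  have h := (((hd_sq ρ).const_mul (l + 1)).div ((hd_sq ρ).add_const (m : ℂ)) hs).const_sub 1
  refine h.congr_deriv ?_
  field_simp
  ring

lemma hd_B {m : ℝ} (hm : 1 ≤ m) (ρ : ℝ) :
    HasDerivAt (Bf m) (4 * (m + 1) * m * ρ * (m - (ρ : ℂ) ^ 2) / ((ρ : ℂ) ^ 2 + m) ^ 3) ρ := by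
  have hs := s_ne hm ρ
  have h := ((hd_sq ρ).const_mul (2 * ((m:ℂ) + 1) * m)).div (((hd_sq ρ).add_const (m : ℂ)).pow 2)
    (pow_ne_zero 2 hs)
  refine h.congr_deriv ?_
  simp only [Pi.pow_apply]
  field_simp
  push_cast
  ring

lemma hd_ph {m : ℝ} (hm : 1 ≤ m) {l : ℂ} (hl : 0 ≤ l.re) (hne : l ≠ 1) {ρ : ℝ} (h : |ρ| < 1) :
    HasDerivAt (ph m l) (ph1 m l ρ) ρ := by
  have hs := s_ne hm ρ
  have h1 := ((hasDerivAt_id ρ).ofReal_comp.mul (hd_E hm l ρ)).mul (hd_ser hm (co_sub1 hm hl hne) h)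
  refine h1.congr_deriv ?_
  simp only [ph1, Af, Bf, id, Pi.mul_apply]
  push_cast
  field_simp
  ring

lemma hd_ph1 {m : ℝ} (hm : 1 ≤ m) {l : ℂ} (hl : 0 ≤ l.re) (hne : l ≠ 1) {ρ : ℝ} (h : |ρ| < 1) :
    HasDerivAt (ph1 m l) (ph2 m l ρ) ρ := by
  have h0 := co_sub1 hm hl hne
  have h1 := (hd_E hm l ρ).mul (((hd_A hm l ρ).mul (hd_ser hm h0 h)).add
    ((hd_B hm ρ).mul (hd_ser hm h0.dc h)))
  refine h1.congr_deriv ?_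
  simp only [ph2, Pi.mul_apply, Pi.add_apply]
  ring

lemma ph_ode {m : ℝ} (hm : 1 ≤ m) {l : ℂ} (hl : 0 ≤ l.re) (hne : l ≠ 1) {ρ : ℝ} (h : |ρ| < 1)
    (hρ : ρ ≠ 0) :
    (1 - (ρ : ℂ) ^ 2) * ph2 m l ρ + ((m + 1) / (ρ : ℂ) - 2 * (l + 1) * ρ) * ph1 m l ρ
      - l * (l + 1) * ph m l ρ - ((m + 1) / (ρ : ℂ) ^ 2) *
        (((ρ : ℂ) ^ 4 - 6 * m * (ρ : ℂ) ^ 2 + m ^ 2) / ((ρ : ℂ) ^ 2 + m) ^ 2) * ph m l ρ = 0 := by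
  have hh := heun hm hl hne (zf_lt hm h)
  have hs := s_ne hm ρ
  have hρ' : (ρ : ℂ) ≠ 0 := by exact_mod_cast hρ
  have hz : ((zf m ρ : ℝ) : ℂ) = (m + 1) * (ρ : ℂ) ^ 2 / ((ρ : ℂ) ^ 2 + m) := by
    rw [zf]; push_cast; rfl
  rw [hz] at hh
  rw [← mul_zero (Ef m l ρ * ρ / ((ρ : ℂ) ^ 2 + m)), ← hh]
  simp only [ph, ph1, ph2, Af, Bf]
  generalize ser (co m l) (zf m ρ) = F0
  generalize ser (dc (co m l)) (zf m ρ) = F1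
  generalize ser (dc (dc (co m l))) (zf m ρ) = F2
  generalize Ef m l ρ = E
  generalize (ρ : ℂ) = x at *
  generalize (m : ℂ) = M at *
  field_simp
  ring

end MS

namespace MS

open Filter Topology

lemma ode_zero {p q v v1 : ℝ → ℂ} (hp : ContinuousOn p (Set.Ioo 0 1)) (hq : ContinuousOn q (Set.Ioo 0 1))
    (hv : ∀ t ∈ Set.Ioo (0:ℝ) 1, HasDerivAt v (v1 t) t)
    (hv1 : ∀ t ∈ Set.Ioo (0:ℝ) 1, HasDerivAt v1 (p t * v1 t + q t * v t) t)
    {t0 : ℝ} (ht0 : t0 ∈ Set.Ioo (0:ℝ) 1) (h0 : v t0 = 0) (h1 : v1 t0 = 0)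
    {t : ℝ} (ht : t ∈ Set.Ioo (0:ℝ) 1) : v t = 0 := by
  obtain ⟨a, ha0, ha⟩ := exists_between (lt_min ht.1 ht0.1)
  obtain ⟨b, hb, hb1⟩ := exists_between (max_lt ht.2 ht0.2)
  have hta : a < t := ha.trans_le (min_le_left _ _)
  have ht0a : a < t0 := ha.trans_le (min_le_right _ _)
  have htb : t < b := (le_max_left _ _).trans_lt hb
  have ht0b : t0 < b := (le_max_right _ _).trans_lt hb
  have hsub : Set.Icc a b ⊆ Set.Ioo 0 1 := fun x hx => ⟨ha0.trans_le hx.1, hx.2.trans_lt hb1⟩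
  obtain ⟨P, hP⟩ := isCompact_Icc.exists_bound_of_continuousOn (hp.mono hsub)
  obtain ⟨Q, hQ⟩ := isCompact_Icc.exists_bound_of_continuousOn (hq.mono hsub)
  have hta' : t ∈ Set.Icc a b := ⟨hta.le, htb.le⟩
  have hP0 : 0 ≤ P := (norm_nonneg _).trans (hP t hta')
  have hQ0 : 0 ≤ Q := (norm_nonneg _).trans (hQ t hta')
  let K : NNReal := ⟨P + Q + 1, by positivity⟩
  have key := ODE_solution_unique_of_mem_Ioo (E := ℂ × ℂ)
    (v := fun t y => (y.2, p t * y.2 + q t * y.1)) (s := fun _ => Set.univ) (K := K)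
    (a := a) (b := b) (t₀ := t0) (f := fun t => (v t, v1 t)) (g := fun _ => (0, 0)) ?_ ⟨ht0a, ht0b⟩ ?_ ?_ ?_
  · have := key ⟨hta, htb⟩
    exact congrArg Prod.fst this
  · intro s hs
    have hs' : s ∈ Set.Icc a b := ⟨hs.1.le, hs.2.le⟩
    refine LipschitzOnWith.of_dist_le_mul ?_
    intro y _ w _
    rw [dist_eq_norm, dist_eq_norm]
    have e1 : ‖y.1 - w.1‖ ≤ ‖y - w‖ := norm_fst_le (y - w)
    have e2 : ‖y.2 - w.2‖ ≤ ‖y - w‖ := norm_snd_le (y - w)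
    have e3 := norm_nonneg (y - w)
    have hK : (K : ℝ) = P + Q + 1 := rfl
    rw [hK]
    refine norm_prod_le_iff.2 ⟨?_, ?_⟩
    · change ‖y.2 - w.2‖ ≤ _
      nlinarith [mul_nonneg hP0 e3, mul_nonneg hQ0 e3]
    · change ‖p s * y.2 + q s * y.1 - (p s * w.2 + q s * w.1)‖ ≤ _
      have e4 : p s * y.2 + q s * y.1 - (p s * w.2 + q s * w.1) =
        p s * (y.2 - w.2) + q s * (y.1 - w.1) := by ring
      rw [e4]
      calc ‖p s * (y.2 - w.2) + q s * (y.1 - w.1)‖ ≤ ‖p s‖ * ‖y.2 - w.2‖ + ‖q s‖ * ‖y.1 - w.1‖ := by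
            refine (norm_add_le _ _).trans ?_
            rw [norm_mul, norm_mul]
        _ ≤ P * ‖y - w‖ + Q * ‖y - w‖ := by
            gcongr
            · exact hP s hs'
            · exact hQ s hs'
        _ ≤ _ := by nlinarith
  · intro s hs
    have hs' : s ∈ Set.Ioo (0:ℝ) 1 := hsub ⟨hs.1.le, hs.2.le⟩
    exact ⟨(hv s hs').prodMk (hv1 s hs'), trivial⟩
  · intro s hs
    refine ⟨?_, trivial⟩
    have := hasDerivAt_const s ((0:ℂ), (0:ℂ))
    refine this.congr_deriv ?_
    simp only [mul_zero, add_zero]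
    rfl
  · simp [h0, h1]

/-- Two solutions of the mode equation, both C¹ up to the origin, have zero Wronskian. -/
lemma wronskian_zero (k : ℕ) (l : ℂ) {u u1 u2 w w1 w2 q : ℝ → ℂ}
    (hu : ∀ t ∈ Set.Ioo (0:ℝ) 1, HasDerivAt u (u1 t) t)
    (hu1 : ∀ t ∈ Set.Ioo (0:ℝ) 1, HasDerivAt u1 (u2 t) t)
    (hw : ∀ t ∈ Set.Ioo (0:ℝ) 1, HasDerivAt w (w1 t) t)
    (hw1 : ∀ t ∈ Set.Ioo (0:ℝ) 1, HasDerivAt w1 (w2 t) t)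
    (hou : ∀ t ∈ Set.Ioo (0:ℝ) 1, (1 - (t:ℂ) ^ 2) * u2 t +
      ((k + 2) / (t:ℂ) - 2 * (l + 1) * t) * u1 t - q t * u t = 0)
    (how : ∀ t ∈ Set.Ioo (0:ℝ) 1, (1 - (t:ℂ) ^ 2) * w2 t +
      ((k + 2) / (t:ℂ) - 2 * (l + 1) * t) * w1 t - q t * w t = 0)
    {a0 a1 b0 b1 : ℂ} (hua : Tendsto u (𝓝[>] 0) (𝓝 a0)) (hu1a : Tendsto u1 (𝓝[>] 0) (𝓝 a1))
    (hwb : Tendsto w (𝓝[>] 0) (𝓝 b0)) (hw1b : Tendsto w1 (𝓝[>] 0) (𝓝 b1))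
    {t : ℝ} (ht : t ∈ Set.Ioo (0:ℝ) 1) : u t * w1 t - u1 t * w t = 0 := by
  obtain ⟨J, hJ⟩ : ∃ J : ℝ → ℂ, J = fun t : ℝ => (t:ℂ) ^ (k + 2) *
    Complex.exp ((l + 1 - (k + 2) / 2) * (Real.log (1 - t ^ 2) : ℝ)) := ⟨_, rfl⟩
  have hJd : ∀ t ∈ Set.Ioo (0:ℝ) 1, HasDerivAt J
      (J t * (((k + 2) / (t:ℂ) - 2 * (l + 1) * t) / (1 - (t:ℂ) ^ 2))) t := by
    intro t ht
    have hpos : 1 - t ^ 2 ≠ 0 := by nlinarith [ht.1, ht.2]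
    have hpos' : 1 - (t:ℂ) ^ 2 ≠ 0 := by exact_mod_cast hpos
    have ht0 : (t:ℂ) ≠ 0 := by exact_mod_cast ht.1.ne'
    have h1 : HasDerivAt (fun t : ℝ => (t:ℂ) ^ (k + 2)) ((k + 2) * (t:ℂ) ^ (k + 1)) t := by
      have := (hasDerivAt_id t).ofReal_comp.pow (k + 2)
      exact this.congr_deriv (by simp)
    have h2 : HasDerivAt (fun t : ℝ => Real.log (1 - t ^ 2)) _ t :=
      ((hasDerivAt_pow 2 t).const_sub 1).log hpos
    have h3 := (h2.ofReal_comp.const_mul (l + 1 - (k + 2) / 2)).cexp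
    rw [hJ]
    refine (h1.mul h3).congr_deriv ?_
    push_cast
    field_simp
    ring
  have hd : ∀ t ∈ Set.Ioo (0:ℝ) 1, HasDerivAt (fun t => J t * (u t * w1 t - u1 t * w t)) 0 t := by
    intro t ht
    have hpos : 1 - t ^ 2 ≠ 0 := by nlinarith [ht.1, ht.2]
    have hpos' : 1 - (t:ℂ) ^ 2 ≠ 0 := by exact_mod_cast hpos
    refine ((hJd t ht).mul (((hu t ht).mul (hw1 t ht)).sub ((hu1 t ht).mul (hw t ht)))).congr_deriv ?_
    simp only [Pi.mul_apply, Pi.sub_apply]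
    have e1 := hou t ht
    have e2 := how t ht
    generalize ((k + 2) / (t:ℂ) - 2 * (l + 1) * t) = R at *
    field_simp
    linear_combination (J t * u t) * e2 - (J t * w t) * e1
  have hconst : ∀ s ∈ Set.Ioo (0:ℝ) 1, J s * (u s * w1 s - u1 s * w s) = J t * (u t * w1 t - u1 t * w t) := by
    intro s hs
    exact isOpen_Ioo.is_const_of_deriv_eq_zero (isPreconnected_Ioo (a := (0:ℝ)) (b := 1))
      (f := fun t => J t * (u t * w1 t - u1 t * w t))
      (fun y hy => (hd y hy).differentiableAt.differentiableWithinAt)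
      (fun y hy => (hd y hy).deriv) hs ht
  have hJ0 : Tendsto J (𝓝[>] 0) (𝓝 0) := by
    have hc : ContinuousAt J 0 := by
      rw [hJ]
      refine ContinuousAt.mul (by fun_prop) (ContinuousAt.cexp ?_)
      refine continuousAt_const.mul (Complex.continuous_ofReal.continuousAt.comp ?_)
      exact ContinuousAt.log (by fun_prop) (by norm_num)
    have h2 := hc.tendsto
    have : J 0 = 0 := by rw [hJ]; simp
    rw [this] at h2
    exact h2.mono_left nhdsWithin_le_nhds
  have hlim := hJ0.mul ((hua.mul hw1b).sub (hu1a.mul hwb))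
  rw [zero_mul] at hlim
  have hlim2 : Tendsto (fun s => J s * (u s * w1 s - u1 s * w s)) (𝓝[>] 0)
      (𝓝 (J t * (u t * w1 t - u1 t * w t))) := by
    refine tendsto_const_nhds.congr' ?_
    filter_upwards [Ioo_mem_nhdsGT (show (0:ℝ) < 1 by norm_num)] with s hs
    exact (hconst s hs).symm
  have hz := tendsto_nhds_unique hlim2 hlim
  have hJt : J t ≠ 0 := by
    rw [hJ]
    refine mul_ne_zero (pow_ne_zero _ ?_) (Complex.exp_ne_zero _)
    exact_mod_cast ht.1.ne'
  exact (mul_eq_zero.1 hz).resolve_left hJt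

end MS

namespace MS

open Filter Topology

/-- A smooth function on `[1/2,1]` cannot agree with the blowing-up power series. -/
lemma no_smooth {m : ℝ} (hm : 1 ≤ m) {l : ℂ} (hl : 0 ≤ l.re) (hne : l ≠ 1) {h : ℝ → ℂ}
    (hh : ContDiffOn ℝ (⊤ : ℕ∞) h (Set.Icc (1 / 2) 1))
    (heq : ∀ x ∈ Set.Ioo (1 / 2 : ℝ) 1, h x = ser (co m l) x) : False := by
  have hud : UniqueDiffOn ℝ (Set.Icc (1 / 2 : ℝ) 1) := uniqueDiffOn_Icc (by norm_num)
  have key : ∀ j : ℕ, ∃ g : ℝ → ℂ, ContDiffOn ℝ (⊤ : ℕ∞) g (Set.Icc (1 / 2) 1) ∧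
      ∀ x ∈ Set.Ioo (1 / 2 : ℝ) 1, g x = ser (dc^[j] (co m l)) x := by
    intro j
    induction j with
    | zero => exact ⟨h, hh, heq⟩
    | succ j ih =>
      obtain ⟨g, hg, hgeq⟩ := ih
      refine ⟨derivWithin g (Set.Icc (1 / 2) 1), hg.derivWithin hud (by norm_cast), ?_⟩
      intro x hx
      rw [derivWithin_of_mem_nhds (Icc_mem_nhds hx.1 hx.2)]
      have he : g =ᶠ[𝓝 x] ser (dc^[j] (co m l)) := by
        filter_upwards [Ioo_mem_nhds hx.1 hx.2] with y hy using hgeq y hy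
      rw [he.deriv_eq, Function.iterate_succ_apply']
      refine (((co_sub1 hm hl hne).iter j).hasDerivAt ?_).deriv
      rw [abs_of_nonneg (by linarith [hx.1])]; exact hx.2
  obtain ⟨k, hk⟩ := exists_blowup hm hl hne
  obtain ⟨g, hg, hgeq⟩ := key k
  obtain ⟨B, hB⟩ := isCompact_Icc.exists_bound_of_continuousOn hg.continuousOn
  obtain ⟨x, hx1, hx2⟩ := ((hk.eventually_gt_atTop B).and
    (Ioo_mem_nhdsLT (show (1 / 2 : ℝ) < 1 by norm_num))).exists
  have := hB x ⟨hx2.1.le, hx2.2.le⟩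
  rw [hgeq x hx2] at this
  linarith

lemma main (k : ℕ) (l : ℂ) (hl : 0 ≤ l.re) (hne : l ≠ 1)
    (u : ℝ → ℂ) (hu : ContDiffOn ℝ (⊤ : ℕ∞) u (Set.Icc 0 1))
    (hode : ∀ ρ ∈ Set.Ioo (0 : ℝ) 1,
      (1 - (ρ : ℂ) ^ 2) * deriv (deriv u) ρ
        + ((k + 2) / (ρ : ℂ) - 2 * (l + 1) * (ρ : ℂ)) * deriv u ρ
        - (l * (l + 1) + ((k + 2) / (ρ : ℂ) ^ 2) * (((ρ : ℂ) ^ 4 - 6 * (k + 1) * (ρ : ℂ) ^ 2 +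
          (k + 1) ^ 2) / ((ρ : ℂ) ^ 2 + (k + 1)) ^ 2)) * u ρ = 0) :
    Set.EqOn u 0 (Set.Icc 0 1) := by
  obtain ⟨m, hmk⟩ : ∃ m : ℝ, m = k + 1 := ⟨_, rfl⟩
  have hm : 1 ≤ m := by rw [hmk]; have : (0:ℝ) ≤ k := by positivity
                        linarith
  have hmk' : (m : ℂ) = k + 1 := by rw [hmk]; push_cast; rfl
  have hud : UniqueDiffOn ℝ (Set.Icc (0 : ℝ) 1) := uniqueDiffOn_Icc (by norm_num)
  have habs : ∀ {t : ℝ}, t ∈ Set.Ioo (0:ℝ) 1 → |t| < 1 := by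
    intro t ht; rw [abs_of_nonneg ht.1.le]; exact ht.2
  have hmem : ∀ {t : ℝ}, t ∈ Set.Ioo (0:ℝ) 1 → Set.Icc (0:ℝ) 1 ∈ 𝓝 t := fun ht => Icc_mem_nhds ht.1 ht.2
  have hat : ∀ t ∈ Set.Ioo (0:ℝ) 1, ContDiffAt ℝ (⊤ : ℕ∞) u t :=
    fun t ht => hu.contDiffAt (hmem ht)
  have hu0 : ∀ t ∈ Set.Ioo (0:ℝ) 1, HasDerivAt u (deriv u t) t :=
    fun t ht => ((hat t ht).differentiableAt (by norm_cast)).hasDerivAt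
  have hIoo : ContDiffOn ℝ (⊤ : ℕ∞) (deriv u) (Set.Ioo 0 1) :=
    (hu.mono Set.Ioo_subset_Icc_self).deriv_of_isOpen isOpen_Ioo (by norm_cast)
  have hu1 : ∀ t ∈ Set.Ioo (0:ℝ) 1, HasDerivAt (deriv u) (deriv (deriv u) t) t :=
    fun t ht => ((hIoo.contDiffAt (Ioo_mem_nhds ht.1 ht.2)).differentiableAt (by norm_cast)).hasDerivAt
  have hlim0 : Tendsto u (𝓝[>] 0) (𝓝 (u 0)) := by
    have := hu.continuousOn 0 ⟨le_rfl, zero_le_one⟩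
    have h2 : 𝓝[>] (0:ℝ) ≤ 𝓝[Set.Icc 0 1] 0 := by
      rw [← nhdsWithin_Ioo_eq_nhdsGT (show (0:ℝ) < 1 by norm_num)]
      exact nhdsWithin_mono _ Set.Ioo_subset_Icc_self
    exact this.tendsto.mono_left h2
  have hlim1 : Tendsto (deriv u) (𝓝[>] 0) (𝓝 (derivWithin u (Set.Icc 0 1) 0)) := by
    have := hu.continuousOn_derivWithin hud (by norm_cast) 0 ⟨le_rfl, zero_le_one⟩
    have h2 : 𝓝[>] (0:ℝ) ≤ 𝓝[Set.Icc 0 1] 0 := by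
      rw [← nhdsWithin_Ioo_eq_nhdsGT (show (0:ℝ) < 1 by norm_num)]
      exact nhdsWithin_mono _ Set.Ioo_subset_Icc_self
    refine (this.tendsto.mono_left h2).congr' ?_
    filter_upwards [Ioo_mem_nhdsGT (show (0:ℝ) < 1 by norm_num)] with t ht
    exact derivWithin_of_mem_nhds (hmem ht)
  have hp0 : Tendsto (ph m l) (𝓝[>] 0) (𝓝 (ph m l 0)) :=
    (hd_ph hm hl hne (by simp : |(0:ℝ)| < 1)).continuousAt.tendsto.mono_left nhdsWithin_le_nhds
  have hp1 : Tendsto (ph1 m l) (𝓝[>] 0) (𝓝 (ph1 m l 0)) :=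
    (hd_ph1 hm hl hne (by simp : |(0:ℝ)| < 1)).continuousAt.tendsto.mono_left nhdsWithin_le_nhds
  obtain ⟨q, hq⟩ : ∃ q : ℝ → ℂ, q = fun ρ : ℝ => (l * (l + 1) + ((k + 2) / (ρ : ℂ) ^ 2) *
    (((ρ : ℂ) ^ 4 - 6 * (k + 1) * (ρ : ℂ) ^ 2 + (k + 1) ^ 2) / ((ρ : ℂ) ^ 2 + (k + 1)) ^ 2)) := ⟨_, rfl⟩
  have hou : ∀ t ∈ Set.Ioo (0:ℝ) 1, (1 - (t:ℂ) ^ 2) * deriv (deriv u) t +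
      ((k + 2) / (t:ℂ) - 2 * (l + 1) * t) * deriv u t - q t * u t = 0 := by
    intro t ht; rw [hq]; exact hode t ht
  have hop : ∀ t ∈ Set.Ioo (0:ℝ) 1, (1 - (t:ℂ) ^ 2) * ph2 m l t +
      ((k + 2) / (t:ℂ) - 2 * (l + 1) * t) * ph1 m l t - q t * ph m l t = 0 := by
    intro t ht
    have := ph_ode hm hl hne (habs ht) ht.1.ne'
    rw [hq, ← this, hmk']
    ring
  have hW : ∀ t ∈ Set.Ioo (0:ℝ) 1, u t * ph1 m l t - deriv u t * ph m l t = 0 := by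
    intro t ht
    exact wronskian_zero k l hu0 hu1 (fun t ht => hd_ph hm hl hne (habs ht))
      (fun t ht => hd_ph1 hm hl hne (habs ht)) hou hop hlim0 hlim1 hp0 hp1 ht
  -- a point where `ph` does not vanish
  obtain ⟨t0, ht0, hpt0⟩ : ∃ t0 ∈ Set.Ioo (0:ℝ) 1, ph m l t0 ≠ 0 := by
    have hF0 : ser (co m l) (zf m 0) = 1 := by
      rw [show zf m 0 = 0 by simp [zf], ser, tsum_eq_single 0]
      · simp [co]
      · intro n hn; simp [hn]
    have hc := (hd_ser hm (co_sub1 hm hl hne) (by simp : |(0:ℝ)| < 1)).continuousAt.tendsto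
    rw [hF0] at hc
    have h2 := (hc.mono_left (nhdsWithin_le_nhds (s := Set.Ioi 0))).eventually_ne one_ne_zero
    obtain ⟨t, h3, ht⟩ := (h2.and (Ioo_mem_nhdsGT (show (0:ℝ) < 1 by norm_num))).exists
    refine ⟨t, ht, mul_ne_zero (mul_ne_zero ?_ (Complex.exp_ne_zero _)) h3⟩
    exact_mod_cast ht.1.ne'
  obtain ⟨c, hc⟩ : ∃ c : ℂ, c = u t0 / ph m l t0 := ⟨_, rfl⟩
  have huc : ∀ t ∈ Set.Ioo (0:ℝ) 1, u t = c * ph m l t := by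
    intro t ht
    have hne1 : ∀ s ∈ Set.Ioo (0:ℝ) 1, (1 - (s:ℂ) ^ 2) ≠ 0 := by
      intro s hs
      have : 1 - s ^ 2 ≠ 0 := by nlinarith [hs.1, hs.2]
      exact_mod_cast this
    have hne0 : ∀ s ∈ Set.Ioo (0:ℝ) 1, (s:ℂ) ≠ 0 := by
      intro s hs
      exact_mod_cast hs.1.ne'
    have hcs : Continuous (fun s : ℝ => (s:ℂ)) := Complex.continuous_ofReal
    have hqc : ContinuousOn q (Set.Ioo 0 1) := by
      rw [hq]
      refine continuousOn_const.add (ContinuousOn.mul (ContinuousOn.div (by fun_prop) (by fun_prop) ?_)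
        (ContinuousOn.div (by fun_prop) (by fun_prop) ?_))
      · intro s hs; exact pow_ne_zero 2 (hne0 s hs)
      · intro s hs; rw [← hmk']; exact pow_ne_zero 2 (s_ne hm s)
    have hz := ode_zero (p := fun s : ℝ => -(((k + 2) / (s:ℂ) - 2 * (l + 1) * s) / (1 - (s:ℂ) ^ 2)))
      (q := fun s : ℝ => q s / (1 - (s:ℂ) ^ 2))
      (v := fun s => u s - c * ph m l s) (v1 := fun s => deriv u s - c * ph1 m l s) ?_ ?_ ?_ ?_ ht0 ?_ ?_ ht
    · exact sub_eq_zero.1 hz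
    · refine ContinuousOn.neg (ContinuousOn.div (ContinuousOn.sub (ContinuousOn.div (by fun_prop) (by fun_prop)
        hne0) (by fun_prop)) (by fun_prop) hne1)
    · exact hqc.div (by fun_prop) hne1
    · intro s hs
      exact (hu0 s hs).sub ((hd_ph hm hl hne (habs hs)).const_mul c)
    · intro s hs
      refine ((hu1 s hs).sub ((hd_ph1 hm hl hne (habs hs)).const_mul c)).congr_deriv ?_
      have e1 := hou s hs
      have e2 := hop s hs
      have h1 := hne1 s hs
      generalize ((k + 2) / (s:ℂ) - 2 * (l + 1) * s) = R at *
      field_simp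
      linear_combination e1 - c * e2
    · rw [hc]; field_simp; simp
    · have := hW t0 ht0
      rw [hc]; field_simp
      linear_combination -this
  by_cases hc0 : c = 0
  · have hz : ∀ t ∈ Set.Ioo (0:ℝ) 1, u t = 0 := by
      intro t ht; rw [huc t ht, hc0, zero_mul]
    have hcl : closure (Set.Ioo (0:ℝ) 1) = Set.Icc 0 1 := closure_Ioo (by norm_num)
    have : Set.EqOn u 0 (Set.Ioo 0 1) := fun t ht => hz t ht
    refine this.of_subset_closure hu.continuousOn continuousOn_const Set.Ioo_subset_Icc_self hcl.ge
  · exfalso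
    obtain ⟨r, hr⟩ : ∃ r : ℝ → ℝ, r = fun z => √(m * z / (m + 1 - z)) := ⟨_, rfl⟩
    have hden : ∀ z ∈ Set.Icc (1 / 2 : ℝ) 1, 0 < m + 1 - z := by
      intro z hz; linarith [hz.2]
    have hrpos : ∀ z ∈ Set.Icc (1 / 2 : ℝ) 1, 0 < m * z / (m + 1 - z) := by
      intro z hz
      have h1 := hden z hz
      have h2 : 0 < z := by linarith [hz.1]
      positivity
    have hr0 : ∀ z ∈ Set.Icc (1 / 2 : ℝ) 1, 0 < r z := by
      intro z hz; rw [hr]; exact Real.sqrt_pos.2 (hrpos z hz)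
    have hrsq : ∀ z ∈ Set.Icc (1 / 2 : ℝ) 1, r z ^ 2 = m * z / (m + 1 - z) := by
      intro z hz; rw [hr]; exact Real.sq_sqrt (hrpos z hz).le
    have hrmap : Set.MapsTo r (Set.Icc (1 / 2 : ℝ) 1) (Set.Icc 0 1) := by
      intro z hz
      refine ⟨(hr0 z hz).le, ?_⟩
      rw [hr]
      refine Real.sqrt_le_one.2 ?_
      rw [div_le_one (hden z hz)]
      nlinarith [hz.2]
    have hrI : ∀ z ∈ Set.Ioo (1 / 2 : ℝ) 1, r z ∈ Set.Ioo (0:ℝ) 1 := by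
      intro z hz
      have hz' : z ∈ Set.Icc (1 / 2 : ℝ) 1 := ⟨hz.1.le, hz.2.le⟩
      refine ⟨hr0 z hz', ?_⟩
      have h1 : r z ^ 2 < 1 := by
        rw [hrsq z hz', div_lt_one (hden z hz')]
        nlinarith [hz.2]
      nlinarith [hr0 z hz']
    have hzr : ∀ z ∈ Set.Icc (1 / 2 : ℝ) 1, zf m (r z) = z := by
      intro z hz
      rw [zf, hrsq z hz]
      have h1 := hden z hz
      have h2 : m * z / (m + 1 - z) + m = m * (m + 1) / (m + 1 - z) := by field_simp; ring
      rw [h2]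
      field_simp
    have hrC : ContDiffOn ℝ (⊤ : ℕ∞) r (Set.Icc (1 / 2) 1) := by
      rw [hr]
      refine ContDiffOn.sqrt (ContDiffOn.div (by fun_prop) (by fun_prop) ?_) ?_
      · intro z hz; exact (hden z hz).ne'
      · intro z hz; exact (hrpos z hz).ne'
    have hrCc : ContDiffOn ℝ (⊤ : ℕ∞) (fun z => ((r z : ℝ) : ℂ)) (Set.Icc (1 / 2) 1) :=
      Complex.ofRealCLM.contDiff.comp_contDiffOn hrC
    refine no_smooth hm hl hne
      (h := fun z => c⁻¹ * (u (r z) * ((r z : ℂ))⁻¹ *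
        Complex.exp ((l + 1) / 2 * (Real.log (r z ^ 2 + m) : ℝ)))) ?_ ?_
    · refine contDiffOn_const.mul (((hu.comp hrC hrmap).mul (hrCc.inv ?_)).mul (ContDiffOn.cexp ?_))
      · intro z hz; exact_mod_cast (hr0 z hz).ne'
      · refine contDiffOn_const.mul ?_
        refine Complex.ofRealCLM.contDiff.comp_contDiffOn (ContDiffOn.log ?_ ?_)
        · exact (hrC.pow 2).add contDiffOn_const
        · intro z hz; exact (s_pos hm _).ne'
    · intro z hz
      have hz' : z ∈ Set.Icc (1 / 2 : ℝ) 1 := ⟨hz.1.le, hz.2.le⟩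
      have h1 : (r z : ℂ) ≠ 0 := by exact_mod_cast (hr0 z hz').ne'
      rw [huc _ (hrI z hz), ph, hzr z hz', Ef]
      have e : Complex.exp (-(l + 1) / 2 * (Real.log (r z ^ 2 + m) : ℝ)) *
        Complex.exp ((l + 1) / 2 * (Real.log (r z ^ 2 + m) : ℝ)) = 1 := by
        rw [← Complex.exp_add]
        convert Complex.exp_zero using 2
        ring
      generalize Complex.exp (-(l + 1) / 2 * (Real.log (r z ^ 2 + m) : ℝ)) = E1 at *
      generalize Complex.exp ((l + 1) / 2 * (Real.log (r z ^ 2 + m) : ℝ)) = E2 at *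
      field_simp
      linear_combination ser (co m l) z * e

end MS

/-- Mode stability of the Bizoń–Biernat self-similar wave map: for `d ≥ 3`, any mode
solution with `Re λ ≥ 0` and `λ ≠ 1` vanishes identically on `[0,1]`. -/
theorem mode_stability (d : ℕ) (hd : 3 ≤ d) (lam : ℂ) (hre : 0 ≤ lam.re) (hne : lam ≠ 1)
    (u : ℝ → ℂ) (hu : ContDiffOn ℝ (⊤ : ℕ∞) u (Set.Icc 0 1))
    (hode : ∀ ρ ∈ Set.Ioo (0 : ℝ) 1,
      (1 - (ρ : ℂ) ^ 2) * deriv (deriv u) ρ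
        + (((d : ℂ) - 1) / (ρ : ℂ) - 2 * (lam + 1) * (ρ : ℂ)) * deriv u ρ
        - lam * (lam + 1) * u ρ
        - V d ρ * u ρ = 0) :
    Set.EqOn u 0 (Set.Icc 0 1) := by
  obtain ⟨k, rfl⟩ : ∃ k, d = k + 3 := ⟨d - 3, by omega⟩
  refine MS.main k lam hre hne u hu ?_
  intro ρ hρ
  have h := hode ρ hρ
  rw [V] at h
  have e1 : ((k + 3 : ℕ) : ℂ) - 1 = k + 2 := by push_cast; ring
  have e2 : (12 - 6 * ((k + 3 : ℕ) : ℂ)) = -(6 * (k + 1)) := by push_cast; ring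
  have e3 : ((k + 3 : ℕ) : ℂ) - 2 = k + 1 := by push_cast; ring
  have e4 : (ρ : ℂ) ^ 2 + ((k + 3 : ℕ) : ℂ) - 2 = (ρ : ℂ) ^ 2 + (k + 1) := by push_cast; ring
  rw [e4, e1, e2, e3] at h
  rw [← h]
  ring
end

section
/- For every integer k ≥ 2 and every λ ∈ ℂ with Re λ ≥ 0, the only function ũ : ℝ → ℂ that is smooth (C^∞) on [0,1] and satisfies the supersymmetric equation (1−ρ²)ũ''(ρ) + ((k+1)/ρ − 2(λ+1)ρ)ũ'(ρ) − λ(λ+1)ũ(ρ) + (2k/ρ²)·((ρ²−k−2)/(ρ²+k))·ũ(ρ) = 0 for all ρ ∈ (0,1) is ũ ≡ 0 (i.e., the supersymmetric problem has no unstable eigenvalues). -/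
namespace Susy

def P (k : ℕ) (j : ℕ) : ℝ := 2 * (j + 1) * (2 * j + k + 6)
def Q (l : ℂ) (j : ℕ) : ℂ := (2 * j + 2 + l) * (2 * j + 3 + l)
def K (k : ℕ) : ℝ := 4 * (k + 1)

/-- The scaled coefficients `(B_j, D_j)`. -/
noncomputable def BD (k : ℕ) (l : ℂ) : ℕ → ℂ × ℂ
  | 0 => (1, -(K k : ℂ))
  | j + 1 => (k * Q l j * (BD k l j).1 + (BD k l j).2,
      -((P k j : ℂ) * (BD k l j).2 + K k * (k * Q l j * (BD k l j).1 + (BD k l j).2)))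

noncomputable def B (k : ℕ) (l : ℂ) (j : ℕ) : ℂ := (BD k l j).1
noncomputable def D (k : ℕ) (l : ℂ) (j : ℕ) : ℂ := (BD k l j).2

lemma B_zero (k : ℕ) (l : ℂ) : B k l 0 = 1 := rfl
lemma D_zero (k : ℕ) (l : ℂ) : D k l 0 = -(K k : ℂ) := rfl
lemma B_succ (k : ℕ) (l : ℂ) (j : ℕ) :
    B k l (j + 1) = k * Q l j * B k l j + D k l j := rfl
lemma D_succ (k : ℕ) (l : ℂ) (j : ℕ) :
    D k l (j + 1) = -((P k j : ℂ) * D k l j + K k * B k l (j + 1)) := rfl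

lemma norm_lt_of_normSq {a b : ℂ} (h : 25 * Complex.normSq a < 4 * Complex.normSq b) :
    ‖a‖ < 2 / 5 * ‖b‖ := by
  rw [Complex.normSq_eq_norm_sq, Complex.normSq_eq_norm_sq] at h
  have : ‖a‖ ^ 2 < (2 / 5 * ‖b‖) ^ 2 := by nlinarith
  exact lt_of_pow_lt_pow_left₀ 2 (by positivity) this


lemma Q_re (x y : ℝ) (j : ℕ) : (Q ⟨x, y⟩ j).re = (2 * j + 2 + x) * (2 * j + 3 + x) - y * y := by
  simp [Q]
lemma Q_im (x y : ℝ) (j : ℕ) : (Q ⟨x, y⟩ j).im = (2 * j + 2 + x) * y + y * (2 * j + 3 + x) := by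
  simp [Q]

set_option maxRecDepth 100000 in
set_option maxHeartbeats 4000000 in
lemma base_ge3 (t : ℕ) (l : ℂ) (hl : 0 ≤ l.re) :
    ‖D (t + 3) l 2‖ < 2 / 5 * ‖((t + 3 : ℕ) : ℂ) * Q l 2 * B (t + 3) l 2‖ := by
  apply norm_lt_of_normSq
  obtain ⟨x, y⟩ := l
  simp only at hl
  have ht : (0 : ℝ) ≤ t := Nat.cast_nonneg t
  rw [← sub_pos]
  simp only [B_succ, D_succ, B_zero, D_zero, Complex.normSq_apply, Complex.mul_re, Complex.mul_im,
    Complex.add_re, Complex.add_im, Complex.neg_re, Complex.neg_im, Complex.ofReal_re,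
    Complex.ofReal_im, Complex.natCast_re, Complex.natCast_im, Complex.one_re, Complex.one_im,
    Q_re, Q_im, P, K]
  push_cast
  generalize (t : ℝ) = t at *
  ring_nf
  positivity

set_option maxRecDepth 100000 in
set_option maxHeartbeats 4000000 in
lemma base_two (l : ℂ) (hl : 0 ≤ l.re) :
    ‖D 2 l 4‖ < 2 / 5 * ‖((2 : ℕ) : ℂ) * Q l 4 * B 2 l 4‖ := by
  apply norm_lt_of_normSq
  obtain ⟨x, y⟩ := l
  simp only at hl
  rw [← sub_pos]
  simp only [B_succ, D_succ, B_zero, D_zero, Complex.normSq_apply, Complex.mul_re, Complex.mul_im,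
    Complex.add_re, Complex.add_im, Complex.neg_re, Complex.neg_im, Complex.ofReal_re,
    Complex.ofReal_im, Complex.natCast_re, Complex.natCast_im, Complex.one_re, Complex.one_im,
    Q_re, Q_im, P, K]
  push_cast
  ring_nf
  positivity
end Susy

namespace Susy

lemma normQ (l : ℂ) (hl : 0 ≤ l.re) (j : ℕ) : (2 * j + 2) * (2 * j + 3) ≤ ‖Q l j‖ := by
  rw [Q, norm_mul]
  have h1 : (2 * j + 2 : ℝ) ≤ ‖(2 * j + 2 + l : ℂ)‖ := by
    refine le_trans ?_ (Complex.re_le_norm _)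
    simp [hl]
  have h2 : (2 * j + 3 : ℝ) ≤ ‖(2 * j + 3 + l : ℂ)‖ := by
    refine le_trans ?_ (Complex.re_le_norm _)
    simp [hl]
  exact mul_le_mul h1 h2 (by positivity) (by positivity)

lemma P_pos (k j : ℕ) : 0 < P k j := by unfold P; positivity
lemma K_pos (k : ℕ) : 0 < K k := by unfold K; positivity
lemma Q_ne (l : ℂ) (hl : 0 ≤ l.re) (j : ℕ) : Q l j ≠ 0 := by
  have := normQ l hl j
  intro h
  rw [h, norm_zero] at this
  have : (0 : ℝ) < (2 * j + 2) * (2 * j + 3) := by positivity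
  linarith

/-- The smallness condition. -/
def Good (k : ℕ) (l : ℂ) (j : ℕ) : Prop := ‖D k l j‖ < 2 / 5 * ‖(k : ℂ) * Q l j * B k l j‖

lemma Good.D_lt {k : ℕ} {l : ℂ} {j : ℕ} (h : Good k l j) :
    ‖D k l j‖ < 2 / 3 * ‖B k l (j + 1)‖ := by
  unfold Good at h
  rw [B_succ]
  have : ‖(k : ℂ) * Q l j * B k l j‖ ≤ ‖(k : ℂ) * Q l j * B k l j + D k l j‖ + ‖D k l j‖ := by
    have := norm_sub_le ((k : ℂ) * Q l j * B k l j + D k l j) (D k l j)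
    simpa using this
  linarith

lemma normD_succ (k : ℕ) (l : ℂ) (j : ℕ) :
    ‖D k l (j + 1)‖ ≤ P k j * ‖D k l j‖ + K k * ‖B k l (j + 1)‖ := by
  rw [D_succ, norm_neg]
  refine (norm_add_le _ _).trans ?_
  rw [norm_mul, norm_mul, Complex.norm_real, Complex.norm_real, Real.norm_of_nonneg (P_pos k j).le,
    Real.norm_of_nonneg (K_pos k).le]

lemma Good.succ {k : ℕ} {l : ℂ} {j : ℕ} (h : Good k l j) (hl : 0 ≤ l.re)
    (hc : 2 / 3 * P k j + K k ≤ 2 / 5 * k * ((2 * (j + 1 : ℕ) + 2) * (2 * (j + 1 : ℕ) + 3))) :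
    Good k l (j + 1) := by
  have h1 := h.D_lt
  have h2 := normD_succ k l j
  have h3 := normQ l hl (j + 1)
  have hP := P_pos k j
  unfold Good
  rw [norm_mul, norm_mul, Complex.norm_natCast]
  have hB : 0 < ‖B k l (j + 1)‖ := by
    have := norm_nonneg (D k l j)
    linarith
  calc ‖D k l (j + 1)‖ ≤ P k j * ‖D k l j‖ + K k * ‖B k l (j + 1)‖ := h2
    _ < P k j * (2 / 3 * ‖B k l (j + 1)‖) + K k * ‖B k l (j + 1)‖ := by gcongr
    _ = (2 / 3 * P k j + K k) * ‖B k l (j + 1)‖ := by ring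
    _ ≤ (2 / 5 * k * ‖Q l (j + 1)‖) * ‖B k l (j + 1)‖ := by
        gcongr
        refine hc.trans ?_
        gcongr
    _ = _ := by ring

lemma good_all (k : ℕ) (hk : 2 ≤ k) (l : ℂ) (hl : 0 ≤ l.re) :
    ∀ j, 4 ≤ j → Good k l j := by
  obtain rfl | hk3 := hk.eq_or_lt
  · intro j hj
    induction j, hj using Nat.le_induction with
    | base => exact base_two l hl
    | succ j hj ih =>
      refine ih.succ hl ?_
      have : (4 : ℝ) ≤ j := by exact_mod_cast hj
      simp only [P, K]; push_cast
      nlinarith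
  · obtain ⟨t, rfl⟩ : ∃ t, k = t + 3 := ⟨k - 3, by omega⟩
    have key : ∀ j, 2 ≤ j → Good (t + 3) l j := by
      intro j hj
      induction j, hj using Nat.le_induction with
      | base => exact base_ge3 t l hl
      | succ j hj ih =>
        refine ih.succ hl ?_
        obtain ⟨i, rfl⟩ : ∃ i, j = i + 2 := ⟨j - 2, by omega⟩
        simp only [P, K]; push_cast
        rw [← sub_nonneg]
        ring_nf
        positivity
    intro j hj
    exact key j (by omega)

noncomputable def del (k : ℕ) (l : ℂ) (j : ℕ) : ℂ := D k l j / (k * Q l j * B k l j)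

lemma Good.B_ne {k : ℕ} {l : ℂ} {j : ℕ} (h : Good k l j) : (k : ℂ) * Q l j * B k l j ≠ 0 := by
  intro h0
  unfold Good at h
  rw [h0] at h
  have := norm_nonneg (D k l j)
  simp at h
  linarith

lemma Good.del_lt {k : ℕ} {l : ℂ} {j : ℕ} (h : Good k l j) : ‖del k l j‖ < 2 / 5 := by
  rw [del, norm_div, div_lt_iff₀ (norm_pos_iff.mpr h.B_ne)]
  exact h

lemma Good.del_succ {k : ℕ} {l : ℂ} {j : ℕ} (h : Good k l j) (h' : Good k l (j + 1)) (hk : 2 ≤ k)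
    (hl : 0 ≤ l.re) :
    ‖del k l (j + 1)‖ ≤ 9 / 10 * ‖del k l j‖ + K k * (1 / ((j : ℝ) + 1) ^ 2) := by
  have hk2 : (2 : ℝ) ≤ k := by exact_mod_cast hk
  have hne := norm_pos_iff.mpr h.B_ne
  have hne' := h'.B_ne
  have hB' : 0 < ‖B k l (j + 1)‖ := norm_pos_iff.mpr (right_ne_zero_of_mul hne')
  have hQ := normQ l hl (j + 1)
  have hQpos : 0 < ‖Q l (j + 1)‖ := norm_pos_iff.mpr (Q_ne l hl _)
  have h1 : ‖D k l j‖ ≤ 5 / 3 * ‖del k l j‖ * ‖B k l (j + 1)‖ := by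
    have e : ‖D k l j‖ = ‖del k l j‖ * ‖(k : ℂ) * Q l j * B k l j‖ := by
      rw [del, norm_div, div_mul_cancel₀ _ hne.ne']
    have h2 : ‖(k : ℂ) * Q l j * B k l j‖ ≤ 5 / 3 * ‖B k l (j + 1)‖ := by
      have : ‖(k : ℂ) * Q l j * B k l j‖ ≤ ‖B k l (j + 1)‖ + ‖D k l j‖ := by
        have := norm_sub_le ((k : ℂ) * Q l j * B k l j + D k l j) (D k l j)
        rw [B_succ]
        simpa using this
      have := h.D_lt
      linarith
    rw [e]
    calc _ ≤ ‖del k l j‖ * (5 / 3 * ‖B k l (j + 1)‖) := by gcongr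
      _ = _ := by ring
  have h2 := normD_succ k l j
  rw [del, norm_div, div_le_iff₀ (norm_pos_iff.mpr hne'), norm_mul, norm_mul,
    Complex.norm_natCast]
  have hP := P_pos k j
  have hK := K_pos k
  have c1 : 5 / 3 * P k j ≤ 9 / 10 * (k * ‖Q l (j + 1)‖) := by
    refine le_trans ?_ (mul_le_mul_of_nonneg_left (mul_le_mul_of_nonneg_left hQ
      (Nat.cast_nonneg k)) (by norm_num))
    obtain ⟨t, rfl⟩ : ∃ t, k = t + 2 := ⟨k - 2, by omega⟩
    simp only [P]; push_cast
    have ht : (0 : ℝ) ≤ t := Nat.cast_nonneg t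
    have hj : (0 : ℝ) ≤ j := Nat.cast_nonneg j
    have := mul_nonneg ht hj
    have := mul_nonneg ht (mul_nonneg hj hj)
    nlinarith [sq_nonneg ((j : ℝ) - 1)]
  have c2 : 1 ≤ 1 / ((j : ℝ) + 1) ^ 2 * (k * ‖Q l (j + 1)‖) := by
    rw [one_div, ← div_eq_inv_mul, le_div_iff₀ (by positivity)]
    push_cast at hQ
    have hj : (0 : ℝ) ≤ j := Nat.cast_nonneg j
    nlinarith
  calc ‖D k l (j + 1)‖ ≤ P k j * ‖D k l j‖ + K k * ‖B k l (j + 1)‖ := h2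
    _ ≤ P k j * (5 / 3 * ‖del k l j‖ * ‖B k l (j + 1)‖) + K k * ‖B k l (j + 1)‖ := by gcongr
    _ = (5 / 3 * P k j) * ‖del k l j‖ * ‖B k l (j + 1)‖ + K k * 1 * ‖B k l (j + 1)‖ := by ring
    _ ≤ (9 / 10 * (k * ‖Q l (j + 1)‖)) * ‖del k l j‖ * ‖B k l (j + 1)‖
        + K k * (1 / ((j : ℝ) + 1) ^ 2 * (k * ‖Q l (j + 1)‖)) * ‖B k l (j + 1)‖ := by gcongr
    _ = _ := by ring

lemma summable_of_rec (x c : ℕ → ℝ) (hx : ∀ j, 0 ≤ x j) (hc : Summable c) (hc0 : ∀ j, 0 ≤ c j)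
    (h : ∀ j, x (j + 1) ≤ 9 / 10 * x j + c j) : Summable x := by
  refine summable_of_sum_range_le (c := 10 * (x 0 + ∑' j, c j)) hx fun n => ?_
  have key : ∀ n, ∑ i ∈ Finset.range (n + 1), x i ≤
      x 0 + 9 / 10 * ∑ i ∈ Finset.range n, x i + ∑ i ∈ Finset.range n, c i := by
    intro n
    rw [Finset.sum_range_succ']
    have : ∑ i ∈ Finset.range n, x (i + 1) ≤ ∑ i ∈ Finset.range n, (9 / 10 * x i + c i) :=
      Finset.sum_le_sum fun i _ => h i
    rw [Finset.sum_add_distrib, ← Finset.mul_sum] at this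
    linarith
  have h1 := key n
  have h2 := hc.sum_le_tsum (Finset.range n) (fun i _ => hc0 i)
  rw [Finset.sum_range_succ] at h1
  have := hx n
  linarith

lemma summable_del (k : ℕ) (hk : 2 ≤ k) (l : ℂ) (hl : 0 ≤ l.re) :
    Summable fun j => ‖del k l j‖ := by
  rw [← summable_nat_add_iff 4]
  have hg := good_all k hk l hl
  refine summable_of_rec _ (fun j => K k * (1 / (((j + 4 : ℕ) : ℝ) + 1) ^ 2))
    (fun j => norm_nonneg _) ?_ (fun j => by have := K_pos k; positivity) ?_
  · apply Summable.mul_left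
    have := (summable_nat_add_iff 5).mpr (Real.summable_one_div_nat_pow.mpr (one_lt_two))
    refine this.congr fun j => ?_
    push_cast; ring
  · intro j
    have := (hg (j + 4) (by omega)).del_succ (hg (j + 4 + 1) (by omega)) hk hl
    rw [show j + 1 + 4 = j + 4 + 1 by omega]
    exact this
end Susy

namespace Susy
open Filter Topology

noncomputable def h (s : ℂ) (j : ℕ) : ℂ := ∏ i ∈ Finset.range j, ((s + i) / (i + 1))
noncomputable def H (s : ℝ) (j : ℕ) : ℝ := ∏ i ∈ Finset.range j, ((s + i) / (i + 1))

lemma h_eq_choose (s : ℂ) (n : ℕ) : Ring.choose (s + n - 1) n = h s n := by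
  have h1 := Ring.factorial_nsmul_multichoose_eq_ascPochhammer s n
  rw [Ring.multichoose_eq, nsmul_eq_mul] at h1
  have hf : (n.factorial : ℂ) ≠ 0 := by exact_mod_cast n.factorial_ne_zero
  have h2 : (ascPochhammer ℕ n).smeval s = (n.factorial : ℂ) * h s n := by
    rw [Polynomial.ascPochhammer_smeval_eq_eval]
    clear h1 hf
    induction n with
    | zero => simp [h]
    | succ n ih =>
      rw [ascPochhammer_succ_eval, ih, h, h, Finset.prod_range_succ, Nat.factorial_succ]
      have : (n + 1 : ℂ) ≠ 0 := by exact_mod_cast n.succ_ne_zero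
      push_cast
      field_simp
  rw [h2] at h1
  exact mul_left_cancel₀ hf h1

lemma hasSum_h (s : ℂ) (x : ℝ) (hx0 : 0 ≤ x) (hx1 : x < 1) :
    HasSum (fun j => h s j * (x : ℂ) ^ j) (1 / (1 - (x : ℂ)) ^ s) := by
  have := (Complex.one_div_one_sub_cpow_hasFPowerSeriesOnBall_zero s).hasSum (y := (x : ℂ))
    (by
      rw [Metric.mem_eball, edist_zero_right, ← ofReal_norm, ← ENNReal.ofReal_one]
      apply (ENNReal.ofReal_lt_ofReal_iff one_pos).mpr
      simpa [abs_of_nonneg hx0] using hx1)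
  simp only [zero_add] at this
  refine this.congr_fun ?_ |> fun h => h
  intro j
  simp [h_eq_choose, mul_comm]

lemma h_ofReal (s : ℝ) (j : ℕ) : h s j = (H s j : ℂ) := by
  simp [h, H]

lemma hasSum_H (s : ℝ) (x : ℝ) (hx0 : 0 ≤ x) (hx1 : x < 1) :
    HasSum (fun j => H s j * x ^ j) ((1 - x) ^ (-s)) := by
  have := hasSum_h s x hx0 hx1
  rw [← Complex.hasSum_ofReal]
  convert this using 1
  · ext j; rw [h_ofReal]; push_cast; ring
  · rw [Complex.ofReal_cpow (by linarith)]
    push_cast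
    rw [Complex.cpow_neg, one_div]

lemma prod_tendsto (X e : ℕ → ℂ) (j0 : ℕ) (hX : ∀ j, j0 ≤ j → X (j + 1) = X j * (1 + e j))
    (h0 : X j0 ≠ 0) (he : Summable fun j => ‖e j‖) (hne : ∀ j, j0 ≤ j → 1 + e j ≠ 0) :
    ∃ L : ℂ, L ≠ 0 ∧ Tendsto X atTop (𝓝 L) := by
  have hs : Summable fun j => ‖e (j + j0)‖ := (summable_nat_add_iff (f := fun j => ‖e j‖) j0).mpr he
  refine ⟨X j0 * ∏' i, (1 + e (i + j0)), mul_ne_zero h0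
    (tprod_one_add_ne_zero_of_summable (fun i => hne _ (by omega)) hs), ?_⟩
  rw [← tendsto_add_atTop_iff_nat j0]
  have := (multipliable_one_add_of_summable hs).hasProd.tendsto_prod_nat.const_mul (X j0)
  refine this.congr fun n => ?_
  induction n with
  | zero => simp
  | succ n ih =>
    rw [Finset.prod_range_succ, ← mul_assoc, ih, show n + 1 + j0 = n + j0 + 1 by omega,
      hX _ (by omega)]

lemma h_ne (s : ℂ) (hs : 1 ≤ s.re) (j : ℕ) : h s j ≠ 0 := by
  refine Finset.prod_ne_zero_iff.mpr fun i _ => div_ne_zero ?_ (by exact_mod_cast i.succ_ne_zero)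
  intro h0
  have := congrArg Complex.re h0
  simp at this
  have : (0 : ℝ) ≤ i := Nat.cast_nonneg i
  linarith

lemma H_pos (s : ℝ) (hs : 1 ≤ s) (j : ℕ) : 0 < H s j := by
  refine Finset.prod_pos fun i _ => by positivity

lemma summable_sq : Summable fun j : ℕ => 1 / ((j : ℝ) + 1) ^ 2 := by
  have := (summable_nat_add_iff 1).mpr (Real.summable_one_div_nat_pow.mpr (one_lt_two))
  refine this.congr fun j => ?_
  push_cast; ring

lemma norm_h_le (s : ℂ) (hs : 1 ≤ s.re) : ∃ C : ℝ, 0 < C ∧ ∀ j, ‖h s j‖ ≤ C * H s.re j := by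
  have key : ∀ j, ‖h s j‖ ≤
      Real.exp (∑ i ∈ Finset.range j, s.im ^ 2 * (1 / ((i : ℝ) + 1) ^ 2)) * H s.re j := by
    intro j
    rw [Real.exp_sum, h, H, ← Finset.prod_mul_distrib, norm_prod]
    refine Finset.prod_le_prod (fun _ _ => norm_nonneg _) fun i _ => ?_
    have hi : (0 : ℝ) < i + 1 := by positivity
    have hn : ‖((i : ℂ) + 1)‖ = i + 1 := by
      rw [show ((i : ℂ) + 1) = ((i + 1 : ℕ) : ℂ) by push_cast; ring, Complex.norm_natCast]
      push_cast; ring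
    rw [norm_div, hn, ← mul_div_assoc]
    gcongr
    have h1 : ‖s + i‖ ≤ (1 + s.im ^ 2 * (1 / ((i : ℝ) + 1) ^ 2)) * (s.re + i) := by
      have hp : 0 ≤ s.re + i := by linarith
      refine le_of_sq_le_sq ?_ (by positivity)
      rw [← Complex.normSq_eq_norm_sq, Complex.normSq_apply]
      simp only [Complex.add_re, Complex.add_im, Complex.natCast_re, Complex.natCast_im, add_zero]
      set t := s.im ^ 2 * (1 / ((i : ℝ) + 1) ^ 2) with ht
      have ht0 : 0 ≤ t := by positivity
      have h2 : s.im ^ 2 ≤ t * (s.re + i) ^ 2 := by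
        have : s.im ^ 2 = t * ((i : ℝ) + 1) ^ 2 := by rw [ht]; field_simp
        rw [this]
        have h3 : (i : ℝ) + 1 ≤ s.re + i := by linarith
        have h4 := pow_le_pow_left₀ hi.le h3 2
        exact mul_le_mul_of_nonneg_left h4 ht0
      nlinarith [mul_nonneg ht0 (sq_nonneg (s.re + i)), mul_nonneg (mul_nonneg ht0 ht0) (sq_nonneg (s.re + i))]
    refine h1.trans ?_
    have := Real.add_one_le_exp (s.im ^ 2 * (1 / ((i : ℝ) + 1) ^ 2))
    have hp : 0 ≤ s.re + i := by linarith
    gcongr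
    linarith
  refine ⟨Real.exp (∑' i : ℕ, s.im ^ 2 * (1 / ((i : ℝ) + 1) ^ 2)), Real.exp_pos _, fun j => ?_⟩
  refine (key j).trans ?_
  have := (H_pos s.re hs j).le
  gcongr
  exact (summable_sq.mul_left _).sum_le_tsum _ (fun i _ => by positivity)

lemma norm_c_le (c : ℕ → ℂ) (s L : ℂ) (hs : 1 ≤ s.re)
    (hc : Tendsto (fun j => c j / h s j) atTop (𝓝 L)) :
    ∃ C : ℝ, ∀ j, ‖c j‖ ≤ C * H s.re j := by
  obtain ⟨C, hC, hh⟩ := norm_h_le s hs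
  obtain ⟨M, hM⟩ := hc.norm.bddAbove_range
  refine ⟨M * C, fun j => ?_⟩
  have h1 : ‖c j / h s j‖ ≤ M := hM ⟨j, rfl⟩
  have h2 := norm_pos_iff.mpr (h_ne s hs j)
  rw [norm_div, div_le_iff₀ h2] at h1
  have hM0 : 0 ≤ M := (norm_nonneg _).trans (hM ⟨j, rfl⟩)
  calc _ ≤ _ := h1
    _ ≤ M * (C * H s.re j) := by gcongr; exact hh j
    _ = _ := by ring

lemma summable_c (c : ℕ → ℂ) (s L : ℂ) (hs : 1 ≤ s.re)
    (hc : Tendsto (fun j => c j / h s j) atTop (𝓝 L)) (x : ℝ) (hx0 : 0 ≤ x) (hx1 : x < 1) :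
    Summable fun j => ‖c j‖ * x ^ j := by
  obtain ⟨C, hC⟩ := norm_c_le c s L hs hc
  refine Summable.of_nonneg_of_le (fun j => by positivity) (fun j => ?_)
    ((hasSum_H s.re x hx0 hx1).summable.mul_left C)
  rw [← mul_assoc]
  gcongr
  exact hC j

lemma unbounded_c (c : ℕ → ℂ) (s L : ℂ) (hs : 1 ≤ s.re) (hL : L ≠ 0)
    (hc : Tendsto (fun j => c j / h s j) atTop (𝓝 L)) (M : ℝ) :
    ∃ x : ℝ, 0 < x ∧ x < 1 ∧ M < ‖∑' j, c j * (x : ℂ) ^ j‖ := by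
  by_contra! hcon
  obtain ⟨C, hC0, hC⟩ := norm_h_le s hs
  have hLp := norm_pos_iff.mpr hL
  set ε := ‖L‖ / (2 * C) with hε
  have hε0 : 0 < ε := by positivity
  -- error sequence
  set e : ℕ → ℂ := fun j => c j - L * h s j with he
  have he1 : ∀ᶠ j in atTop, ‖e j‖ ≤ ε * C * H s.re j := by
    filter_upwards [Metric.tendsto_nhds.mp hc ε hε0] with j hj
    rw [dist_eq_norm] at hj
    have hne := h_ne s hs j
    have : e j = (c j / h s j - L) * h s j := by
      simp only [he]; field_simp
    rw [this, norm_mul, mul_assoc]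
    exact mul_le_mul hj.le (hC j) (norm_nonneg _) hε0.le
  obtain ⟨J, hJ⟩ := eventually_atTop.mp he1
  set E := ∑ j ∈ Finset.range J, ‖e j‖ with hE
  have hbound : ∀ x : ℝ, 0 < x → x < 1 → ‖L‖ / 2 * (1 - x) ^ (-s.re) ≤ M + E := by
    intro x hx0 hx1
    have hH := hasSum_H s.re x hx0.le hx1
    have hh := hasSum_h s x hx0.le hx1
    have hcs : Summable fun j => c j * (x : ℂ) ^ j := by
      refine Summable.of_norm ((summable_c c s L hs hc x hx0.le hx1).congr fun j => ?_)
      rw [norm_mul, norm_pow, Complex.norm_real, Real.norm_of_nonneg hx0.le]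
    have hes : HasSum (fun j => e j * (x : ℂ) ^ j)
        (∑' j, c j * (x : ℂ) ^ j - L * (1 / (1 - (x : ℂ)) ^ s)) := by
      refine (hcs.hasSum.sub (hh.mul_left L)).congr_fun ?_ |> fun h => h
      intro j; simp only [he]; ring
    have hnorm : ‖(1 / (1 - (x : ℂ)) ^ s)‖ = (1 - x) ^ (-s.re) := by
      rw [norm_div, norm_one, Real.rpow_neg (by linarith), ← one_div]
      congr 1
      rw [show (1 - (x : ℂ)) = ((1 - x : ℝ) : ℂ) by push_cast; ring,
        Complex.norm_cpow_eq_rpow_re_of_pos (by linarith)]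
    have hle : ∀ j, ‖e j * (x : ℂ) ^ j‖ ≤
        (if j ∈ Finset.range J then ‖e j‖ else 0) + ε * C * (H s.re j * x ^ j) := by
      intro j
      rw [norm_mul, norm_pow, Complex.norm_real, Real.norm_of_nonneg hx0.le]
      have hHp := (H_pos s.re hs j).le
      split_ifs with hj
      · have : ‖e j‖ * x ^ j ≤ ‖e j‖ * 1 := by
          gcongr; exact pow_le_one₀ hx0.le hx1.le
        have : 0 ≤ ε * C * (H s.re j * x ^ j) := by positivity
        linarith
      · simp only [Finset.mem_range, not_lt] at hj
        rw [zero_add, ← mul_assoc]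
        gcongr
        exact hJ j hj
    have hsumB : HasSum (fun j => (if j ∈ Finset.range J then ‖e j‖ else 0)
        + ε * C * (H s.re j * x ^ j)) (E + ε * C * (1 - x) ^ (-s.re)) := by
      refine HasSum.add ?_ (hH.mul_left _)
      have := hasSum_sum_of_ne_finset_zero (L := SummationFilter.unconditional ℕ) (f := fun j => (if j ∈ Finset.range J then ‖e j‖ else 0))
        (s := Finset.range J) (fun b hb => by simp only [if_neg hb])
      convert this using 1
      exact Finset.sum_congr rfl fun j hj => by rw [if_pos hj]
    have h1 := tsum_of_norm_bounded hsumB hle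
    rw [hes.tsum_eq] at h1
    have h2 := hcon x hx0 hx1
    have h3 : ‖L * (1 / (1 - (x : ℂ)) ^ s)‖ ≤ ‖∑' j, c j * (x : ℂ) ^ j‖ +
        ‖∑' j, c j * (x : ℂ) ^ j - L * (1 / (1 - (x : ℂ)) ^ s)‖ := by
      have := norm_sub_le (∑' j, c j * (x : ℂ) ^ j)
        (∑' j, c j * (x : ℂ) ^ j - L * (1 / (1 - (x : ℂ)) ^ s))
      rwa [sub_sub_cancel] at this
    rw [norm_mul, hnorm] at h3
    have h4 : ε * C = ‖L‖ / 2 := by rw [hε]; field_simp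
    rw [h4] at h1
    linarith
  -- choose x close to 1
  set T := 2 * (|M + E| + 1) / ‖L‖ + 2 with hT
  have hT2 : 2 ≤ T := by
    have : 0 ≤ 2 * (|M + E| + 1) / ‖L‖ := by positivity
    linarith
  have := hbound (1 - 1 / T) (by
    have : 1 / T ≤ 1 / 2 := by gcongr
    linarith) (by have : 0 < 1 / T := by positivity
                  linarith)
  rw [sub_sub_cancel, one_div, Real.inv_rpow (by linarith), Real.rpow_neg (by linarith),
    inv_inv] at this
  have h5 : T ≤ T ^ s.re := by
    calc T = T ^ (1 : ℝ) := (Real.rpow_one T).symm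
      _ ≤ _ := Real.rpow_le_rpow_of_exponent_le (by linarith) hs
  have h6 : ‖L‖ / 2 * T ≤ ‖L‖ / 2 * T ^ s.re := by gcongr
  have h7 : ‖L‖ / 2 * T = |M + E| + 1 + ‖L‖ := by rw [hT]; field_simp
  have h8 := le_abs_self (M + E)
  linarith

end Susy

namespace Susy
open Filter Topology

lemma summable_of_analytic (f : ℂ → ℂ) (hf : AnalyticAt ℂ f 0) (h0 : f 0 = 1)
    (h1 : HasDerivAt f 0 0) : Summable fun j : ℕ => ‖f (1 / ((j : ℂ) + 1)) - 1‖ := by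
  obtain ⟨p, hp⟩ := hf
  have hO := hp.isBigO_sub_partialSum_pow 2
  have hps : ∀ y : ℂ, p.partialSum 2 y = 1 := by
    intro y
    have e1 : p 1 (fun _ => y) = 0 := by
      have h2 : p 1 (fun _ => 1) = 0 := by rw [← hp.deriv]; exact h1.deriv
      have h3 := (p 1).map_smul_univ (fun _ => y) (fun _ => (1 : ℂ))
      simp only [smul_eq_mul, mul_one] at h3
      rw [h3, h2, mul_zero]
    have e0 : p 0 (fun _ => y) = 1 := by
      rw [hp.coeff_zero, h0]
    rw [FormalMultilinearSeries.partialSum, Finset.sum_range_succ, Finset.sum_range_one, e0, e1,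
      add_zero]
  simp only [zero_add, hps] at hO
  have ht : Tendsto (fun j : ℕ => 1 / ((j : ℂ) + 1)) atTop (𝓝 0) :=
    tendsto_one_div_add_atTop_nhds_zero_nat (𝕜 := ℂ)
  have := (hO.comp_tendsto ht).norm_left
  refine summable_of_isBigO_nat summable_sq (this.trans (Asymptotics.IsBigO.of_bound 1 ?_))
  refine Eventually.of_forall fun j => ?_
  have hn : ‖((j : ℂ) + 1)‖ = j + 1 := by
    rw [show ((j : ℂ) + 1) = ((j + 1 : ℕ) : ℂ) by push_cast; ring, Complex.norm_natCast]
    push_cast; ring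
  simp [hn]

noncomputable def phi (m : ℕ) (a b c d z : ℂ) : ℂ :=
  ((1 + z) ^ m * (1 + a * z) * (1 + b * z)) / ((1 + c * z) * (1 + d * z))

lemma summable_phi (m : ℕ) (a b c d : ℂ) (habcd : m + a + b = c + d) :
    Summable fun j : ℕ => ‖phi m a b c d (1 / ((j : ℂ) + 1)) - 1‖ := by
  have hl : ∀ a : ℂ, HasDerivAt (fun z : ℂ => 1 + a * z) a 0 := fun a => by
    simpa using ((hasDerivAt_id (0 : ℂ)).const_mul a).const_add 1
  have hl1 : HasDerivAt (fun z : ℂ => (1 + z) ^ m) m 0 := by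
    have := ((hasDerivAt_id (0 : ℂ)).const_add 1).fun_pow m
    simpa using this
  apply summable_of_analytic
  · unfold phi
    refine AnalyticAt.div (by fun_prop) (by fun_prop) (by simp)
  · simp [phi]
  · have := ((hl1.mul (hl a)).mul (hl b)).div ((hl c).mul (hl d)) (by simp)
    refine (this.congr_deriv ?_)
    simp
    linear_combination habcd

noncomputable def A (k : ℕ) (l : ℂ) (j : ℕ) : ℂ :=
  B k l j / ∏ i ∈ Finset.range j, ((k : ℂ) * (P k i : ℂ))

lemma A_zero (k : ℕ) (l : ℂ) : A k l 0 = 1 := by simp [A, B_zero]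

lemma prodP_ne (k : ℕ) (hk : 2 ≤ k) (j : ℕ) : ∏ i ∈ Finset.range j, ((k : ℂ) * (P k i : ℂ)) ≠ 0 := by
  refine Finset.prod_ne_zero_iff.mpr fun i _ => mul_ne_zero ?_ ?_
  · exact_mod_cast (by omega : k ≠ 0)
  · exact_mod_cast (P_pos k i).ne'

lemma A_ratio (k : ℕ) (hk : 2 ≤ k) (l : ℂ) (j : ℕ) (hg : Good k l j) :
    A k l (j + 1) = A k l j * (Q l j / P k j * (1 + del k l j)) := by
  have h1 := prodP_ne k hk j
  have h2 : (P k j : ℂ) ≠ 0 := by exact_mod_cast (P_pos k j).ne'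
  have hk0 : (k : ℂ) ≠ 0 := by exact_mod_cast (by omega : k ≠ 0)
  have h3 := hg.B_ne
  have h4 : B k l j ≠ 0 := right_ne_zero_of_mul h3
  have h5 : Q l j ≠ 0 := right_ne_zero_of_mul (left_ne_zero_of_mul h3)
  rw [A, A, del, B_succ, Finset.prod_range_succ]
  field_simp

/-- Coefficients after applying the Euler operator `m` times. -/
lemma coeff_asymp (k : ℕ) (hk : 2 ≤ k) (l : ℂ) (hl : 0 ≤ l.re) (m : ℕ) (hm : k + 2 ≤ m) :
    ∃ s L : ℂ, 1 ≤ s.re ∧ L ≠ 0 ∧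
      Tendsto (fun j : ℕ => ((2 * (j : ℂ) + 2) ^ m * A k l j) / h s j) atTop (𝓝 L) := by
  set s : ℂ := m + l - (k + 1) / 2 with hs
  have hsre : 1 ≤ s.re := by
    have hm' : (k : ℝ) + 2 ≤ m := by exact_mod_cast hm
    have : s.re = m + l.re - (k + 1) / 2 := by
      rw [hs, show (m + l - (k + 1) / 2 : ℂ) = m + l - (((k + 1) / 2 : ℝ) : ℂ) by push_cast; ring]
      simp only [Complex.sub_re, Complex.add_re, Complex.natCast_re, Complex.ofReal_re]
    rw [this]
    have : (0 : ℝ) ≤ k := Nat.cast_nonneg k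
    linarith
  have hgood := good_all k hk l hl
  set φ : ℕ → ℂ := fun j => phi m (l / 2) ((l + 1) / 2) ((k + 4) / 2) (s - 1) (1 / ((j : ℂ) + 1))
    with hφ
  have hsum : Summable fun j => ‖φ j - 1‖ := summable_phi m _ _ _ _ (by rw [hs]; ring)
  have hdel := summable_del k hk l hl
  have hφlim : Tendsto φ atTop (𝓝 1) := by
    have := hsum.tendsto_atTop_zero
    rw [tendsto_iff_norm_sub_tendsto_zero]
    exact this
  obtain ⟨Mφ, hMφ⟩ := hφlim.norm.bddAbove_range
  have hMφ' : ∀ j, ‖φ j‖ ≤ Mφ := fun j => hMφ ⟨j, rfl⟩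
  refine ⟨s, ?_⟩
  have := prod_tendsto (fun j : ℕ => ((2 * (j : ℂ) + 2) ^ m * A k l j) / h s j)
    (fun j => φ j * (1 + del k l j) - 1) 4 ?_ ?_ ?_ ?_
  · obtain ⟨L, hL, hT⟩ := this
    exact ⟨L, hsre, hL, hT⟩
  · intro j hj
    have hJ : ((j : ℂ) + 1) ≠ 0 := by exact_mod_cast j.succ_ne_zero
    have hk6 : (2 * (j : ℂ) + k + 6) ≠ 0 := by exact_mod_cast (by omega : 2 * j + k + 6 ≠ 0)
    have hsj : s + j ≠ 0 := by
      have := h_ne s hsre (j + 1)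
      rw [h, Finset.prod_range_succ] at this
      exact (div_ne_zero_iff.mp (right_ne_zero_of_mul this)).1
    have hh := h_ne s hsre j
    have hφj : φ j = ((2 * ((j + 1 : ℕ) : ℂ) + 2) ^ m / (2 * (j : ℂ) + 2) ^ m) *
        (Q l j / P k j) / ((s + j) / (j + 1)) := by
      rw [← div_pow, show (2 * ((j + 1 : ℕ) : ℂ) + 2) / (2 * (j : ℂ) + 2) = 1 + 1 / ((j : ℂ) + 1) by
        rw [show 2 * (j : ℂ) + 2 = 2 * (j + 1) by ring]
        push_cast; field_simp]
      simp only [hφ, phi, Q, P]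
      generalize (1 + 1 / ((j : ℂ) + 1)) ^ m = w
      push_cast
      have e1 : (1 + ((k : ℂ) + 4) / 2 * (1 / ((j : ℂ) + 1))) = (2 * j + k + 6) / (2 * (j + 1)) := by
        field_simp; ring
      have e2 : (1 + (s - 1) * (1 / ((j : ℂ) + 1))) = (s + j) / (j + 1) := by
        field_simp; ring
      have e3 : (1 + l / 2 * (1 / ((j : ℂ) + 1))) = (2 * j + 2 + l) / (2 * (j + 1)) := by
        field_simp
      have e4 : (1 + (l + 1) / 2 * (1 / ((j : ℂ) + 1))) = (2 * j + 3 + l) / (2 * (j + 1)) := by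
        field_simp
        ring
      rw [e1, e2, e3, e4]
      field_simp
    rw [A_ratio k hk l j (hgood j hj)]
    rw [show h s (j + 1) = h s j * ((s + j) / (j + 1)) by rw [h, h, Finset.prod_range_succ]]
    rw [add_sub_cancel, hφj]
    have h22 : (2 * (j : ℂ) + 2) ^ m ≠ 0 := by
      apply pow_ne_zero; exact_mod_cast (by omega : 2 * j + 2 ≠ 0)
    generalize (2 * (j : ℂ) + 2) ^ m = w1 at *
    generalize (2 * ((j + 1 : ℕ) : ℂ) + 2) ^ m = w2 at *
    have hP : (P k j : ℂ) ≠ 0 := by exact_mod_cast (P_pos k j).ne'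
    field_simp
  · refine div_ne_zero (mul_ne_zero ?_ (div_ne_zero ?_ (prodP_ne k hk 4))) (h_ne s hsre 4)
    · apply pow_ne_zero; norm_num
    · exact right_ne_zero_of_mul (hgood 4 le_rfl).B_ne
  · refine Summable.of_nonneg_of_le (fun _ => norm_nonneg _) (fun j => ?_)
      (hsum.add (hdel.mul_left Mφ))
    rw [show φ j * (1 + del k l j) - 1 = (φ j - 1) + φ j * del k l j by ring]
    refine (norm_add_le _ _).trans ?_
    rw [norm_mul]
    gcongr
    exact hMφ' j
  · intro j hj
    rw [add_sub_cancel]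
    have hJ : ((j : ℂ) + 1) ≠ 0 := by exact_mod_cast j.succ_ne_zero
    refine mul_ne_zero ?_ ?_
    · have hre : ∀ w : ℂ, 0 ≤ w.re → 1 + w * (1 / ((j : ℂ) + 1)) ≠ 0 := by
        intro w hw h0
        have : (j : ℂ) + 1 + w = 0 := by
          field_simp at h0
          linear_combination h0
        have := congrArg Complex.re this
        simp at this
        have : (0 : ℝ) ≤ j := Nat.cast_nonneg j
        linarith
      simp only [hφ, phi]
      refine div_ne_zero (mul_ne_zero (mul_ne_zero (pow_ne_zero _ ?_) (hre _ ?_)) (hre _ ?_))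
        (mul_ne_zero (hre _ ?_) (hre _ ?_))
      · simpa using hre 1 (by simp)
      · rw [Complex.div_ofNat_re]; positivity
      · rw [Complex.div_ofNat_re, Complex.add_re, Complex.one_re]; positivity
      · rw [Complex.div_ofNat_re]; simp; positivity
      · simp; linarith
    · intro h0
      have h1 := (hgood j hj).del_lt
      have : del k l j = -1 := by linear_combination h0
      rw [this] at h1
      norm_num at h1

end Susy

namespace Susy
open Filter Topology

def Summ (c : ℕ → ℂ) : Prop := ∀ x : ℝ, 0 ≤ x → x < 1 → Summable fun j => ‖c j‖ * x ^ j

/-- Euler operator on coefficients. -/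
def eu (c : ℕ → ℂ) : ℕ → ℂ := fun j => (2 * (j : ℂ) + 2) * c j

noncomputable def S (c : ℕ → ℂ) (r : ℝ) : ℂ := ∑' j, c j * (r : ℂ) ^ (2 * j + 2)

lemma norm_two_j (j : ℕ) : ‖(2 * (j : ℂ) + 2)‖ = 2 * j + 2 := by
  rw [show (2 * (j : ℂ) + 2) = ((2 * j + 2 : ℕ) : ℂ) by push_cast; ring, Complex.norm_natCast]
  push_cast; ring

lemma Summ.eu {c : ℕ → ℂ} (hc : Summ c) : Summ (eu c) := by
  intro x hx0 hx1
  obtain ⟨r, hr1, hr2⟩ := exists_between hx1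
  have hr0 : 0 < r := by linarith
  have hq0 : 0 ≤ x / r := by positivity
  have hq1 : x / r < 1 := (div_lt_one hr0).mpr hr1
  have h1 := tendsto_self_mul_const_pow_of_lt_one hq0 hq1
  obtain ⟨M, hM⟩ := h1.bddAbove_range
  have hM' : ∀ j : ℕ, (j : ℝ) * (x / r) ^ j ≤ M := fun j => hM ⟨j, rfl⟩
  refine Summable.of_nonneg_of_le (fun j => by positivity) (fun j => ?_)
    ((hc r hr0.le hr2).mul_left (2 * M + 2))
  have h2 : (2 * (j : ℝ) + 2) * x ^ j ≤ (2 * M + 2) * r ^ j := by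
    have h3 : (x / r) ^ j ≤ 1 := pow_le_one₀ hq0 hq1.le
    have h4 : (2 * (j : ℝ) + 2) * (x / r) ^ j ≤ 2 * M + 2 := by
      have := hM' j
      linarith
    have h5 : x ^ j = (x / r) ^ j * r ^ j := by
      rw [← mul_pow, div_mul_cancel₀ _ hr0.ne']
    rw [h5, ← mul_assoc]
    gcongr
  rw [Susy.eu, norm_mul, norm_two_j]
  calc _ = ‖c j‖ * ((2 * (j : ℝ) + 2) * x ^ j) := by ring
    _ ≤ ‖c j‖ * ((2 * M + 2) * r ^ j) := by gcongr
    _ = _ := by ring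

lemma pow_le_aux {r : ℝ} (hr0 : 0 ≤ r) (hr1 : r ≤ 1) (j i : ℕ) : r ^ (2 * j + i) ≤ r ^ j :=
  pow_le_pow_of_le_one hr0 hr1 (by omega)

lemma Summ.summable {c : ℕ → ℂ} (hc : Summ c) {r : ℝ} (hr : |r| < 1) (i : ℕ) :
    Summable fun j => c j * (r : ℂ) ^ (2 * j + i) := by
  refine Summable.of_norm (Summable.of_nonneg_of_le (fun j => norm_nonneg _) (fun j => ?_)
    (hc |r| (abs_nonneg r) hr))
  rw [norm_mul, norm_pow, Complex.norm_real, Real.norm_eq_abs]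
  exact mul_le_mul_of_nonneg_left (pow_le_aux (abs_nonneg r) hr.le j i) (norm_nonneg _)

lemma hasDerivAt_S {c : ℕ → ℂ} (hc : Summ c) {r : ℝ} (hr : |r| < 1) :
    HasDerivAt (S c) (∑' j, eu c j * (r : ℂ) ^ (2 * j + 1)) r := by
  obtain ⟨R, hR1, hR2⟩ := exists_between hr
  have hR0 : 0 ≤ R := (abs_nonneg r).trans hR1.le
  have hu : Summable fun j => ‖eu c j‖ * R ^ j := hc.eu R hR0 hR2
  refine hasDerivAt_tsum_of_isPreconnected (t := Metric.ball (0 : ℝ) R) (y₀ := r)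
    (g := fun j (r : ℝ) => c j * (r : ℂ) ^ (2 * j + 2))
    (g' := fun j (r : ℝ) => eu c j * (r : ℂ) ^ (2 * j + 1)) hu Metric.isOpen_ball
    (convex_ball _ _).isPreconnected ?_ ?_ ?_ (hc.summable hr 2) ?_
  · intro j y _
    have h1 : HasDerivAt (fun y : ℝ => (y : ℂ)) 1 y := by
      simpa using (hasDerivAt_id y).ofReal_comp
    have h2 := (h1.fun_pow (2 * j + 2)).const_mul (c j)
    refine h2.congr_deriv ?_
    simp only [eu]
    push_cast
    ring
  · intro j y hy
    rw [mem_ball_zero_iff, Real.norm_eq_abs] at hy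
    rw [norm_mul, norm_pow, Complex.norm_real, Real.norm_eq_abs]
    gcongr
    refine (pow_le_aux (abs_nonneg y) (hy.le.trans hR2.le) j 1).trans ?_
    gcongr
  · simpa using hR1
  · simpa using hR1

lemma hasDerivAt_S' {c : ℕ → ℂ} (hc : Summ c) {r : ℝ} (hr : r ∈ Set.Ioo (0 : ℝ) 1) :
    HasDerivAt (S c) (S (eu c) r / r) r := by
  have hr0 : (r : ℂ) ≠ 0 := by exact_mod_cast hr.1.ne'
  refine (hasDerivAt_S hc (by rw [abs_of_pos hr.1]; exact hr.2)).congr_deriv ?_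
  rw [eq_div_iff hr0, S, ← tsum_mul_right]
  refine tsum_congr fun j => ?_
  ring

lemma continuousAt_S {c : ℕ → ℂ} (hc : Summ c) : ContinuousAt (S c) 0 :=
  (hasDerivAt_S hc (by simp)).continuousAt

lemma S_eq (c : ℕ → ℂ) (r : ℝ) : S c r = (r : ℂ) ^ 2 * ∑' j, c j * ((r ^ 2 : ℝ) : ℂ) ^ j := by
  rw [S, ← tsum_mul_left]
  refine tsum_congr fun j => ?_
  push_cast
  rw [← pow_mul]
  ring

lemma eu_iter (c : ℕ → ℂ) (m j : ℕ) : (eu^[m] c) j = (2 * (j : ℂ) + 2) ^ m * c j := by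
  induction m generalizing c with
  | zero => simp
  | succ m ih => rw [Function.iterate_succ_apply, ih, eu]; ring

lemma summ_A (k : ℕ) (hk : 2 ≤ k) (l : ℂ) (hl : 0 ≤ l.re) : Summ (A k l) := by
  obtain ⟨s, L, hs, hL, hT⟩ := coeff_asymp k hk l hl (k + 2) le_rfl
  intro x hx0 hx1
  refine Summable.of_nonneg_of_le (fun j => by positivity) (fun j => ?_)
    (summable_c _ s L hs hT x hx0 hx1)
  gcongr
  rw [norm_mul, norm_pow, norm_two_j]
  have : (1 : ℝ) ≤ (2 * (j : ℝ) + 2) ^ (k + 2) := one_le_pow₀ (by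
    have : (0 : ℝ) ≤ j := Nat.cast_nonneg j
    linarith)
  exact le_mul_of_one_le_left (norm_nonneg _) this

noncomputable def DD (f : ℝ → ℂ) : ℝ → ℂ := fun r => (r : ℂ) * derivWithin f (Set.Icc 0 1) r

lemma DD_contDiff {f : ℝ → ℂ} (hf : ContDiffOn ℝ (⊤ : ℕ∞) f (Set.Icc 0 1)) :
    ContDiffOn ℝ (⊤ : ℕ∞) (DD f) (Set.Icc 0 1) := by
  refine ContDiffOn.mul (Complex.ofRealCLM.contDiff.contDiffOn) ?_
  exact hf.derivWithin (uniqueDiffOn_Icc zero_lt_one) (by simp)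

lemma DD_S {f : ℝ → ℂ} {c : ℕ → ℂ} (hc : Summ c) (hf : Set.EqOn f (S c) (Set.Ioo 0 1)) :
    Set.EqOn (DD f) (S (eu c)) (Set.Ioo 0 1) := by
  intro r hr
  have hr0 : (r : ℂ) ≠ 0 := by exact_mod_cast hr.1.ne'
  have h1 : HasDerivAt f (S (eu c) r / r) r :=
    (hasDerivAt_S' hc hr).congr_of_eventuallyEq (hf.eventuallyEq_of_mem (Ioo_mem_nhds hr.1 hr.2))
  rw [DD, derivWithin_of_mem_nhds (Icc_mem_nhds hr.1 hr.2), h1.deriv]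
  field_simp

lemma no_smooth (k : ℕ) (hk : 2 ≤ k) (l : ℂ) (hl : 0 ≤ l.re) (f : ℝ → ℂ)
    (hf : ContDiffOn ℝ (⊤ : ℕ∞) f (Set.Icc 0 1)) (hfS : Set.EqOn f (S (A k l)) (Set.Ioo 0 1)) :
    False := by
  obtain ⟨s, L, hs, hL, hT⟩ := coeff_asymp k hk l hl (k + 2) le_rfl
  have key : ∀ m, ContDiffOn ℝ (⊤ : ℕ∞) (DD^[m] f) (Set.Icc 0 1) ∧ Summ (eu^[m] (A k l)) ∧
      Set.EqOn (DD^[m] f) (S (eu^[m] (A k l))) (Set.Ioo 0 1) := by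
    intro m
    induction m with
    | zero => exact ⟨hf, summ_A k hk l hl, hfS⟩
    | succ m ih =>
      simp only [Function.iterate_succ_apply']
      exact ⟨DD_contDiff ih.1, ih.2.1.eu, DD_S ih.2.1 ih.2.2⟩
  obtain ⟨h1, h2, h3⟩ := key (k + 2)
  obtain ⟨M, hM⟩ := isCompact_Icc.exists_bound_of_continuousOn h1.continuousOn
  have hc : eu^[k + 2] (A k l) = fun j : ℕ => (2 * (j : ℂ) + 2) ^ (k + 2) * A k l j :=
    funext fun j => eu_iter _ _ _
  -- boundedness near 1, and near 0 by monotonicity of the majorant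
  have h4 := summable_c _ s L hs hT (1 / 4) (by norm_num) (by norm_num)
  set M0 := ∑' j : ℕ, ‖(2 * (j : ℂ) + 2) ^ (k + 2) * A k l j‖ * (1 / 4 : ℝ) ^ j with hM0
  obtain ⟨x, hx0, hx1, hx⟩ := unbounded_c _ s L hs hL hT (max M0 (4 * M))
  rcases le_or_gt x (1 / 4) with hx4 | hx4
  · have : ‖∑' j : ℕ, (2 * (j : ℂ) + 2) ^ (k + 2) * A k l j * (x : ℂ) ^ j‖ ≤ M0 := by
      refine tsum_of_norm_bounded h4.hasSum fun j => ?_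
      rw [norm_mul _ ((x : ℂ) ^ j), norm_pow (x : ℂ), Complex.norm_real, Real.norm_of_nonneg hx0.le]
      gcongr
    exact absurd hx (not_lt.mpr (this.trans (le_max_left _ _)))
  · have hsq : Real.sqrt x ∈ Set.Ioo (0 : ℝ) 1 :=
      ⟨Real.sqrt_pos.mpr hx0, by rw [Real.sqrt_lt' one_pos]; simpa using hx1⟩
    have h5 := h3 hsq
    have h6 := hM _ (Set.Ioo_subset_Icc_self hsq)
    rw [h5, S_eq, Real.sq_sqrt hx0.le, norm_mul, ← Complex.ofReal_pow, Real.sq_sqrt hx0.le,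
      Complex.norm_real, Real.norm_of_nonneg hx0.le, hc] at h6
    have h7 := (le_max_right M0 (4 * M)).trans_lt hx
    nlinarith [norm_nonneg (∑' j : ℕ, (2 * (j : ℂ) + 2) ^ (k + 2) * A k l j * (x : ℂ) ^ j)]

noncomputable def T (k : ℕ) (l : ℂ) (j : ℕ) : ℂ := P k j * A k l (j + 1) - Q l j * A k l j

lemma T_eq (k : ℕ) (hk : 2 ≤ k) (l : ℂ) (j : ℕ) :
    k * T k l j = D k l j / ∏ i ∈ Finset.range j, ((k : ℂ) * (P k i : ℂ)) := by
  have h1 := prodP_ne k hk j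
  have h2 : (P k j : ℂ) ≠ 0 := by exact_mod_cast (P_pos k j).ne'
  have hk0 : (k : ℂ) ≠ 0 := by exact_mod_cast (by omega : k ≠ 0)
  rw [T, A, A, B_succ, Finset.prod_range_succ]
  field_simp
  ring

lemma T_zero (k : ℕ) (hk : 2 ≤ k) (l : ℂ) : k * T k l 0 = -K k * A k l 0 := by
  rw [T_eq k hk, A_zero, D_zero]; simp

lemma T_succ (k : ℕ) (hk : 2 ≤ k) (l : ℂ) (j : ℕ) :
    k * T k l (j + 1) + T k l j = -K k * A k l (j + 1) := by
  have h1 := prodP_ne k hk j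
  have h2 : (P k j : ℂ) ≠ 0 := by exact_mod_cast (P_pos k j).ne'
  have hk0 : (k : ℂ) ≠ 0 := by exact_mod_cast (by omega : k ≠ 0)
  have h3 : T k l j = (D k l j / ∏ i ∈ Finset.range j, ((k : ℂ) * (P k i : ℂ))) / k := by
    rw [← T_eq k hk]; field_simp
  rw [T_eq k hk, h3, A, D_succ, Finset.prod_range_succ]
  field_simp
  ring

lemma S_ode (k : ℕ) (hk : 2 ≤ k) (l : ℂ) (hl : 0 ≤ l.re) (r : ℝ) (hr : r ∈ Set.Ioo (0 : ℝ) 1) :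
    ((r : ℂ) ^ 2 + k) * ((S (eu (eu (A k l))) r + k * S (eu (A k l)) r - 2 * (k + 2) * S (A k l) r)
      - (r : ℂ) ^ 2 * (S (eu (eu (A k l))) r + (2 * l + 1) * S (eu (A k l)) r
        + l * (l + 1) * S (A k l) r)) + K k * (r : ℂ) ^ 2 * S (A k l) r = 0 := by
  have hA := summ_A k hk l hl
  have hr' : |r| < 1 := by rw [abs_of_pos hr.1]; exact hr.2
  have s0 := hA.summable hr' 2
  have s1 := hA.eu.summable hr' 2
  have s2 := hA.eu.eu.summable hr' 2
  have F := ((s2.hasSum.add (s1.hasSum.mul_left (k : ℂ))).sub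
    (s0.hasSum.mul_left (2 * ((k : ℂ) + 2))))
  have G := ((s2.hasSum.add (s1.hasSum.mul_left (2 * l + 1))).add
    (s0.hasSum.mul_left (l * (l + 1)))).mul_left ((r : ℂ) ^ 2)
  rw [← hasSum_nat_add_iff' 1] at F
  have FG := F.sub G
  have hT : HasSum (fun j => T k l j * (r : ℂ) ^ (2 * j + 4))
      ((S (eu (eu (A k l))) r + k * S (eu (A k l)) r - 2 * (k + 2) * S (A k l) r)
      - (r : ℂ) ^ 2 * (S (eu (eu (A k l))) r + (2 * l + 1) * S (eu (A k l)) r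
        + l * (l + 1) * S (A k l) r)) := by
    have e0 : eu (A k l) 0 = 2 * A k l 0 := by simp [eu]
    have e1 : eu (eu (A k l)) 0 = 4 * A k l 0 := by simp [eu]; ring
    have e := FG.congr_fun (g := fun j => T k l j * (r : ℂ) ^ (2 * j + 4)) (fun j => by
      simp only [T, eu, P, Q]
      push_cast
      ring)
    simp only [Finset.sum_range_one, e0, e1] at e
    refine (congrArg (HasSum (fun j => T k l j * (r : ℂ) ^ (2 * j + 4))
      · (SummationFilter.unconditional ℕ)) ?_).mp e
    simp only [S]
    ring
  have h1 := hT.mul_left (k : ℂ)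
  rw [← hasSum_nat_add_iff' 1] at h1
  have h2 := h1.add (hT.mul_left ((r : ℂ) ^ 2))
  have h3 := (s0.hasSum.mul_left (-(K k : ℂ) * (r : ℂ) ^ 2))
  rw [← hasSum_nat_add_iff' 1] at h3
  have h4 := h2.unique (h3.congr_fun (fun j => by
    linear_combination (r : ℂ) ^ (2 * j + 6) * T_succ k hk l j))
  simp only [Finset.sum_range_one] at h4
  have h5 := T_zero k hk l
  change _ = -(K k : ℂ) * (r : ℂ) ^ 2 * S (A k l) r - _ at h4
  linear_combination h4 + (r : ℂ) ^ 4 * h5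

end Susy

namespace Susy
open Filter Topology

lemma lin_unique (a b y z : ℝ → ℂ) (ha : ContinuousOn a (Set.Ioo 0 1))
    (hb : ContinuousOn b (Set.Ioo 0 1))
    (hy : ∀ t ∈ Set.Ioo (0 : ℝ) 1, HasDerivAt y (z t) t)
    (hz : ∀ t ∈ Set.Ioo (0 : ℝ) 1, HasDerivAt z (a t * z t + b t * y t) t)
    (t0 : ℝ) (ht0 : t0 ∈ Set.Ioo (0 : ℝ) 1) (hy0 : y t0 = 0) (hz0 : z t0 = 0) :
    ∀ t ∈ Set.Ioo (0 : ℝ) 1, y t = 0 := by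
  intro t ht
  obtain ⟨p, hp0, hp⟩ := exists_between (lt_min ht0.1 ht.1)
  obtain ⟨q, hq, hq1⟩ := exists_between (max_lt ht0.2 ht.2)
  rw [lt_min_iff] at hp
  rw [max_lt_iff] at hq
  have hsub : Set.Icc p q ⊆ Set.Ioo (0 : ℝ) 1 := fun x hx =>
    ⟨hp0.trans_le hx.1, hx.2.trans_lt hq1⟩
  have hsub' : Set.Ioo p q ⊆ Set.Ioo (0 : ℝ) 1 := Set.Ioo_subset_Icc_self.trans hsub
  obtain ⟨M, hM⟩ := isCompact_Icc.exists_bound_of_continuousOn (ha.mono hsub)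
  obtain ⟨N, hN⟩ := isCompact_Icc.exists_bound_of_continuousOn (hb.mono hsub)
  have hM0 : 0 ≤ M := (norm_nonneg _).trans (hM t0 ⟨hp.1.le, hq.1.le⟩)
  have hN0 : 0 ≤ N := (norm_nonneg _).trans (hN t0 ⟨hp.1.le, hq.1.le⟩)
  have key := ODE_solution_unique_of_mem_Ioo (a := p) (b := q) (t₀ := t0)
    (v := fun t (w : ℂ × ℂ) => (w.2, a t * w.2 + b t * w.1)) (s := fun _ => Set.univ)
    (K := ⟨1 + M + N, by positivity⟩) (f := fun t => (y t, z t)) (g := fun _ => (0, 0))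
    ?_ ⟨hp.1, hq.1⟩ ?_ ?_ (by simp [hy0, hz0])
  · exact congrArg Prod.fst (key ⟨hp.2, hq.2⟩)
  · intro s hs
    have hs' := Set.Ioo_subset_Icc_self hs
    refine (LipschitzWith.of_dist_le_mul fun w w' => ?_).lipschitzOnWith
    have h1 : ‖w.1 - w'.1‖ ≤ ‖w - w'‖ := norm_fst_le (w - w')
    have h2 : ‖w.2 - w'.2‖ ≤ ‖w - w'‖ := norm_snd_le (w - w')
    have h0 := norm_nonneg (w - w')
    rw [dist_eq_norm, dist_eq_norm]
    change _ ≤ (1 + M + N) * _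
    refine norm_prod_le_iff.mpr ⟨?_, ?_⟩
    · change ‖w.2 - w'.2‖ ≤ _
      nlinarith [mul_nonneg hM0 h0, mul_nonneg hN0 h0]
    · change ‖(a s * w.2 + b s * w.1) - (a s * w'.2 + b s * w'.1)‖ ≤ _
      calc _ = ‖a s * (w.2 - w'.2) + b s * (w.1 - w'.1)‖ := by congr 1; ring
        _ ≤ ‖a s‖ * ‖w.2 - w'.2‖ + ‖b s‖ * ‖w.1 - w'.1‖ := by
          refine (norm_add_le _ _).trans ?_
          rw [norm_mul, norm_mul]
        _ ≤ M * ‖w - w'‖ + N * ‖w - w'‖ := by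
          gcongr
          · exact hM s hs'
          · exact hN s hs'
        _ ≤ _ := by nlinarith
  · intro s hs
    exact ⟨(hy s (hsub' hs)).prodMk (hz s (hsub' hs)), trivial⟩
  · intro s hs
    refine ⟨?_, trivial⟩
    refine (hasDerivAt_const s ((0, 0) : ℂ × ℂ)).congr_deriv ?_
    ext <;> simp

noncomputable def ca (k : ℕ) (l : ℂ) (t : ℝ) : ℂ :=
  -(((k : ℂ) + 1) / (t : ℂ) - 2 * (l + 1) * (t : ℂ)) / (1 - (t : ℂ) ^ 2)

noncomputable def cb (k : ℕ) (l : ℂ) (t : ℝ) : ℂ :=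
  (l * (l + 1) - (2 * (k : ℂ) / (t : ℂ) ^ 2) * (((t : ℂ) ^ 2 - (k : ℂ) - 2) /
    ((t : ℂ) ^ 2 + (k : ℂ)))) / (1 - (t : ℂ) ^ 2)

lemma ne_facts (k : ℕ) (t : ℝ) (ht : t ∈ Set.Ioo (0 : ℝ) 1) :
    (t : ℂ) ≠ 0 ∧ (1 - (t : ℂ) ^ 2) ≠ 0 ∧ ((t : ℂ) ^ 2 + (k : ℂ)) ≠ 0 := by
  obtain ⟨h0, h1⟩ := ht
  refine ⟨by exact_mod_cast h0.ne', ?_, ?_⟩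
  · have : (1 - t ^ 2 : ℝ) ≠ 0 := by nlinarith
    exact_mod_cast this
  · have : (t ^ 2 + (k : ℝ)) ≠ 0 := by positivity
    exact_mod_cast this

lemma ca_cont (k : ℕ) (l : ℂ) : ContinuousOn (ca k l) (Set.Ioo 0 1) := by
  unfold ca
  have h : Continuous fun t : ℝ => (t : ℂ) := Complex.continuous_ofReal
  refine ContinuousOn.div ?_ (by fun_prop) (fun t ht => (ne_facts k t ht).2.1)
  refine ContinuousOn.neg (ContinuousOn.sub ?_ (by fun_prop))
  exact ContinuousOn.div (by fun_prop) (by fun_prop) (fun t ht => (ne_facts k t ht).1)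

lemma cb_cont (k : ℕ) (l : ℂ) : ContinuousOn (cb k l) (Set.Ioo 0 1) := by
  unfold cb
  refine ContinuousOn.div ?_ (by fun_prop) (fun t ht => (ne_facts k t ht).2.1)
  refine ContinuousOn.sub (by fun_prop) (ContinuousOn.mul ?_ ?_)
  · exact ContinuousOn.div (by fun_prop) (by fun_prop)
      (fun t ht => pow_ne_zero 2 (ne_facts k t ht).1)
  · exact ContinuousOn.div (by fun_prop) (by fun_prop) (fun t ht => (ne_facts k t ht).2.2)

noncomputable def VV (k : ℕ) (l : ℂ) (t : ℝ) : ℂ := S (eu (A k l)) t / t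

lemma U_deriv (k : ℕ) (hk : 2 ≤ k) (l : ℂ) (hl : 0 ≤ l.re) (t : ℝ)
    (ht : t ∈ Set.Ioo (0 : ℝ) 1) : HasDerivAt (S (A k l)) (VV k l t) t :=
  hasDerivAt_S' (summ_A k hk l hl) ht

lemma V_deriv (k : ℕ) (hk : 2 ≤ k) (l : ℂ) (hl : 0 ≤ l.re) (t : ℝ)
    (ht : t ∈ Set.Ioo (0 : ℝ) 1) :
    HasDerivAt (VV k l) (ca k l t * VV k l t + cb k l t * S (A k l) t) t := by
  have h1 := hasDerivAt_S' (summ_A k hk l hl).eu ht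
  have h2 : HasDerivAt (fun y : ℝ => (y : ℂ)) 1 t := by
    simpa using (hasDerivAt_id t).ofReal_comp
  obtain ⟨n0, n1, n2⟩ := ne_facts k t ht
  refine (h1.div h2 n0).congr_deriv ?_
  have h3 := S_ode k hk l hl t ht
  rw [K] at h3
  push_cast at h3
  unfold ca cb VV
  field_simp
  linear_combination h3

lemma wronsk (k : ℕ) (hk : 2 ≤ k) (l : ℂ) (hl : 0 ≤ l.re) (u : ℝ → ℂ)
    (hu : ContDiffOn ℝ (⊤ : ℕ∞) u (Set.Icc 0 1))
    (h1 : ∀ t ∈ Set.Ioo (0 : ℝ) 1, HasDerivAt u (deriv u t) t)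
    (h2 : ∀ t ∈ Set.Ioo (0 : ℝ) 1,
      HasDerivAt (deriv u) (ca k l t * deriv u t + cb k l t * u t) t) :
    ∀ t ∈ Set.Ioo (0 : ℝ) 1, S (A k l) t * deriv u t - VV k l t * u t = 0 := by
  set e : ℂ := l + 1 - ((k : ℂ) + 1) / 2 with he
  set E : ℝ → ℂ := fun t => Complex.exp (e * (Real.log (1 - t ^ 2) : ℝ)) with hE
  set W : ℝ → ℂ := fun t => S (A k l) t * deriv u t - VV k l t * u t with hW
  set Z : ℝ → ℂ := fun t => (t : ℂ) ^ (k + 1) * W t * E t with hZ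
  have hEd : ∀ t ∈ Set.Ioo (0 : ℝ) 1,
      HasDerivAt E (E t * (e * (-(2 * t) / (1 - (t : ℂ) ^ 2)))) t := by
    intro t ht
    have hp : (1 - t ^ 2 : ℝ) ≠ 0 := by nlinarith [ht.1, ht.2]
    have a1 : HasDerivAt (fun t : ℝ => 1 - t ^ 2) (-(2 * t)) t := by
      simpa using ((hasDerivAt_id t).fun_pow 2).const_sub 1
    have a2 := ((a1.log hp).ofReal_comp.const_mul e).cexp
    refine a2.congr_deriv ?_
    push_cast
    rfl
  have hWd : ∀ t ∈ Set.Ioo (0 : ℝ) 1, HasDerivAt W (ca k l t * W t) t := by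
    intro t ht
    refine (((U_deriv k hk l hl t ht).fun_mul (h2 t ht)).fun_sub
      ((V_deriv k hk l hl t ht).fun_mul (h1 t ht))).congr_deriv ?_
    simp only [hW]
    ring
  have hZd : ∀ t ∈ Set.Ioo (0 : ℝ) 1, HasDerivAt Z 0 t := by
    intro t ht
    obtain ⟨n0, n1, n2⟩ := ne_facts k t ht
    have b1 : HasDerivAt (fun y : ℝ => (y : ℂ)) 1 t := by
      simpa using (hasDerivAt_id t).ofReal_comp
    refine (((b1.fun_pow (k + 1)).fun_mul (hWd t ht)).fun_mul (hEd t ht)).congr_deriv ?_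
    simp only [he, ca]
    push_cast
    simp only [pow_succ (t : ℂ) k]
    field_simp
    ring
  have hconst : ∀ x ∈ Set.Ioo (0 : ℝ) 1, ∀ y ∈ Set.Ioo (0 : ℝ) 1, Z x = Z y := by
    intro x hx y hy
    exact isOpen_Ioo.is_const_of_deriv_eq_zero isPreconnected_Ioo
      (fun t ht => (hZd t ht).differentiableAt.differentiableWithinAt)
      (fun t ht => (hZd t ht).deriv) hx hy
  set G : ℝ → ℂ := fun t => (t : ℂ) ^ k * (S (A k l) t * DD u t - S (eu (A k l)) t * u t) * E t
    with hG
  have hGZ : ∀ t ∈ Set.Ioo (0 : ℝ) 1, G t = Z t := by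
    intro t ht
    obtain ⟨n0, n1, n2⟩ := ne_facts k t ht
    simp only [hG, hZ, hW, DD, derivWithin_of_mem_nhds (Icc_mem_nhds ht.1 ht.2), VV]
    field_simp
    ring
  have h0 : (0 : ℝ) ∈ Set.Icc (0 : ℝ) 1 := by simp
  have hsA := summ_A k hk l hl
  have hEc : ContinuousAt E 0 := by
    have : ContinuousAt (fun t : ℝ => Real.log (1 - t ^ 2)) 0 :=
      ContinuousAt.log (by fun_prop) (by simp)
    exact (continuousAt_const.mul (Complex.continuous_ofReal.continuousAt.comp this)).cexp
  have hGc : ContinuousWithinAt G (Set.Icc 0 1) 0 := by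
    refine ContinuousWithinAt.mul (ContinuousWithinAt.mul ?_ (ContinuousWithinAt.sub
      (ContinuousWithinAt.mul ?_ ?_) (ContinuousWithinAt.mul ?_ ?_))) ?_
    · exact (Complex.continuous_ofReal.pow k).continuousWithinAt
    · exact (continuousAt_S hsA).continuousWithinAt
    · exact (DD_contDiff hu).continuousOn 0 h0
    · exact (continuousAt_S hsA.eu).continuousWithinAt
    · exact hu.continuousOn 0 h0
    · exact hEc.continuousWithinAt
  have hG0 : G 0 = 0 := by
    have : k ≠ 0 := by omega
    simp [hG, this]
  intro t ht
  have hlim : Tendsto G (𝓝[Set.Ioo 0 1] 0) (𝓝 0) := by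
    have := hGc.mono Set.Ioo_subset_Icc_self
    rw [ContinuousWithinAt, hG0] at this
    exact this
  have hlim2 : Tendsto G (𝓝[Set.Ioo 0 1] 0) (𝓝 (Z t)) := by
    refine tendsto_const_nhds.congr' ?_
    filter_upwards [self_mem_nhdsWithin] with x hx
    rw [hGZ x hx]
    exact hconst t ht x hx
  have : (𝓝[Set.Ioo (0 : ℝ) 1] 0).NeBot := by
    rw [← mem_closure_iff_nhdsWithin_neBot, closure_Ioo zero_ne_one]
    exact h0
  have hZ0 : Z t = 0 := tendsto_nhds_unique hlim2 hlim
  obtain ⟨n0, n1, n2⟩ := ne_facts k t ht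
  have : (t : ℂ) ^ (k + 1) * W t * E t = 0 := hZ0
  rcases mul_eq_zero.mp this with h | h
  · rcases mul_eq_zero.mp h with h | h
    · exact absurd h (pow_ne_zero _ n0)
    · exact h
  · exact absurd h (Complex.exp_ne_zero _)

end Susy

theorem susy_no_unstable_eigenvalues (k : ℕ) (hk : 2 ≤ k) (lam : ℂ) (hre : 0 ≤ lam.re)
    (u : ℝ → ℂ) (hu : ContDiffOn ℝ (⊤ : ℕ∞) u (Set.Icc 0 1))
    (hode : ∀ ρ ∈ Set.Ioo (0 : ℝ) 1,
      (1 - (ρ : ℂ) ^ 2) * deriv (deriv u) ρ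
        + (((k : ℂ) + 1) / (ρ : ℂ) - 2 * (lam + 1) * (ρ : ℂ)) * deriv u ρ
        - lam * (lam + 1) * u ρ
        + (2 * (k : ℂ) / (ρ : ℂ) ^ 2) * (((ρ : ℂ) ^ 2 - (k : ℂ) - 2) / ((ρ : ℂ) ^ 2 + (k : ℂ)))
            * u ρ = 0) :
    Set.EqOn u 0 (Set.Icc 0 1) := by
  have huo : ContDiffOn ℝ (⊤ : ℕ∞) u (Set.Ioo 0 1) := hu.mono Set.Ioo_subset_Icc_self
  have hu' : ContDiffOn ℝ (⊤ : ℕ∞) (deriv u) (Set.Ioo 0 1) :=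
    huo.deriv_of_isOpen isOpen_Ioo (by simp)
  have h1 : ∀ t ∈ Set.Ioo (0 : ℝ) 1, HasDerivAt u (deriv u t) t := fun t ht =>
    ((huo.differentiableOn (by simp)).differentiableAt (isOpen_Ioo.mem_nhds ht)).hasDerivAt
  have h2 : ∀ t ∈ Set.Ioo (0 : ℝ) 1,
      HasDerivAt (deriv u) (Susy.ca k lam t * deriv u t + Susy.cb k lam t * u t) t := by
    intro t ht
    have h3 := ((hu'.differentiableOn (by simp)).differentiableAt
      (isOpen_Ioo.mem_nhds ht)).hasDerivAt
    refine h3.congr_deriv ?_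
    obtain ⟨n0, n1, n2⟩ := Susy.ne_facts k t ht
    have h4 := hode t ht
    refine mul_left_cancel₀ n1 ?_
    have e1 : (1 - (t : ℂ) ^ 2) * Susy.ca k lam t
        = -(((k : ℂ) + 1) / (t : ℂ) - 2 * (lam + 1) * (t : ℂ)) := by
      rw [Susy.ca, mul_div_cancel₀ _ n1]
    have e2 : (1 - (t : ℂ) ^ 2) * Susy.cb k lam t
        = lam * (lam + 1) - (2 * (k : ℂ) / (t : ℂ) ^ 2) * (((t : ℂ) ^ 2 - (k : ℂ) - 2) /
          ((t : ℂ) ^ 2 + (k : ℂ))) := by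
      rw [Susy.cb, mul_div_cancel₀ _ n1]
    linear_combination h4 - deriv u t * e1 - u t * e2
  have hW := Susy.wronsk k hk lam hre u hu h1 h2
  have hex : ∃ r ∈ Set.Ioo (0 : ℝ) 1, Susy.S (Susy.A k lam) r ≠ 0 := by
    by_contra! hcon
    exact Susy.no_smooth k hk lam hre (fun _ => 0) contDiffOn_const
      (fun r hr => (hcon r hr).symm)
  obtain ⟨r, hr, hrU⟩ := hex
  set c := u r / Susy.S (Susy.A k lam) r with hc
  have hsol := Susy.lin_unique (Susy.ca k lam) (Susy.cb k lam)
    (fun t => u t - c * Susy.S (Susy.A k lam) t) (fun t => deriv u t - c * Susy.VV k lam t)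
    (Susy.ca_cont k lam) (Susy.cb_cont k lam)
    (fun t ht => (h1 t ht).fun_sub ((Susy.U_deriv k hk lam hre t ht).const_mul c))
    (fun t ht => ((h2 t ht).fun_sub ((Susy.V_deriv k hk lam hre t ht).const_mul c)).congr_deriv
      (by ring)) r hr (by rw [hc]; field_simp; ring) (by
        have := hW r hr
        rw [hc]
        field_simp
        linear_combination this)
  have hc0 : c = 0 := by
    by_contra hne
    refine Susy.no_smooth k hk lam hre (fun t => c⁻¹ * u t) (contDiffOn_const.mul hu) ?_
    intro t ht
    have := hsol t ht
    change c⁻¹ * u t = _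
    rw [sub_eq_zero.mp this]
    field_simp
  have hz : Set.EqOn u 0 (Set.Ioo 0 1) := by
    intro t ht
    have := hsol t ht
    simpa [hc0] using this
  refine hz.of_subset_closure hu.continuousOn continuousOn_const Set.Ioo_subset_Icc_self ?_
  rw [closure_Ioo zero_ne_one]
end

section
/- Let d ≥ 4 be an integer and let λ ∈ ℂ with Re λ ≥ 0 and λ ≠ 1. If there exists a nonzero function u : ℝ → ℂ, smooth (C^∞) on [0,1], satisfying (1−ρ²)u'' + ((d−1)/ρ − 2(λ+1)ρ)u' − λ(λ+1)u − V(ρ)u = 0 on (0,1) with V(ρ) = ((d−1)/ρ²)·(ρ⁴ + (12−6d)ρ² + (d−2)²)/(ρ² + d−2)², then there exists a nonzero function ũ : ℝ → ℂ, smooth (C^∞) on [0,1], satisfying (1−ρ²)ũ'' + ((k+1)/ρ − 2(λ+1)ρ)ũ' − λ(λ+1)ũ + (2k/ρ²)·((ρ²−k−2)/(ρ²+k))·ũ = 0 on (0,1), where k = d − 2. -/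
open Set Filter Topology

/-- Parametric integrals `∫ t^m h(t x)` are as smooth as `h`. -/
lemma param_contDiff (n : ℕ) : ∀ (m : ℕ) (h : ℝ → ℂ), ContDiff ℝ n h →
    ContDiff ℝ n (fun x : ℝ => ∫ t in (0 : ℝ)..1, ((t : ℂ) ^ m) * h (t * x)) := by
  induction n with
  | zero =>
    intro m h hh
    have hc : Continuous h := hh.continuous
    rw [Nat.cast_zero, contDiff_zero]
    apply intervalIntegral.continuous_parametric_intervalIntegral_of_continuous'
    fun_prop
  | succ n ih =>
    intro m h hh
    have hc : Continuous h := hh.continuous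
    rw [Nat.cast_succ, contDiff_succ_iff_deriv] at hh
    obtain ⟨hd, -, hd'⟩ := hh
    have hc' : Continuous (deriv h) := hd'.continuous
    have key : ∀ x₀ : ℝ, HasDerivAt (fun x : ℝ => ∫ t in (0 : ℝ)..1, ((t : ℂ) ^ m) * h (t * x))
        (∫ t in (0 : ℝ)..1, ((t : ℂ) ^ (m + 1)) * deriv h (t * x₀)) x₀ := by
      intro x₀
      obtain ⟨M, hM⟩ := (isCompact_Icc (a := -(|x₀| + 1)) (b := |x₀| + 1)).exists_bound_of_continuousOn
        hc'.continuousOn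
      refine (intervalIntegral.hasDerivAt_integral_of_dominated_loc_of_deriv_le
        (F := fun x t => ((t : ℂ) ^ m) * h (t * x))
        (F' := fun x t => ((t : ℂ) ^ (m + 1)) * deriv h (t * x)) (bound := fun _ => M)
        (Metric.ball_mem_nhds x₀ one_pos) ?_ ?_ ?_ ?_ ?_ ?_).2
      · filter_upwards with x
        exact (by fun_prop : Continuous fun t : ℝ => ((t : ℂ) ^ m) * h (t * x)).aestronglyMeasurable
      · exact (by fun_prop : Continuous fun t : ℝ => ((t : ℂ) ^ m) * h (t * x₀)).intervalIntegrable _ _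
      · exact (by fun_prop : Continuous fun t : ℝ =>
          ((t : ℂ) ^ (m + 1)) * deriv h (t * x₀)).aestronglyMeasurable
      · filter_upwards with t ht x hx
        rw [uIoc_of_le zero_le_one] at ht
        have h1 : |x| ≤ |x₀| + 1 := by
          rw [Metric.mem_ball, Real.dist_eq] at hx
          have := abs_sub_abs_le_abs_sub x x₀
          linarith
        have h2 : |t * x| ≤ |x₀| + 1 := by
          rw [abs_mul, abs_of_pos ht.1]
          have := abs_nonneg x
          nlinarith [ht.2, ht.1]
        have h3 := hM (t * x) (abs_le.mp h2)
        rw [norm_mul, norm_pow, Complex.norm_real, Real.norm_eq_abs, abs_of_pos ht.1]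
        have h4 : t ^ (m + 1) ≤ 1 := pow_le_one₀ ht.1.le ht.2
        have h5 := norm_nonneg (deriv h (t * x))
        nlinarith
      · exact intervalIntegrable_const
      · filter_upwards with t ht x hx
        have h1 : HasDerivAt (fun x : ℝ => t * x) t x := by
          simpa using (hasDerivAt_id x).const_mul t
        have h2 := ((hd (t * x)).hasDerivAt.scomp x h1).const_mul ((t : ℂ) ^ m)
        refine h2.congr_deriv ?_
        simp only [Complex.real_smul]
        ring
    rw [Nat.cast_succ, contDiff_succ_iff_deriv]
    refine ⟨fun x => (key x).differentiableAt, by simp, ?_⟩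
    rw [show deriv (fun x : ℝ => ∫ t in (0 : ℝ)..1, ((t : ℂ) ^ m) * h (t * x)) = _ from
      funext fun x => (key x).deriv]
    exact ih (m + 1) (deriv h) hd'

/-- Finite order extension from `[0,1]`. -/
lemma exists_ext (n : ℕ) : ∀ f : ℝ → ℂ, ContDiffOn ℝ n f (Icc 0 1) →
    ∃ F : ℝ → ℂ, ContDiff ℝ n F ∧ EqOn f F (Icc 0 1) := by
  induction n with
  | zero =>
    intro f hf
    have hc := hf.continuousOn
    refine ⟨IccExtend (zero_le_one) ((Icc (0 : ℝ) 1).domRestrict f), ?_, ?_⟩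
    · rw [Nat.cast_zero, contDiff_zero]
      exact (continuousOn_iff_continuous_domRestrict.mp hc).Icc_extend'
    · intro x hx
      rw [IccExtend_of_mem _ _ hx]
      rfl
  | succ n ih =>
    intro f hf
    have hud : UniqueDiffOn ℝ (Icc (0 : ℝ) 1) := uniqueDiffOn_Icc one_pos
    rw [Nat.cast_succ, contDiffOn_succ_iff_derivWithin hud] at hf
    obtain ⟨hd, -, hd'⟩ := hf
    obtain ⟨G, hG, hGe⟩ := ih _ hd'
    have hGc : Continuous G := hG.continuous
    have hder : ∀ x, HasDerivAt (fun x => f 0 + ∫ t in (0 : ℝ)..x, G t) (G x) x := fun x =>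
      (hGc.integral_hasStrictDerivAt 0 x).hasDerivAt.const_add _
    refine ⟨fun x => f 0 + ∫ t in (0 : ℝ)..x, G t, ?_, ?_⟩
    · rw [Nat.cast_succ, contDiff_succ_iff_deriv]
      refine ⟨fun x => (hder x).differentiableAt, by simp, ?_⟩
      rw [show deriv (fun x => f 0 + ∫ t in (0 : ℝ)..x, G t) = G from
        funext fun x => (hder x).deriv]
      exact hG
    · apply eq_of_derivWithin_eq hd
      · exact fun x _ => (hder x).differentiableAt.differentiableWithinAt
      · intro x hx
        rw [(hder x).hasDerivWithinAt.derivWithin (hud x ⟨hx.1, hx.2.le⟩)]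
        exact hGe ⟨hx.1, hx.2.le⟩
      · simp

lemma exists_div (u : ℝ → ℂ) (hu : ContDiffOn ℝ (⊤ : ℕ∞) u (Icc 0 1)) (h0 : u 0 = 0) :
    ContDiffOn ℝ (⊤ : ℕ∞)
      (fun x => if x = 0 then derivWithin u (Icc 0 1) 0 else u x / (x : ℂ)) (Icc 0 1) := by
  have hud : UniqueDiffOn ℝ (Icc (0 : ℝ) 1) := uniqueDiffOn_Icc one_pos
  rw [contDiffOn_infty]
  intro n
  obtain ⟨F, hF, hFe⟩ := exists_ext (n + 1) u ((contDiffOn_infty.mp hu) (n + 1))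
  rw [Nat.cast_succ, contDiff_succ_iff_deriv] at hF
  obtain ⟨hd, -, hd'⟩ := hF
  have hc' : Continuous (deriv F) := hd'.continuous
  have hP := param_contDiff n 0 _ hd'
  refine hP.contDiffOn.congr ?_
  intro x hx
  have hF0 : F 0 = 0 := by rw [← hFe ⟨le_rfl, zero_le_one⟩, h0]
  by_cases hx0 : x = 0
  · subst hx0
    simp only [if_true, pow_zero, one_mul, mul_zero]
    rw [derivWithin_congr hFe (hFe hx), (hd 0).derivWithin (hud 0 hx)]
    simp
  · simp only [hx0, if_false, pow_zero, one_mul]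
    have hxc : (x : ℂ) ≠ 0 := by exact_mod_cast hx0
    have h1 : ∀ t ∈ uIcc (0 : ℝ) 1, HasDerivAt (fun t => F (t * x) / (x : ℂ)) (deriv F (t * x)) t := by
      intro t _
      have h1 : HasDerivAt (fun t : ℝ => t * x) x t := by
        simpa using (hasDerivAt_id t).mul_const x
      refine (((hd (t * x)).hasDerivAt.scomp t h1).div_const (x : ℂ)).congr_deriv ?_
      simp only [Complex.real_smul]
      field_simp
    rw [intervalIntegral.integral_eq_sub_of_hasDerivAt h1
      ((by fun_prop : Continuous fun t : ℝ => deriv F (t * x)).intervalIntegrable _ _)]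
    simp [hF0, hFe hx]

/-- Algebra: the second derivative from the mode equation yields the SUSY first-order system. -/
lemma alg1 (r k l u D D2 : ℂ) (hr : r ≠ 0) (h1 : 1 - r ^ 2 ≠ 0) (hk : r ^ 2 + k ≠ 0)
    (hode : (1 - r ^ 2) * D2 + ((k + 1) / r - 2 * (l + 1) * r) * D - l * (l + 1) * u
      - ((k + 1) / r ^ 2 * ((r ^ 4 + (-6 * k) * r ^ 2 + k ^ 2) / (r ^ 2 + k) ^ 2)) * u = 0) :
    (-2 * r) * (D - ((l - 1) * r / (1 - r ^ 2) + 1 / r - 2 * r / (r ^ 2 + k)) * u)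
      + (1 - r ^ 2) * (D2 - (((l - 1) * (1 + r ^ 2) / (1 - r ^ 2) ^ 2 - 1 / r ^ 2
        - 2 * (k - r ^ 2) / (r ^ 2 + k) ^ 2) * u +
        ((l - 1) * r / (1 - r ^ 2) + 1 / r - 2 * r / (r ^ 2 + k)) * D))
    = ((-2 * r - ((k + 1) / r - 2 * (l + 1) * r) - (l - 1) * r) / (1 - r ^ 2)
        - 1 / r + 2 * r / (r ^ 2 + k))
        * ((1 - r ^ 2) * (D - ((l - 1) * r / (1 - r ^ 2) + 1 / r - 2 * r / (r ^ 2 + k)) * u))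
      + (l - 1) * (l - k) * u / (1 - r ^ 2) := by
  have e : D2 = (-((k + 1) / r - 2 * (l + 1) * r) * D + l * (l + 1) * u
      + ((k + 1) / r ^ 2 * ((r ^ 4 + (-6 * k) * r ^ 2 + k ^ 2) / (r ^ 2 + k) ^ 2)) * u)
        / (1 - r ^ 2) := by
    rw [eq_div_iff h1]; linear_combination hode
  rw [e]
  field_simp
  ring

lemma alg2 (r k l u D v v1 : ℂ) (hr : r ≠ 0) (h1 : 1 - r ^ 2 ≠ 0) (hk : r ^ 2 + k ≠ 0)
    (hv : v = (1 - r ^ 2) * (D - ((l - 1) * r / (1 - r ^ 2) + 1 / r - 2 * r / (r ^ 2 + k)) * u))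
    (hv1 : v1 = ((-2 * r - ((k + 1) / r - 2 * (l + 1) * r) - (l - 1) * r) / (1 - r ^ 2)
        - 1 / r + 2 * r / (r ^ 2 + k)) * v + (l - 1) * (l - k) * u / (1 - r ^ 2)) :
    (1 - r ^ 2) * ((((-2 + (k + 1) / r ^ 2 + 2 * (l + 1) - (l - 1)) * (1 - r ^ 2)
          + (-2 * r - ((k + 1) / r - 2 * (l + 1) * r) - (l - 1) * r) * (2 * r)) / (1 - r ^ 2) ^ 2
          + 1 / r ^ 2 + 2 * (k - r ^ 2) / (r ^ 2 + k) ^ 2) * v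
        + ((-2 * r - ((k + 1) / r - 2 * (l + 1) * r) - (l - 1) * r) / (1 - r ^ 2)
        - 1 / r + 2 * r / (r ^ 2 + k)) * v1
        + (l - 1) * (l - k) * (D * (1 - r ^ 2) + u * (2 * r)) / (1 - r ^ 2) ^ 2)
      + ((k + 1) / r - 2 * (l + 1) * r) * v1 - l * (l + 1) * v
      + (2 * k / r ^ 2) * ((r ^ 2 - k - 2) / (r ^ 2 + k)) * v = 0 := by
  have e : D = v / (1 - r ^ 2) + ((l - 1) * r / (1 - r ^ 2) + 1 / r - 2 * r / (r ^ 2 + k)) * u := by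
    rw [hv]; field_simp; ring
  rw [e, hv1]
  clear hv hv1 e
  field_simp
  ring

lemma hdR (k l z : ℂ) (hr : z ≠ 0) (h1 : 1 - z ^ 2 ≠ 0) (hk : z ^ 2 + k ≠ 0) :
    HasDerivAt (fun r : ℂ => (l - 1) * r / (1 - r ^ 2) + 1 / r - 2 * r / (r ^ 2 + k))
      ((l - 1) * (1 + z ^ 2) / (1 - z ^ 2) ^ 2 - 1 / z ^ 2
        - 2 * (k - z ^ 2) / (z ^ 2 + k) ^ 2) z := by
  have hid := hasDerivAt_id z
  have hp : HasDerivAt (fun r : ℂ => r ^ 2) (2 * z) z := by simpa using hasDerivAt_pow 2 z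
  have a := ((hid.const_mul (l - 1)).div (hp.const_sub 1) h1)
  have b := ((hasDerivAt_const z (1 : ℂ)).div hid hr)
  have c := (hid.const_mul 2).div (hp.add_const k) hk
  refine ((a.add b).sub c).congr_deriv ?_
  simp only [id]
  field_simp
  ring

lemma hdS (k l z : ℂ) (hr : z ≠ 0) (h1 : 1 - z ^ 2 ≠ 0) (hk : z ^ 2 + k ≠ 0) :
    HasDerivAt (fun r : ℂ => (-2 * r - ((k + 1) / r - 2 * (l + 1) * r) - (l - 1) * r) / (1 - r ^ 2)
        - 1 / r + 2 * r / (r ^ 2 + k))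
      (((-2 + (k + 1) / z ^ 2 + 2 * (l + 1) - (l - 1)) * (1 - z ^ 2)
          + (-2 * z - ((k + 1) / z - 2 * (l + 1) * z) - (l - 1) * z) * (2 * z)) / (1 - z ^ 2) ^ 2
          + 1 / z ^ 2 + 2 * (k - z ^ 2) / (z ^ 2 + k) ^ 2) z := by
  have hid := hasDerivAt_id z
  have hp : HasDerivAt (fun r : ℂ => r ^ 2) (2 * z) z := by simpa using hasDerivAt_pow 2 z
  have a := ((((hid.const_mul (-2)).sub (((hasDerivAt_const z (k + 1)).div hid hr).sub
    (hid.const_mul (2 * (l + 1))))).sub (hid.const_mul (l - 1))).div (hp.const_sub 1) h1)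
  have b := ((hasDerivAt_const z (1 : ℂ)).div hid hr)
  have c := (hid.const_mul 2).div (hp.add_const k) hk
  refine ((a.sub b).add c).congr_deriv ?_
  simp only [id, Pi.sub_apply, Pi.div_apply]
  field_simp
  ring

lemma hdQ (m : ℕ) (k z : ℂ) (hr : z ≠ 0) (h1 : 1 - z ^ 2 ≠ 0) (hk : z ^ 2 + k ≠ 0) 
    (hm : k = m + 2) :
    HasDerivAt (fun r : ℂ => (1 - r ^ 2) ^ (m + 1) * (r ^ 2 + k) ^ 2 / r ^ 2)
      (-2 * ((k - 1) * z / (1 - z ^ 2) + 1 / z - 2 * z / (z ^ 2 + k)) * 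
        ((1 - z ^ 2) ^ (m + 1) * (z ^ 2 + k) ^ 2 / z ^ 2)) z := by
  have hp : HasDerivAt (fun r : ℂ => r ^ 2) (2 * z) z := by simpa using hasDerivAt_pow 2 z
  have a := (((hp.const_sub 1).pow (m + 1)).mul ((hp.add_const k).pow 2)).div hp (pow_ne_zero 2 hr)
  refine a.congr_deriv ?_
  simp only [Pi.pow_apply, Pi.mul_apply]
  have : (m : ℂ) = k - 2 := by rw [hm]; ring
  simp only [add_tsub_cancel_right]
  push_cast
  rw [this, pow_succ (1 - z ^ 2) m]
  field_simp
  ring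

/-- Eigenvalue correspondence: for `d ≥ 4`, every unstable eigenvalue `λ ≠ 1` of the mode
equation is also an unstable eigenvalue of the supersymmetric problem with `k = d - 2`. -/
theorem eigenvalue_correspondence (d k : ℕ) (hd : 4 ≤ d) (hk : k = d - 2)
    (lam : ℂ) (hre : 0 ≤ lam.re) (hne : lam ≠ 1)
    (h : ∃ u : ℝ → ℂ, ContDiffOn ℝ (⊤ : ℕ∞) u (Set.Icc 0 1) ∧
      (∀ ρ ∈ Set.Ioo (0 : ℝ) 1,
        (1 - (ρ : ℂ) ^ 2) * deriv (deriv u) ρ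
          + (((d : ℂ) - 1) / (ρ : ℂ) - 2 * (lam + 1) * (ρ : ℂ)) * deriv u ρ
          - lam * (lam + 1) * u ρ
          - V d ρ * u ρ = 0) ∧
      ¬ Set.EqOn u 0 (Set.Icc 0 1)) :
    ∃ v : ℝ → ℂ, ContDiffOn ℝ (⊤ : ℕ∞) v (Set.Icc 0 1) ∧
      (∀ ρ ∈ Set.Ioo (0 : ℝ) 1,
        (1 - (ρ : ℂ) ^ 2) * deriv (deriv v) ρ
          + (((k : ℂ) + 1) / (ρ : ℂ) - 2 * (lam + 1) * (ρ : ℂ)) * deriv v ρ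
          - lam * (lam + 1) * v ρ
          + (2 * (k : ℂ) / (ρ : ℂ) ^ 2) * (((ρ : ℂ) ^ 2 - (k : ℂ) - 2) / ((ρ : ℂ) ^ 2 + (k : ℂ)))
              * v ρ = 0) ∧
      ¬ Set.EqOn v 0 (Set.Icc 0 1) := by
  obtain ⟨u, hu, hode, hnz⟩ := h
  have hud : UniqueDiffOn ℝ (Icc (0 : ℝ) 1) := uniqueDiffOn_Icc one_pos
  obtain ⟨m, rfl⟩ : ∃ m, k = m + 2 := ⟨k - 2, by omega⟩
  obtain rfl : d = m + 4 := by omega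
  clear hk hd
  obtain ⟨K, hK⟩ : ∃ K : ℂ, K = ((m + 2 : ℕ) : ℂ) := ⟨_, rfl⟩
  have hKm : K = m + 2 := by rw [hK]; push_cast; ring
  have hdK : ((m + 4 : ℕ) : ℂ) = K + 2 := by rw [hKm]; push_cast; ring
  rw [← hK]
  have hKx : ∀ x : ℝ, (x : ℂ) ^ 2 + K ≠ 0 := by
    intro x
    have : (x : ℂ) ^ 2 + K = ((x ^ 2 + ((m + 2 : ℕ) : ℝ) : ℝ) : ℂ) := by rw [hK]; push_cast; ring
    rw [this]
    have h2 : x ^ 2 + ((m + 2 : ℕ) : ℝ) ≠ 0 := by positivity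
    exact_mod_cast h2
  have hx0 : ∀ x ∈ Ioo (0 : ℝ) 1, (x : ℂ) ≠ 0 := fun x hx => by exact_mod_cast hx.1.ne'
  have hx1 : ∀ x ∈ Ioo (0 : ℝ) 1, 1 - (x : ℂ) ^ 2 ≠ 0 := by
    intro x hx
    have h2 : (1 - x ^ 2 : ℝ) ≠ 0 := by nlinarith [hx.1, hx.2]
    exact_mod_cast h2
  obtain ⟨D, hD⟩ : ∃ D, D = derivWithin u (Icc 0 1) := ⟨_, rfl⟩
  obtain ⟨D2, hD2⟩ : ∃ D2, D2 = derivWithin D (Icc 0 1) := ⟨_, rfl⟩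
  obtain ⟨hu1, hDs⟩ := (contDiffOn_infty_iff_derivWithin hud).mp hu
  rw [← hD] at hDs
  obtain ⟨hD1, hD2s⟩ := (contDiffOn_infty_iff_derivWithin hud).mp hDs
  rw [← hD2] at hD2s
  have hder : ∀ x ∈ Ioo (0 : ℝ) 1, HasDerivAt u (D x) x := by
    intro x hx
    rw [hD]
    exact (hu1 x (Ioo_subset_Icc_self hx)).hasDerivWithinAt.hasDerivAt (Icc_mem_nhds hx.1 hx.2)
  have hder2 : ∀ x ∈ Ioo (0 : ℝ) 1, HasDerivAt D (D2 x) x := by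
    intro x hx
    rw [hD2]
    exact (hD1 x (Ioo_subset_Icc_self hx)).hasDerivWithinAt.hasDerivAt (Icc_mem_nhds hx.1 hx.2)
  have hode' : ∀ x ∈ Ioo (0 : ℝ) 1, (1 - (x : ℂ) ^ 2) * D2 x
      + ((K + 1) / x - 2 * (lam + 1) * x) * D x - lam * (lam + 1) * u x
      - ((K + 1) / (x : ℂ) ^ 2 * (((x : ℂ) ^ 4 + (-6 * K) * (x : ℂ) ^ 2 + K ^ 2)
        / ((x : ℂ) ^ 2 + K) ^ 2)) * u x = 0 := by
    intro x hx
    have e1 : deriv u =ᶠ[𝓝 x] D := by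
      filter_upwards [Ioo_mem_nhds hx.1 hx.2] with y hy using (hder y hy).deriv
    have := hode x hx
    rw [e1.deriv_eq, (hder2 x hx).deriv, (hder x hx).deriv, V, hdK] at this
    rw [← this]
    ring_nf
  -- continuity helper: functions continuous on `[0,1]` vanishing inside vanish at the ends
  have hext : ∀ f : ℝ → ℂ, ContinuousOn f (Icc 0 1) → (∀ x ∈ Ioo (0 : ℝ) 1, f x = 0) →
      EqOn f 0 (Icc 0 1) := by
    intro f hf hz
    have : EqOn f 0 (closure (Ioo (0 : ℝ) 1)) := by
      apply EqOn.of_subset_closure (s := Ioo (0 : ℝ) 1) (t := closure (Ioo (0 : ℝ) 1)) hz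
      · rwa [closure_Ioo zero_ne_one]
      · exact continuousOn_const
      · exact subset_closure
      · exact subset_rfl
    rwa [closure_Ioo zero_ne_one] at this
  have huc := hu.continuousOn
  have hDc := hDs.continuousOn
  have hD2c := hD2s.continuousOn
  have hK0 : K ≠ 0 := by simpa using hKx 0
  have hu0 : u 0 = 0 := by
    have := hext (fun x => ((x : ℂ) ^ 2 * (1 - (x : ℂ) ^ 2) * D2 x
      + ((K + 1) * x - 2 * (lam + 1) * (x : ℂ) ^ 3) * D x - (x : ℂ) ^ 2 * lam * (lam + 1) * u x)
        * ((x : ℂ) ^ 2 + K) ^ 2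
      - (K + 1) * ((x : ℂ) ^ 4 + (-6 * K) * (x : ℂ) ^ 2 + K ^ 2) * u x) (by fun_prop) (by
        intro x hx
        have h3 := hode' x hx
        have h4 := hx0 x hx
        have h5 := hKx x
        field_simp at h3
        linear_combination h3) ⟨le_rfl, zero_le_one⟩
    have hK1 : K + 1 ≠ 0 := by simpa [add_comm] using hKx 1
    simpa [hK0, hK1] using this
  have hg := exists_div u hu hu0
  obtain ⟨g, hgdef⟩ : ∃ g : ℝ → ℂ,
    g = (fun x => if x = 0 then derivWithin u (Icc 0 1) 0 else u x / (x : ℂ)) := ⟨_, rfl⟩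
  rw [← hgdef] at hg
  have hgx : ∀ x ∈ Ioo (0 : ℝ) 1, g x = u x / x := by
    intro x hx
    simp [hgdef, hx.1.ne']
  obtain ⟨v, hvdef⟩ : ∃ v : ℝ → ℂ, v = fun x : ℝ => (1 - (x : ℂ) ^ 2) * D x - (lam - 1) * x * u x
    - (1 - (x : ℂ) ^ 2) * (g x - 2 * x / ((x : ℂ) ^ 2 + K) * u x) := ⟨_, rfl⟩
  have hvx : ∀ x ∈ Ioo (0 : ℝ) 1, v x = (1 - (x : ℂ) ^ 2) *
      (D x - ((lam - 1) * x / (1 - (x : ℂ) ^ 2) + 1 / x - 2 * x / ((x : ℂ) ^ 2 + K)) * u x) := by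
    intro x hx
    have h3 := hx0 x hx
    have h4 := hx1 x hx
    have h5 := hKx x
    rw [hvdef]
    simp only [hgx x hx]
    field_simp
    ring
  have hco : ContDiff ℝ (⊤ : ℕ∞) (fun x : ℝ => (x : ℂ)) := Complex.ofRealCLM.contDiff
  have hvs : ContDiffOn ℝ (⊤ : ℕ∞) v (Icc 0 1) := by
    rw [hvdef]
    have hc := hco.contDiffOn (s := Icc (0 : ℝ) 1)
    have h1 : ContDiffOn ℝ (⊤ : ℕ∞) (fun x : ℝ => 1 - (x : ℂ) ^ 2) (Icc 0 1) :=
      contDiffOn_const.sub (hc.pow 2)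
    have h2 : ContDiffOn ℝ (⊤ : ℕ∞) (fun x : ℝ => 2 * (x : ℂ) / ((x : ℂ) ^ 2 + K)) (Icc 0 1) := by
      simp only [div_eq_mul_inv]
      exact (contDiffOn_const.mul hc).mul
        (((hc.pow 2).add contDiffOn_const).inv (fun x _ => hKx x))
    exact ((h1.mul hDs).sub ((contDiffOn_const.mul hc).mul hu)).sub (h1.mul (hg.sub (h2.mul hu)))
  have hp : ∀ x : ℝ, HasDerivAt (fun x : ℝ => 1 - (x : ℂ) ^ 2) (-2 * (x : ℂ)) x := by
    intro x
    have : HasDerivAt (fun r : ℂ => 1 - r ^ 2) (-2 * (x : ℂ)) (x : ℂ) := by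
      refine ((hasDerivAt_pow 2 (x : ℂ)).const_sub 1).congr_deriv ?_
      simp
    exact this.comp_ofReal
  have hv1 : ∀ x ∈ Ioo (0 : ℝ) 1, HasDerivAt v
      (((-2 * x - ((K + 1) / x - 2 * (lam + 1) * x) - (lam - 1) * x) / (1 - (x : ℂ) ^ 2)
        - 1 / x + 2 * x / ((x : ℂ) ^ 2 + K)) * v x
        + (lam - 1) * (lam - K) * u x / (1 - (x : ℂ) ^ 2)) x := by
    intro x hx
    have hR := (hdR K lam x (hx0 x hx) (hx1 x hx) (hKx x)).comp_ofReal
    have h3 := (hp x).mul ((hder2 x hx).sub (hR.mul (hder x hx)))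
    have h4 := h3.congr_deriv (alg1 x K lam (u x) (D x) (D2 x) (hx0 x hx) (hx1 x hx) (hKx x)
      (hode' x hx))
    rw [← hvx x hx] at h4
    refine h4.congr_of_eventuallyEq ?_
    filter_upwards [Ioo_mem_nhds hx.1 hx.2] with y hy using hvx y hy
  refine ⟨v, hvs, ?_, ?_⟩
  · intro x hx
    have hS := (hdS K lam x (hx0 x hx) (hx1 x hx) (hKx x)).comp_ofReal
    have e1 : deriv v =ᶠ[𝓝 x] fun x : ℝ =>
      ((-2 * (x : ℂ) - ((K + 1) / x - 2 * (lam + 1) * x) - (lam - 1) * x) / (1 - (x : ℂ) ^ 2)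
        - 1 / x + 2 * x / ((x : ℂ) ^ 2 + K)) * v x
        + (lam - 1) * (lam - K) * u x / (1 - (x : ℂ) ^ 2) := by
      filter_upwards [Ioo_mem_nhds hx.1 hx.2] with y hy using (hv1 y hy).deriv
    have h3 := (hS.mul (hv1 x hx)).add
      ((((hder x hx).const_mul ((lam - 1) * (lam - K))).div (hp x) (hx1 x hx)))
    have h4 : deriv (deriv v) x = _ := e1.deriv_eq.trans h3.deriv
    rw [h4, (hv1 x hx).deriv]
    have h5 := alg2 x K lam (u x) (D x) (v x) _ (hx0 x hx) (hx1 x hx) (hKx x) (hvx x hx) rfl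
    rw [← h5]
    ring
  · intro hv0
    apply hnz
    apply hext u huc
    intro x hx
    have hvz : ∀ y ∈ Ioo (0 : ℝ) 1, v y = 0 := fun y hy => hv0 (Ioo_subset_Icc_self hy)
    by_cases hlK : lam = K
    · subst hlK
      have hQ : ∀ y ∈ Ioo (0 : ℝ) 1, HasDerivAt (fun y : ℝ => u y ^ 2 *
          ((1 - (y : ℂ) ^ 2) ^ (m + 1) * ((y : ℂ) ^ 2 + lam) ^ 2 / (y : ℂ) ^ 2)) 0 y := by
        intro y hy
        have h3 := ((hder y hy).pow 2).mul
          (hdQ m lam y (hx0 y hy) (hx1 y hy) (hKx y) hKm).comp_ofReal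
        refine h3.congr_deriv ?_
        have h4 := hvx y hy
        rw [hvz y hy] at h4
        have h5 := (mul_eq_zero.mp h4.symm).resolve_left (hx1 y hy)
        rw [sub_eq_zero.mp h5]
        simp only [Pi.pow_apply]
        push_cast
        ring
      have h6 := constant_of_has_deriv_right_zero (a := x) (b := 1) (f := fun y : ℝ => u y ^ 2 *
          ((1 - (y : ℂ) ^ 2) ^ (m + 1) * ((y : ℂ) ^ 2 + lam) ^ 2 / (y : ℂ) ^ 2))
        (by
          have huc' : ContinuousOn u (Icc x 1) := huc.mono (Icc_subset_Icc_left hx.1.le)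
          refine (huc'.pow 2).mul (ContinuousOn.div (by fun_prop) (by fun_prop) ?_)
          intro y hy
          have : (y : ℂ) ≠ 0 := by exact_mod_cast (hx.1.trans_le hy.1).ne'
          exact pow_ne_zero 2 this)
        (fun y hy => (hQ y ⟨hx.1.trans_le hy.1, hy.2⟩).hasDerivWithinAt) 1 ⟨hx.2.le, le_rfl⟩
      have h7 := hx0 x hx
      have h8 := hx1 x hx
      have h9 := hKx x
      simpa [h7, h8, h9] using h6.symm
    · have h3 := (hv1 x hx).deriv
      have e1 : v =ᶠ[𝓝 x] fun _ => 0 := by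
        filter_upwards [Ioo_mem_nhds hx.1 hx.2] with y hy using hvz y hy
      rw [e1.deriv_eq, hvz x hx] at h3
      simpa [hx1 x hx, sub_eq_zero, hne, hlK] using h3.symm
end
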